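/- arXiv:2107.06583 — 2 statements merged into one kernel-verified Lean document; each statement's English description precedes it below -/
import Mathlib

section
/- There exists some ε₁ > 0 such that, for any 0 < ε₂ < 1/5 and k ≥ 10, there exists d₀ = d₀(ε₁,ε₂,k) such that the following holds for each n ≥ d ≥ d₀. Suppose G is an n-vertex TK_{d/2}^(2)-free bipartite (ε₁, ε₂·d)-expander with minimum degree δ(G) ≥ d. Suppose log^{10} n ≤ D ≤ log^k n, U ⊆ V(G) with |U| ≤ D/(2 log³ n), and let m = (800/ε₁)·log³ n. Suppose F₁, F₂ ⊆ G − U are vertex disjoint subgraphs such that F_i is a (D,m)-expansion of v_i for i ∈ {1,2}. Let ℓ be an integer with log⁷ n ≤ ℓ ≤ n/log^{10} n and ℓ ≡ π(v₁,v₂,G) (mod 2). Then there is a v₁,v₂-path of length ℓ in G − U. -/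
open Real

namespace Balanced

variable {V : Type*}

/-- The external neighbourhood of a vertex set `X` in `G`. -/
def extNbr (G : SimpleGraph V) (X : Set V) : Set V := {v | v ∉ X ∧ ∃ u ∈ X, G.Adj u v}

/-- The Komlós–Szemerédi expansion function `ε(x, ε₁, k)`. -/
noncomputable def epsFn (ε₁ k x : ℝ) : ℝ :=
  if x < k / 5 then 0 else ε₁ / (Real.log (15 * x / k)) ^ 2

/-- `G` is an `(ε₁, k)`-expander. -/
def IsExpander (G : SimpleGraph V) (ε₁ k : ℝ) : Prop :=
  ∀ X : Set V, k / 2 ≤ (X.ncard : ℝ) → (X.ncard : ℝ) ≤ (Nat.card V : ℝ) / 2 →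
    epsFn ε₁ k (X.ncard : ℝ) * (X.ncard : ℝ) ≤ ((extNbr G X).ncard : ℝ)

/-- `G` is bipartite. -/
def IsBip (G : SimpleGraph V) : Prop := ∃ f : V → Bool, ∀ u v, G.Adj u v → f u ≠ f v

/-- The average degree `2|E(G)|/|V(G)|` of `G`. -/
noncomputable def avgDeg (G : SimpleGraph V) : ℝ :=
  2 * (Nat.card G.edgeSet : ℝ) / (Nat.card V : ℝ)

/-- The minimum degree of `G` is at least `d`. -/
def MinDegGE (G : SimpleGraph V) (d : ℝ) : Prop :=
  ∀ v : V, d ≤ ((G.neighborSet v).ncard : ℝ)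

/-- The support of a walk, as a set of vertices. -/
def suppSet {G : SimpleGraph V} {a b : V} (w : G.Walk a b) : Set V := {x | x ∈ w.support}

/-- `G` contains an `ℓ`-balanced subdivision `TK_k^(ℓ)` of the complete graph `K_k`:
there are `k` core vertices joined pairwise by internally vertex-disjoint paths of
length exactly `ℓ`, whose internal vertices avoid all core vertices. -/
def ContainsBalSub (G : SimpleGraph V) (k ℓ : ℕ) : Prop :=
  ∃ c : Fin k → V, Function.Injective c ∧
    ∃ P : ∀ i j : Fin k, i < j → G.Walk (c i) (c j),
      (∀ i j (h : i < j), (P i j h).IsPath ∧ (P i j h).length = ℓ) ∧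
      (∀ i j (h : i < j) (q : Fin k), c q ∈ (P i j h).support → q = i ∨ q = j) ∧
      (∀ i j (h : i < j) i' j' (h' : i' < j'), (i, j) ≠ (i', j') →
        ∀ x, x ∈ (P i j h).support → x ∈ (P i' j' h').support →
          (x = c i ∨ x = c j) ∧ (x = c i' ∨ x = c j'))

/-- The subgraph `F` of `G` is a `(D, m)`-expansion of the vertex `v`:
`|V(F)| = D` and every vertex of `F` is at distance at most `m` from `v` in `F`. -/
def IsExpansion (G : SimpleGraph V) (F : G.Subgraph) (v : V) (D m : ℝ) : Prop :=
  ∃ hv : v ∈ F.verts, ((F.verts.ncard : ℝ) = D ∧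
    ∀ u, ∀ hu : u ∈ F.verts, ∃ w : F.coe.Walk ⟨v, hv⟩ ⟨u, hu⟩, (w.length : ℝ) ≤ m)

/-- `G` contains a `(D, m, k)`-adjuster. -/
def HasAdjuster (G : SimpleGraph V) (D m : ℝ) (k : ℕ) : Prop :=
  ∃ (v₁ v₂ : V) (F₁ F₂ : G.Subgraph) (A : Set V),
    Disjoint A F₁.verts ∧ Disjoint A F₂.verts ∧ Disjoint F₁.verts F₂.verts ∧
    IsExpansion G F₁ v₁ D m ∧ IsExpansion G F₂ v₂ D m ∧
    (A.ncard : ℝ) ≤ 10 * m * (k : ℝ) ∧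
    ∃ ℓ : ℕ, ∀ i : ℕ, i ≤ k → ∃ w : G.Walk v₁ v₂, w.IsPath ∧
      w.length = ℓ + 2 * i ∧ ∀ x ∈ w.support, x ∈ A ∪ {v₁, v₂}

open Classical in
/-- `π(u, v, G)` for a connected bipartite graph `G`: `0` if `u = v`, `1` if `u, v`
lie in different classes of the bipartition (equivalently, are joined by an odd walk),
and `2` otherwise. -/
noncomputable def piVal (G : SimpleGraph V) (u v : V) : ℕ :=
  if u = v then 0 else if ∃ w : G.Walk u v, Odd w.length then 1 else 2

/-- The ball of radius `r` around `v` in the subgraph of `G` induced on `S`,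
viewed as a subset of `V`. -/
def ballIn (G : SimpleGraph V) (S : Set V) (v : V) (r : ℕ) : Set V :=
  {u | ∃ w : G.Walk v u, w.length ≤ r ∧ ∀ x ∈ w.support, x ∈ S}

/-- The ball of radius `r` around the set `Y` in the subgraph of `G` induced on `S`. -/
def ballSetIn (G : SimpleGraph V) (S : Set V) (Y : Set V) (r : ℕ) : Set V :=
  {u | ∃ y ∈ Y, ∃ w : G.Walk y u, w.length ≤ r ∧ ∀ x ∈ w.support, x ∈ S}

/-- `P 0, …, P (q-1)` are consecutive shortest paths from `v` in the vertex set `W`: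
each `P i` is a shortest path between its endpoints in the graph induced on
`(W \ ⋃_{j<i} V(P j)) ∪ {v}`. -/
def ConsecSP (G : SimpleGraph V) (v : V) (W : Set V) {q : ℕ}
    (P : Fin q → Σ u : V, G.Walk v u) : Prop :=
  ∀ i : Fin q,
    (∀ x ∈ suppSet (P i).2,
      x ∈ (W \ ⋃ (j : Fin q) (_ : j < i), suppSet (P j).2) ∪ {v}) ∧
    ((P i).2).IsPath ∧
    ∀ w' : G.Walk v (P i).1,
      (∀ x ∈ suppSet w',
        x ∈ (W \ ⋃ (j : Fin q) (_ : j < i), suppSet (P j).2) ∪ {v}) →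
      ((P i).2).length ≤ w'.length

/-- `v` is an end vertex of the path `p`. -/
def IsEnd (G : SimpleGraph V) (v : V) (p : Σ a b : V, G.Walk a b) : Prop :=
  v = p.1 ∨ v = p.2.1

/-- `t` is the subpath `p(v, r)` of `p` of length `r` having `v` as an end vertex. -/
def IsTrunc (G : SimpleGraph V) (r : ℕ) (p : Σ a b : V, G.Walk a b) (v : V)
    (t : Σ u : V, G.Walk v u) : Prop :=
  t.2.length = r ∧ ∃ (c : V) (w' : G.Walk t.1 c),
    (⟨v, c, t.2.append w'⟩ : Σ a b : V, G.Walk a b) = p ∨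
    (⟨v, c, t.2.append w'⟩ : Σ a b : V, G.Walk a b) = ⟨p.2.1, p.1, p.2.2.reverse⟩

section
open scoped Classical
open Finset

variable {V : Type*} {G : SimpleGraph V}

/-- `a` and `b` are joined by a walk of length at most `i` with all vertices in `S`. -/
def JoinedIn (G : SimpleGraph V) (S : Finset V) (i : ℕ) (a b : V) : Prop :=
  ∃ w : G.Walk a b, w.length ≤ i ∧ ∀ x ∈ w.support, x ∈ S

/-- `S` contains `v`, and all its vertices are joined to `v` inside `S` by walks of length at
most `ρ`. -/
def IsRad (G : SimpleGraph V) (ρ : ℕ) (v : V) (S : Finset V) : Prop :=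
  v ∈ S ∧ ∀ x ∈ S, JoinedIn G S ρ v x

namespace JoinedIn

variable {S T : Finset V} {i j : ℕ} {a b c : V}

lemma refl (h : a ∈ S) : JoinedIn G S i a a := ⟨.nil, by simp, by simpa using h⟩

lemma mono (h : JoinedIn G S i a b) (hST : S ⊆ T) (hij : i ≤ j) : JoinedIn G T j a b := by
  obtain ⟨w, h1, h2⟩ := h
  exact ⟨w, h1.trans hij, fun x hx => hST (h2 x hx)⟩

lemma symm (h : JoinedIn G S i a b) : JoinedIn G S i b a := by
  obtain ⟨w, h1, h2⟩ := h
  exact ⟨w.reverse, by simpa using h1, fun x hx => h2 x (by simpa using hx)⟩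

lemma trans (h : JoinedIn G S i a b) (h' : JoinedIn G S j b c) : JoinedIn G S (i + j) a c := by
  obtain ⟨w, h1, h2⟩ := h
  obtain ⟨w', h1', h2'⟩ := h'
  refine ⟨w.append w', by rw [SimpleGraph.Walk.length_append]; omega, fun x hx => ?_⟩
  rcases (SimpleGraph.Walk.mem_support_append_iff _ _).mp hx with hx | hx
  exacts [h2 x hx, h2' x hx]

lemma left_mem (h : JoinedIn G S i a b) : a ∈ S := by
  obtain ⟨w, -, h2⟩ := h
  exact h2 a w.start_mem_support

lemma right_mem (h : JoinedIn G S i a b) : b ∈ S := h.symm.left_mem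

lemma of_adj (ha : a ∈ S) (hb : b ∈ S) (hab : G.Adj a b) : JoinedIn G S 1 a b :=
  ⟨hab.toWalk, by simp, by simp [ha, hb]⟩

lemma step (h : JoinedIn G S i a b) (hbc : G.Adj b c) (hc : c ∈ S) : JoinedIn G S (i + 1) a c :=
  h.trans (of_adj h.right_mem hc hbc)

lemma exists_path (h : JoinedIn G S i a b) :
    ∃ w : G.Walk a b, w.IsPath ∧ w.length ≤ i ∧ ∀ x ∈ w.support, x ∈ S := by
  obtain ⟨w, h1, h2⟩ := h
  exact ⟨w.bypass, w.bypass_isPath, w.length_bypass_le_length.trans h1,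
    fun x hx => h2 x (w.support_bypass_subset_support hx)⟩

/-- A walk to a set can be cut to a path which meets the set only in its last vertex. -/
lemma exists_path_first_hit (h : JoinedIn G S i a b) (hb : b ∈ T) :
    ∃ t ∈ T, ∃ w : G.Walk a t, w.IsPath ∧ w.length ≤ i ∧ (∀ x ∈ w.support, x ∈ S) ∧
      ∀ x ∈ w.support, x ∈ T → x = t := by
  obtain ⟨w, h1, h2⟩ := h
  have key : ∃ t ∈ T, ∃ w' : G.Walk a t, w'.length ≤ w.length ∧
      (∀ x ∈ w'.support, x ∈ w.support) ∧ ∀ x ∈ w'.support, x ∈ T → x = t := by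
    clear h1 h2
    induction w with
    | nil => exact ⟨_, hb, .nil, by simp⟩
    | @cons u v w hadj p ih =>
      by_cases hu : u ∈ T
      · exact ⟨u, hu, .nil, by simp⟩
      · obtain ⟨t, ht, w', h1, h2, h3⟩ := ih hb
        refine ⟨t, ht, .cons hadj w', by simpa using h1, fun x hx => ?_, fun x hx hxT => ?_⟩
        · rw [SimpleGraph.Walk.support_cons, List.mem_cons] at hx ⊢
          exact hx.imp id (h2 x)
        · rw [SimpleGraph.Walk.support_cons, List.mem_cons] at hx
          rcases hx with rfl | hx
          exacts [(hu hxT).elim, h3 x hx hxT]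
  obtain ⟨t, ht, w', h1', h2', h3'⟩ := key
  exact ⟨t, ht, w'.bypass, w'.bypass_isPath, w'.length_bypass_le_length.trans (h1'.trans h1),
    fun x hx => h2 x (h2' x (w'.support_bypass_subset_support hx)),
    fun x hx => h3' x (w'.support_bypass_subset_support hx)⟩

/-- Either a vertex can be deleted, or it is reached earlier. -/
lemma erase_or (h : JoinedIn G S i a b) {x : V} (hxb : x ≠ b) :
    JoinedIn G (S.erase x) i a b ∨ ∃ j < i, JoinedIn G S j a x := by
  obtain ⟨w, h1, h2⟩ := h
  by_cases hx : x ∈ w.support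
  · refine Or.inr ⟨(w.takeUntil x hx).length,
      (SimpleGraph.Walk.length_takeUntil_lt_length hx hxb).trans_le h1, w.takeUntil x hx, le_rfl,
      fun y hy => h2 y (w.support_takeUntil_subset_support hx hy)⟩
  · exact Or.inl ⟨w, h1, fun y hy => mem_erase.mpr ⟨fun h => hx (h ▸ hy), h2 y hy⟩⟩

end JoinedIn

lemma IsRad.exists_erase {ρ : ℕ} {v : V} {S : Finset V} (h : IsRad G ρ v S)
    (hS : 1 < #S) : ∃ x ∈ S, IsRad G ρ v (S.erase x) := by
  have hex : ∀ x ∈ S, ∃ i, JoinedIn G S i v x := fun x hx => ⟨ρ, h.2 x hx⟩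
  let dd : V → ℕ := fun x => if hx : x ∈ S then Nat.find (hex x hx) else 0
  have hdd : ∀ x ∈ S, JoinedIn G S (dd x) v x := fun x hx => by
    simp only [dd, hx, dif_pos]; exact Nat.find_spec (hex x hx)
  have hmin : ∀ x ∈ S, ∀ j, JoinedIn G S j v x → dd x ≤ j := fun x hx j hj => by
    simp only [dd, hx, dif_pos]; exact Nat.find_min' (hex x hx) hj
  have hne : (S.erase v).Nonempty := by
    rw [← card_pos, card_erase_of_mem h.1]; omega
  obtain ⟨x, hx, hmax⟩ := exists_max_image _ dd hne
  rw [mem_erase] at hx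
  refine ⟨x, hx.2, mem_erase.mpr ⟨hx.1.symm, h.1⟩, fun y hy => ?_⟩
  rw [mem_erase] at hy
  rcases (hdd y hy.2).erase_or (x := x) hy.1.symm with h1 | ⟨j, hj, h1⟩
  · exact h1.mono subset_rfl (hmin y hy.2 _ (h.2 y hy.2))
  · exfalso
    have := hmin x hx.2 j h1
    by_cases hyv : y = v
    · have h0 : dd y ≤ 0 := hmin y hy.2 0 (by rw [hyv]; exact JoinedIn.refl h.1)
      omega
    · have := hmax y (mem_erase.mpr ⟨hyv, hy.2⟩)
      omega

/-- Truncation of a set of bounded radius to any prescribed size. -/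
lemma IsRad.exists_subset_card {ρ : ℕ} {v : V} {S : Finset V} (h : IsRad G ρ v S) {s : ℕ}
    (hs : 1 ≤ s) (hsS : s ≤ #S) : ∃ T ⊆ S, #T = s ∧ IsRad G ρ v T := by
  obtain ⟨t, ht⟩ := Nat.exists_eq_add_of_le hsS
  induction t generalizing S with
  | zero => exact ⟨S, subset_rfl, by omega, h⟩
  | succ t ih =>
    obtain ⟨x, hx, hr⟩ := h.exists_erase (by omega)
    have hc : #(S.erase x) = s + t := by rw [card_erase_of_mem hx]; omega
    obtain ⟨T, hT, h1, h2⟩ := ih hr (by omega) hc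
    exact ⟨T, hT.trans (erase_subset _ _), h1, h2⟩

variable [Fintype V]

/-- The external neighbourhood of a finite vertex set, as a finset. -/
noncomputable def extN (G : SimpleGraph V) (X : Finset V) : Finset V :=
  univ.filter fun v => v ∉ X ∧ ∃ u ∈ X, G.Adj u v

/-- The neighbourhood of a vertex, as a finset. -/
noncomputable def nbr (G : SimpleGraph V) (v : V) : Finset V := univ.filter fun u => G.Adj v u

@[simp] lemma mem_extN {X : Finset V} {v : V} :
    v ∈ extN G X ↔ v ∉ X ∧ ∃ u ∈ X, G.Adj u v := by simp [extN]

@[simp] lemma mem_nbr {u v : V} : u ∈ nbr G v ↔ G.Adj v u := by simp [nbr]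

/-- Growing a set inside a region with relative expansion rate `1 / C`. -/
lemma exists_growth {C N R : ℕ} (hR : Fintype.card V * C ^ R < (C + 1) ^ R)
    {S Y : Finset V} (hY : Y.Nonempty) (hYS : Y ⊆ S)
    (hexp : ∀ X, Y ⊆ X → X ⊆ S → #X ≤ N → #X ≤ C * #(extN G X ∩ S)) :
    ∃ B, Y ⊆ B ∧ B ⊆ S ∧ N < #B ∧ ∀ x ∈ B, ∃ y ∈ Y, JoinedIn G B R y x := by
  have key : ∀ i : ℕ, ∃ B, Y ⊆ B ∧ B ⊆ S ∧ (N < #B ∨ (C + 1) ^ i ≤ C ^ i * #B) ∧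
      ∀ x ∈ B, ∃ y ∈ Y, JoinedIn G B i y x := by
    intro i
    induction i with
    | zero =>
      exact ⟨Y, subset_rfl, hYS, Or.inr (by simpa using hY.card_pos),
        fun x hx => ⟨x, hx, .refl hx⟩⟩
    | succ i ih =>
      obtain ⟨B, h1, h2, h3, h4⟩ := ih
      by_cases hB : N < #B
      · exact ⟨B, h1, h2, Or.inl hB, fun x hx => by
          obtain ⟨y, hy, hj⟩ := h4 x hx
          exact ⟨y, hy, hj.mono subset_rfl (by omega)⟩⟩
      · have h3 := h3.resolve_left hB
        have h5 := hexp B h1 h2 (by omega)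
        have hdisj : Disjoint B (extN G B ∩ S) := by
          rw [disjoint_left]
          intro x hx hx'
          simp only [mem_inter, mem_extN] at hx'
          exact hx'.1.1 hx
        refine ⟨B ∪ (extN G B ∩ S), h1.trans subset_union_left,
          union_subset h2 inter_subset_right, Or.inr ?_, fun x hx => ?_⟩
        · rw [card_union_of_disjoint hdisj]
          calc (C + 1) ^ (i + 1) = (C + 1) ^ i * (C + 1) := pow_succ _ _
            _ ≤ (C ^ i * #B) * (C + 1) := Nat.mul_le_mul_right _ h3
            _ = C ^ i * (C * #B + #B) := by ring
            _ ≤ C ^ i * (C * #B + C * #(extN G B ∩ S)) := by gcongr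
            _ = C ^ (i + 1) * (#B + #(extN G B ∩ S)) := by ring
        · rcases mem_union.mp hx with hx' | hx'
          · obtain ⟨y, hy, hj⟩ := h4 x hx'
            exact ⟨y, hy, hj.mono subset_union_left (by omega)⟩
          · simp only [mem_inter, mem_extN] at hx'
            obtain ⟨⟨-, u, hu, hux⟩, -⟩ := hx'
            obtain ⟨y, hy, hj⟩ := h4 u hu
            exact ⟨y, hy, (hj.mono subset_union_left le_rfl).step hux hx⟩
  obtain ⟨B, h1, h2, h3, h4⟩ := key R
  refine ⟨B, h1, h2, h3.resolve_right fun h => ?_, h4⟩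
  have : C ^ R * #B ≤ Fintype.card V * C ^ R := by
    rw [mul_comm]; exact Nat.mul_le_mul_right _ (card_le_univ B)
  omega

lemma IsRad.exists_growth {C N R ρ : ℕ}
    (hR : Fintype.card V * C ^ R < (C + 1) ^ R)
    {S Y : Finset V} {v : V} (hY : IsRad G ρ v Y) (hYS : Y ⊆ S)
    (hexp : ∀ X, Y ⊆ X → X ⊆ S → #X ≤ N → #X ≤ C * #(extN G X ∩ S)) :
    ∃ B, Y ⊆ B ∧ B ⊆ S ∧ N < #B ∧ IsRad G (ρ + R) v B := by
  obtain ⟨B, h1, h2, h3, h4⟩ := Balanced.exists_growth hR ⟨v, hY.1⟩ hYS hexp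
  refine ⟨B, h1, h2, h3, h1 hY.1, fun x hx => ?_⟩
  obtain ⟨y, hy, hj⟩ := h4 x hx
  exact ((hY.2 y hy).mono h1 le_rfl).trans hj

/-- Two sets which both grow beyond half of the vertices in a region are connected in it. -/
lemma exists_joinedIn_of_growth {C R : ℕ}
    (hR : Fintype.card V * C ^ R < (C + 1) ^ R)
    {S Y Z : Finset V} (hY : Y.Nonempty) (hZ : Z.Nonempty) (hYS : Y ⊆ S) (hZS : Z ⊆ S)
    (hexpY : ∀ X, Y ⊆ X → X ⊆ S → #X ≤ Fintype.card V / 2 → #X ≤ C * #(extN G X ∩ S))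
    (hexpZ : ∀ X, Z ⊆ X → X ⊆ S → #X ≤ Fintype.card V / 2 → #X ≤ C * #(extN G X ∩ S)) :
    ∃ y ∈ Y, ∃ z ∈ Z, JoinedIn G S (R + R) y z := by
  obtain ⟨B, -, h2, h3, h4⟩ := exists_growth hR hY hYS hexpY
  obtain ⟨B', -, h2', h3', h4'⟩ := exists_growth hR hZ hZS hexpZ
  have : ¬ Disjoint B B' := fun hd => by
    have := card_union_of_disjoint hd
    have h5 := card_le_univ (B ∪ B')
    omega
  obtain ⟨x, hx, hx'⟩ := not_disjoint_iff.mp this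
  obtain ⟨y, hy, hj⟩ := h4 x hx
  obtain ⟨z, hz, hj'⟩ := h4' x hx'
  exact ⟨y, hy, z, hz, (hj.mono h2 le_rfl).trans (hj'.mono h2' le_rfl).symm⟩

end

section
open scoped Classical
open Finset

variable {V : Type*} {G : SimpleGraph V}

/-- If the neighbours of `v` in `W` are pairwise connected through distinct outside vertices,
there is a subdivision. -/
lemma containsBalSub_two_of_injOn {h : ℕ} {W T : Finset V} (hTW : T ⊆ W) (hT : h ≤ #T)
    (g : V → Sym2 V)
    (hg : ∀ a ∈ T, ∀ b ∈ T, a ≠ b → ∃ u ∉ W, g u = s(a, b) ∧ G.Adj a u ∧ G.Adj u b) :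
    ContainsBalSub G h 2 := by
  obtain ⟨c⟩ : Nonempty (Fin h ↪ T) :=
    Function.Embedding.nonempty_of_card_le (by simpa using hT)
  have hinj : Function.Injective fun i => (c i : V) := fun i j hij =>
    c.injective (Subtype.ext hij)
  choose! u hu1 hu2 hu3 hu4 using hg
  have hne : ∀ i j : Fin h, i < j → (c i : V) ≠ c j := fun i j hij h' => hij.ne (hinj h')
  refine ⟨fun i => c i, hinj, fun i j hij =>
    .cons (hu3 _ (c i).2 _ (c j).2 (hne i j hij))
      (.cons (hu4 _ (c i).2 _ (c j).2 (hne i j hij)) .nil), ?_, ?_, ?_⟩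
  · intro i j hij
    refine ⟨?_, rfl⟩
    have h1 := (hu3 _ (c i).2 _ (c j).2 (hne i j hij)).ne
    have h2 := (hu4 _ (c i).2 _ (c j).2 (hne i j hij)).ne
    have h3 := hne i j hij
    simp [SimpleGraph.Walk.isPath_def, h1, h2, h3]
  · intro i j hij q hq
    simp only [SimpleGraph.Walk.support_cons, SimpleGraph.Walk.support_nil, List.mem_cons,
      List.not_mem_nil, or_false] at hq
    rcases hq with hq | hq | hq
    · exact Or.inl (hinj hq)
    · exact (hu1 _ (c i).2 _ (c j).2 (hne i j hij) (hq ▸ hTW (c q).2)).elim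
    · exact Or.inr (hinj hq)
  · intro i j hij i' j' hij' hne' x hx hx'
    simp only [SimpleGraph.Walk.support_cons, SimpleGraph.Walk.support_nil, List.mem_cons,
      List.not_mem_nil, or_false] at hx hx'
    have hm := hu1 _ (c i).2 _ (c j).2 (hne i j hij)
    have hm' := hu1 _ (c i').2 _ (c j').2 (hne i' j' hij')
    have hW : ∀ q : Fin h, (c q : V) ∈ W := fun q => hTW (c q).2
    rcases hx with hx | hx | hx
    · refine ⟨Or.inl hx, ?_⟩
      rcases hx' with hx' | hx' | hx'
      · exact Or.inl hx'
      · exact (hm' (by rw [← hx', hx]; exact hW i)).elim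
      · exact Or.inr hx'
    · rcases hx' with hx' | hx' | hx'
      · exact (hm (by rw [← hx, hx']; exact hW _)).elim
      · exfalso
        have e1 := hu2 _ (c i).2 _ (c j).2 (hne i j hij)
        have e2 := hu2 _ (c i').2 _ (c j').2 (hne i' j' hij')
        rw [← hx, hx', e2] at e1
        rw [Sym2.eq_iff] at e1
        rcases e1 with ⟨a, b⟩ | ⟨a, b⟩
        · have a := hinj a
          have b := hinj b
          exact hne' (by rw [a, b])
        · have a := hinj a
          have b := hinj b
          subst a b
          exact absurd hij (not_lt.mpr hij'.le)
      · exact (hm (by rw [← hx, hx']; exact hW _)).elim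
    · refine ⟨Or.inr hx, ?_⟩
      rcases hx' with hx' | hx' | hx'
      · exact Or.inl hx'
      · exact (hm' (by rw [← hx', hx]; exact hW j)).elim
      · exact Or.inr hx'

variable [Fintype V]

/-- In a graph without a 1-subdivision of `K_h`, few vertices have `h` neighbours in a set. -/
lemma card_exceptional_le {h : ℕ} (hG : ¬ ContainsBalSub G h 2) (W : Finset V) :
    #{v | v ∉ W ∧ h ≤ #(nbr G v ∩ W)} ≤ #W ^ 2 := by
  by_contra! hlt
  set E : Finset V := {v | v ∉ W ∧ h ≤ #(nbr G v ∩ W)} with hE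
  let good : Finset V → Prop := fun F => ∃ g : V → Sym2 V, Set.InjOn g F ∧
    ∀ v ∈ F, g v ∈ W.sym2 ∧ ∀ a ∈ g v, G.Adj a v
  obtain ⟨F, hF, hmax⟩ := exists_max_image (E.powerset.filter good) card
    ⟨∅, mem_filter.mpr ⟨empty_mem_powerset _, fun v => s(v, v), by simp, by simp⟩⟩
  rw [mem_filter, mem_powerset] at hF
  obtain ⟨hFE, g, hinj, hg⟩ := hF
  have hFc : #F ≤ #W ^ 2 := by
    calc #F ≤ #W.sym2 := card_le_card_of_injOn g (fun v hv => (hg v hv).1) hinj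
      _ ≤ #W ^ 2 := by
        rw [card_sym2, Nat.choose_two_right]
        apply Nat.div_le_of_le_mul
        rcases Nat.eq_zero_or_pos #W with h0 | h0
        · simp [h0]
        · simp only [Nat.add_sub_cancel]; nlinarith
  obtain ⟨v, hvE, hvF⟩ := exists_mem_notMem_of_card_lt_card (hFc.trans_lt hlt)
  rw [hE, mem_filter] at hvE
  refine hG (containsBalSub_two_of_injOn (T := nbr G v ∩ W) inter_subset_right hvE.2.2 g ?_)
  intro a ha b hb hab
  rw [mem_inter, mem_nbr] at ha hb
  by_cases hu : ∃ u ∈ F, g u = s(a, b)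
  · obtain ⟨u, hu, hgu⟩ := hu
    have h1 := hFE hu
    rw [hE, mem_filter] at h1
    exact ⟨u, h1.2.1, hgu, (hg u hu).2 a (by simp [hgu]), ((hg u hu).2 b (by simp [hgu])).symm⟩
  · push Not at hu
    exfalso
    have hcard := hmax (insert v F) ?_
    · rw [card_insert_of_notMem hvF] at hcard; omega
    · rw [mem_filter, mem_powerset]
      refine ⟨insert_subset (by rw [hE, mem_filter]; exact hvE) hFE,
        Function.update g v s(a, b), ?_, ?_⟩
      · intro x hx y hy hxy
        rw [mem_coe, mem_insert] at hx hy
        have hne : ∀ z ∈ F, z ≠ v := fun z hz h => hvF (h ▸ hz)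
        rcases hx with rfl | hx <;> rcases hy with rfl | hy
        · rfl
        · rw [Function.update_self, Function.update_of_ne (hne y hy)] at hxy
          exact (hu y hy hxy.symm).elim
        · rw [Function.update_self, Function.update_of_ne (hne x hx)] at hxy
          exact (hu x hx hxy).elim
        · rw [Function.update_of_ne (hne x hx), Function.update_of_ne (hne y hy)] at hxy
          exact hinj hx hy hxy
      · intro x hx
        rcases mem_insert.mp hx with rfl | hx
        · rw [Function.update_self]
          refine ⟨by simp [ha.2, hb.2], fun y hy => ?_⟩
          rcases Sym2.mem_iff.mp hy with rfl | rfl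
          exacts [ha.1.symm, hb.1.symm]
        · rw [Function.update_of_ne (fun h => hvF (by rwa [h] at hx))]
          exact hg x hx

/-- Removing a maximal set with few neighbours leaves a region in which everything expands. -/
lemma exists_core (c cap : ℕ) (W : Finset V) :
    ∃ X : Finset V, Disjoint X W ∧ #X ≤ cap ∧ c * #(extN G X \ W) ≤ #X ∧
      ∀ Y : Finset V, Y.Nonempty → Disjoint Y (W ∪ X) → #X + #Y ≤ cap →
        #Y < c * #(extN G Y \ (W ∪ X)) := by
  obtain ⟨X, hX, hmax⟩ := exists_max_image
    (univ.filter fun X : Finset V => Disjoint X W ∧ #X ≤ cap ∧ c * #(extN G X \ W) ≤ #X) card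
    ⟨∅, mem_filter.mpr ⟨mem_univ _, by simp [extN]⟩⟩
  simp only [mem_filter, mem_univ, true_and] at hX hmax
  refine ⟨X, hX.1, hX.2.1, hX.2.2, fun Y hY hd hc => ?_⟩
  by_contra! hle
  rw [disjoint_union_right] at hd
  have hcard : #(X ∪ Y) = #X + #Y := card_union_of_disjoint hd.2.symm
  have h1 := hmax (X ∪ Y) ⟨disjoint_union_left.mpr ⟨hX.1, hd.1⟩, by omega, ?_⟩
  · have := hY.card_pos
    omega
  · have hsub : extN G (X ∪ Y) \ W ⊆ (extN G X \ W) ∪ (extN G Y \ (W ∪ X)) := by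
      intro v hv
      simp only [mem_sdiff, mem_union, mem_extN, not_or] at hv ⊢
      obtain ⟨⟨⟨hvX, hvY⟩, u, hu | hu, huv⟩, hvW⟩ := hv
      · exact Or.inl ⟨⟨hvX, u, hu, huv⟩, hvW⟩
      · exact Or.inr ⟨⟨hvY, u, hu, huv⟩, hvW, hvX⟩
    calc c * #(extN G (X ∪ Y) \ W) ≤ c * (#(extN G X \ W) + #(extN G Y \ (W ∪ X))) :=
          Nat.mul_le_mul_left _ ((card_le_card hsub).trans (card_union_le _ _))
      _ ≤ #X + #Y := by rw [mul_add]; exact Nat.add_le_add hX.2.2 hle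
      _ = #(X ∪ Y) := hcard.symm

end

section
open scoped Classical
open Finset

variable {V : Type*} {G : SimpleGraph V}

lemma JoinedIn.le_card {S : Finset V} {i : ℕ} {a b : V} (h : JoinedIn G S i a b) :
    JoinedIn G S #S a b := by
  obtain ⟨w, hp, -, hS⟩ := h.exists_path
  refine ⟨w, ?_, hS⟩
  have h1 : #w.support.toFinset = w.length + 1 := by
    rw [List.toFinset_card_of_nodup hp.support_nodup, SimpleGraph.Walk.length_support]
  have h2 : w.support.toFinset ⊆ S := fun x hx => hS x (by simpa using hx)
  have := card_le_card h2
  omega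

lemma card_powerset_filter_card_le (W : Finset V) (t : ℕ) :
    #{T ∈ W.powerset | #T ≤ t} ≤ (#W + 1) ^ t := by
  induction t with
  | zero =>
    calc _ ≤ #({∅} : Finset (Finset V)) := card_le_card fun T hT => by
            simpa using (mem_filter.mp hT).2
      _ ≤ _ := by simp
  | succ t ih =>
    have hsub : {T ∈ W.powerset | #T ≤ t + 1} ⊆ {T ∈ W.powerset | #T ≤ t} ∪
        (W ×ˢ {T ∈ W.powerset | #T ≤ t}).image fun p => insert p.1 p.2 := by
      intro T hT
      rw [mem_filter, mem_powerset] at hT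
      rw [mem_union, mem_filter, mem_powerset, mem_image]
      by_cases hc : #T ≤ t
      · exact Or.inl ⟨hT.1, hc⟩
      · obtain ⟨a, ha⟩ : T.Nonempty := card_pos.mp (by omega)
        refine Or.inr ⟨(a, T.erase a), ?_, insert_erase ha⟩
        rw [mem_product, mem_filter, mem_powerset]
        refine ⟨hT.1 ha, (erase_subset _ _).trans hT.1, ?_⟩
        rw [card_erase_of_mem ha]; omega
    calc _ ≤ _ := card_le_card hsub
      _ ≤ (#W + 1) ^ t + #W * (#W + 1) ^ t := (card_union_le _ _).trans
          (Nat.add_le_add ih (card_image_le.trans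
            (by rw [card_product]; exact Nat.mul_le_mul_left _ ih)))
      _ = (#W + 1) ^ (t + 1) := by ring

variable [Fintype V]

lemma card_joinedIn_le {S : Finset V} {Δ : ℕ} (hΔ : ∀ x ∈ S, #(nbr G x ∩ S) ≤ Δ) (z : V)
    (i : ℕ) : #{v | JoinedIn G S i z v} ≤ (1 + Δ) ^ i := by
  induction i with
  | zero =>
    calc _ ≤ #({z} : Finset V) := card_le_card fun v hv => by
            rw [mem_filter] at hv
            obtain ⟨w, hw, -⟩ := hv.2
            exact mem_singleton.mpr (SimpleGraph.Walk.eq_of_length_eq_zero (Nat.le_zero.mp hw)).symm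
      _ ≤ _ := by simp
  | succ i ih =>
    have hsub : ({v | JoinedIn G S (i + 1) z v} : Finset V) ⊆
        ({v | JoinedIn G S i z v} : Finset V) ∪
        ({v | JoinedIn G S i z v} : Finset V).biUnion fun x => nbr G x ∩ S := by
      intro v hv
      rw [mem_filter] at hv
      obtain ⟨w, hw, hS⟩ := hv.2
      have hS' : ∀ x ∈ w.reverse.support, x ∈ S := fun x hx => hS x (by simpa using hx)
      have hl : w.reverse.length ≤ i + 1 := by simpa using hw
      rw [mem_union, mem_biUnion]
      cases hq : w.reverse with
      | nil => exact Or.inl (by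
          rw [mem_filter]; exact ⟨mem_univ _, .refl (hS _ w.end_mem_support)⟩)
      | @cons _ u _ hadj p =>
        rw [hq] at hS' hl
        rw [SimpleGraph.Walk.length_cons] at hl
        refine Or.inr ⟨u, ?_, ?_⟩
        · rw [mem_filter]
          exact ⟨mem_univ _, JoinedIn.symm ⟨p, by omega, fun x hx => hS' x (by simp [hx])⟩⟩
        · rw [mem_inter, mem_nbr]
          exact ⟨hadj.symm, hS' _ (by simp)⟩
    have hb : ∀ x ∈ ({v | JoinedIn G S i z v} : Finset V), #(nbr G x ∩ S) ≤ Δ := fun x hx =>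
      hΔ x (mem_filter.mp hx).2.right_mem
    calc _ ≤ _ := card_le_card hsub
      _ ≤ (1 + Δ) ^ i + (1 + Δ) ^ i * Δ := (card_union_le _ _).trans
          (Nat.add_le_add ih ((card_biUnion_le_card_mul _ _ _ hb).trans
            (Nat.mul_le_mul_right _ ih)))
      _ = _ := by ring

/-- A small connected set outside `W` with exceptionally few neighbours outside `W`. -/
def IsBad (G : SimpleGraph V) (W : Finset V) (s₁ : ℕ) (Y : Finset V) : Prop :=
  Disjoint Y W ∧ (∃ ρ v, IsRad G ρ v Y) ∧ #Y ≤ s₁ ∧ #(extN G Y \ W) ^ 3 < #Y ^ 2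

lemma IsBad.nonempty {W Y : Finset V} {s₁ : ℕ} (h : IsBad G W s₁ Y) : Y.Nonempty := by
  obtain ⟨-, ⟨ρ, v, hv⟩, -⟩ := h
  exact ⟨v, hv.1⟩

lemma IsBad.card_lt {W Y : Finset V} {s₁ : ℕ} (h : IsBad G W s₁ Y) : #(extN G Y \ W) < #Y := by
  have h1 := h.2.2.2
  have h2 := h.nonempty.card_pos
  refine lt_of_pow_lt_pow_left₀ 3 (Nat.zero_le _) (h1.trans_le ?_)
  exact Nat.pow_le_pow_right h2 (by norm_num)

lemma IsBad.card_nbr_le {W Y : Finset V} {s₁ : ℕ} (h : IsBad G W s₁ Y) {v : V} (hv : v ∈ Y) :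
    #(nbr G v \ W) + 2 ≤ 2 * #Y := by
  have hsub : nbr G v \ W ⊆ (Y.erase v) ∪ (extN G Y \ W) := by
    intro x hx
    simp only [mem_sdiff, mem_nbr, mem_union, mem_erase, mem_extN] at hx ⊢
    by_cases hxY : x ∈ Y
    · exact Or.inl ⟨hx.1.ne', hxY⟩
    · exact Or.inr ⟨⟨hxY, v, hv, hx.1⟩, hx.2⟩
  have h1 := (card_le_card hsub).trans (card_union_le _ _)
  have h2 := h.card_lt
  have h3 := h.nonempty.card_pos
  rw [card_erase_of_mem hv] at h1
  omega

lemma IsBad.joinedIn {W Y : Finset V} {s₁ : ℕ} (h : IsBad G W s₁ Y) {x y : V} (hx : x ∈ Y)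
    (hy : y ∈ Y) : JoinedIn G Y s₁ x y := by
  obtain ⟨-, ⟨ρ, v, hv⟩, hc, -⟩ := h
  exact ((hv.2 x hx).symm.trans (hv.2 y hy)).le_card.mono subset_rfl hc

/-- Bad sets of equal size and equal trace on `W` are few, as their union must expand. -/
lemma card_bad_fiber_le {W : Finset V} {h s₁ s : ℕ} {T : Finset V}
    (htiny : ∀ s X, h ≤ 2 * s → s ≤ s₁ → Finset.Nonempty X → #X ≤ 2 * s ^ 3 →
      8 * #X ^ 3 < s * #(extN G X) ^ 3)
    {𝒴 : Finset (Finset V)} (hdisj : Set.PairwiseDisjoint (𝒴 : Set (Finset V)) id)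
    (hbad : ∀ Y ∈ 𝒴, IsBad G W s₁ Y ∧ #Y = s ∧ extN G Y ∩ W = T)
    (hT : #T ≤ s * h) (hh : h ≤ 2 * s) : #𝒴 ≤ s * h := by
  by_contra! hlt
  obtain ⟨𝒵, h𝒵, hc⟩ := exists_subset_card_eq hlt.le
  have hne : 𝒴.Nonempty := card_pos.mp (by omega)
  obtain ⟨Y₀, hY₀, hmax⟩ := exists_max_image 𝒴 (fun Y => #(extN G Y \ W)) hne
  set ν := #(extN G Y₀ \ W) with hν
  have hs := (hbad Y₀ hY₀).2.1
  have hspos : 0 < s := hs ▸ (hbad Y₀ hY₀).1.nonempty.card_pos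
  have hν3 : ν ^ 3 < s ^ 2 := hs ▸ (hbad Y₀ hY₀).1.2.2.2
  by_cases hh0 : h = 0
  · subst hh0
    have := htiny s Y₀ (by omega) (hs ▸ (hbad Y₀ hY₀).1.2.2.1) (hbad Y₀ hY₀).1.nonempty
      (by rw [hs]; nlinarith [Nat.pow_le_pow_right hspos (show 1 ≤ 3 by norm_num)])
    have hT0 : T = ∅ := by simpa using hT
    have h1 : extN G Y₀ ⊆ extN G Y₀ \ W := fun x hx => by
      rw [mem_sdiff]
      refine ⟨hx, fun hxW => ?_⟩
      have : x ∈ T := (hbad Y₀ hY₀).2.2 ▸ mem_inter.mpr ⟨hx, hxW⟩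
      simp [hT0] at this
    have h2 := Nat.pow_le_pow_left (card_le_card h1) 3
    rw [hs] at this
    rw [← hν] at h2
    have h3 : s * #(extN G Y₀) ^ 3 ≤ s * s ^ 2 := Nat.mul_le_mul_left _ (h2.trans hν3.le)
    have h4 : s * s ^ 2 = s ^ 3 := by ring
    have h5 : 0 < s ^ 3 := by positivity
    omega
  have hcardU : #(𝒵.biUnion id) = s * h * s := by
    rw [card_biUnion (fun A hA B hB hAB => hdisj (h𝒵 hA) (h𝒵 hB) hAB),
      sum_congr rfl (fun Y hY => by simpa using (hbad Y (h𝒵 hY)).2.1), sum_const, hc, smul_eq_mul]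
  have hsub : extN G (𝒵.biUnion id) ⊆ T ∪ 𝒵.biUnion fun Y => extN G Y \ W := by
    intro v hv
    simp only [mem_extN, mem_biUnion, id] at hv
    obtain ⟨hvn, u, ⟨Y, hY, huY⟩, huv⟩ := hv
    have hvY : v ∈ extN G Y := mem_extN.mpr ⟨fun hvY => hvn ⟨Y, hY, hvY⟩, u, huY, huv⟩
    rw [mem_union, mem_biUnion]
    by_cases hvW : v ∈ W
    · exact Or.inl ((hbad Y (h𝒵 hY)).2.2 ▸ mem_inter.mpr ⟨hvY, hvW⟩)
    · exact Or.inr ⟨Y, hY, mem_sdiff.mpr ⟨hvY, hvW⟩⟩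
  have hext : #(extN G (𝒵.biUnion id)) ≤ s * h * (1 + ν) := by
    calc _ ≤ #T + #𝒵 * ν := (card_le_card hsub).trans ((card_union_le _ _).trans
          (Nat.add_le_add_left (card_biUnion_le_card_mul _ _ _ fun Y hY => hmax Y (h𝒵 hY)) _))
      _ ≤ s * h + s * h * ν := by rw [hc]; exact Nat.add_le_add_right hT _
      _ = _ := by ring
  have hsh : 0 < s * h := Nat.mul_pos hspos (Nat.pos_of_ne_zero hh0)
  have h1 := htiny s (𝒵.biUnion id) hh (hs ▸ (hbad Y₀ hY₀).1.2.2.1)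
    (card_pos.mp (by rw [hcardU]; exact Nat.mul_pos hsh hspos))
    (by rw [hcardU]; calc s * h * s ≤ s * (2 * s) * s := by gcongr
          _ = _ := by ring)
  rw [hcardU] at h1
  have h2 : 8 * (s * h * s) ^ 3 < s * (s * h * (1 + ν)) ^ 3 :=
    h1.trans_le (by gcongr)
  have h3 : (s * h) ^ 3 * s * (8 * s ^ 2) < (s * h) ^ 3 * s * (1 + ν) ^ 3 := by
    calc _ = 8 * (s * h * s) ^ 3 := by ring
      _ < _ := h2
      _ = _ := by ring
  have h4 := Nat.lt_of_mul_lt_mul_left h3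
  have h5 : (1 + ν) ^ 3 ≤ 8 * s ^ 2 := by
    rcases Nat.eq_zero_or_pos ν with h0 | h0
    · rw [h0]; nlinarith
    · calc (1 + ν) ^ 3 ≤ (2 * ν) ^ 3 := Nat.pow_le_pow_left (by omega) _
        _ = 8 * ν ^ 3 := by ring
        _ ≤ _ := by omega
  omega

lemma card_bad_family_le {W : Finset V} {h s₁ : ℕ}
    (htiny : ∀ s X, h ≤ 2 * s → s ≤ s₁ → Finset.Nonempty X → #X ≤ 2 * s ^ 3 →
      8 * #X ^ 3 < s * #(extN G X) ^ 3)
    {𝒴 : Finset (Finset V)} (hdisj : Set.PairwiseDisjoint (𝒴 : Set (Finset V)) id)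
    (hbad : ∀ Y ∈ 𝒴, IsBad G W s₁ Y ∧ (∀ v ∈ Y, #(nbr G v ∩ W) ≤ h) ∧ h ≤ 2 * #Y) :
    #𝒴 ≤ 2 * s₁ ^ 2 * ((s₁ + 1) * (#W + 1) ^ (2 * s₁ ^ 2)) := by
  have htr : ∀ Y ∈ 𝒴, #(extN G Y ∩ W) ≤ #Y * h := by
    intro Y hY
    have hsub : extN G Y ∩ W ⊆ Y.biUnion fun v => nbr G v ∩ W := by
      intro x hx
      simp only [mem_inter, mem_extN, mem_biUnion, mem_nbr] at hx ⊢
      obtain ⟨⟨-, u, hu, hux⟩, hxW⟩ := hx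
      exact ⟨u, hu, hux, hxW⟩
    exact (card_le_card hsub).trans (card_biUnion_le_card_mul _ _ _ (hbad Y hY).2.1)
  have hle : ∀ Y ∈ 𝒴, #Y * h ≤ 2 * s₁ ^ 2 := fun Y hY => by
    calc #Y * h ≤ #Y * (2 * #Y) := Nat.mul_le_mul_left _ (hbad Y hY).2.2
      _ = 2 * #Y ^ 2 := by ring
      _ ≤ _ := by gcongr; exact (hbad Y hY).1.2.2.1
  let types : Finset (ℕ × Finset V) := range (s₁ + 1) ×ˢ {T ∈ W.powerset | #T ≤ 2 * s₁ ^ 2}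
  have hmaps : ∀ Y ∈ 𝒴, (#Y, extN G Y ∩ W) ∈ types := fun Y hY => by
    simp only [types, mem_product, mem_range, mem_filter, mem_powerset]
    exact ⟨Nat.lt_succ_of_le (hbad Y hY).1.2.2.1, inter_subset_right,
      (htr Y hY).trans (hle Y hY)⟩
  have hcard := card_le_mul_card_image_of_maps_to (n := 2 * s₁ ^ 2) hmaps ?_
  · refine hcard.trans (Nat.mul_le_mul_left _ ?_)
    simp only [types, card_product, card_range]
    exact Nat.mul_le_mul_left _ (card_powerset_filter_card_le _ _)
  · rintro ⟨s, T⟩ -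
    set 𝒵 := {Y ∈ 𝒴 | (#Y, extN G Y ∩ W) = (s, T)} with h𝒵
    rcases 𝒵.eq_empty_or_nonempty with h0 | ⟨Y₀, hY₀⟩
    · rw [h0]; simp
    · have hm : ∀ Y ∈ 𝒵, Y ∈ 𝒴 ∧ #Y = s ∧ extN G Y ∩ W = T := fun Y hY => by
        rw [h𝒵, mem_filter, Prod.mk.injEq] at hY
        exact hY
      obtain ⟨h1, h2, h3⟩ := hm Y₀ hY₀
      have hT := htr Y₀ h1
      have hsh := hle Y₀ h1
      have hh := (hbad Y₀ h1).2.2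
      rw [h2] at hT hsh hh
      rw [h3] at hT
      exact (card_bad_fiber_le (W := W) (T := T) (s₁ := s₁) htiny
        (hdisj.subset fun Y hY => (hm Y hY).1)
        (fun Y hY => ⟨(hbad Y (hm Y hY).1).1, (hm Y hY).2⟩) hT hh).trans hsh

end

section
open scoped Classical
open Finset

variable {V : Type*} {G : SimpleGraph V} [Fintype V]

lemma card_nbr_inter_add_sdiff (v : V) (W : Finset V) :
    #(nbr G v ∩ W) + #(nbr G v \ W) = #(nbr G v) := card_inter_add_card_sdiff _ _

/-- The number of vertices which lie in bad sets and have few neighbours in `W` is small. -/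
lemma card_trapped_le {W : Finset V} {h s₁ : ℕ} (hTK : ¬ ContainsBalSub G h 2)
    (hdeg : ∀ v, 2 * h ≤ #(nbr G v) + 2)
    (htiny : ∀ s X, h ≤ 2 * s → s ≤ s₁ → Finset.Nonempty X → #X ≤ 2 * s ^ 3 →
      8 * #X ^ 3 < s * #(extN G X) ^ 3) :
    #{v | v ∉ W ∧ #(nbr G v ∩ W) < h ∧ ∃ Y, IsBad G W s₁ Y ∧ v ∈ Y} ≤
      (#W ^ 2 + 2 * s₁ ^ 2 * ((s₁ + 1) * (#W + 1) ^ (2 * s₁ ^ 2)) * s₁) *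
        (1 + 2 * s₁) ^ s₁ := by
  set E : Finset V := {v | v ∉ W ∧ h ≤ #(nbr G v ∩ W)} with hE
  obtain ⟨𝒴, h𝒴, hmax⟩ := exists_max_image
    (univ.filter fun 𝒴 : Finset (Finset V) => Set.PairwiseDisjoint (𝒴 : Set (Finset V)) id ∧
      ∀ Y ∈ 𝒴, IsBad G W s₁ Y ∧ Disjoint Y E) card
    ⟨∅, mem_filter.mpr ⟨mem_univ _, by simp⟩⟩
  simp only [mem_filter, mem_univ, true_and] at h𝒴 hmax
  have hlow : ∀ Y, IsBad G W s₁ Y → Disjoint Y E → ∀ v ∈ Y, #(nbr G v ∩ W) < h := by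
    intro Y hY hYE v hv
    by_contra! hge
    exact disjoint_left.mp hYE hv
      (mem_filter.mpr ⟨mem_univ _, disjoint_left.mp hY.1 hv, hge⟩)
  have hcard𝒴 := card_bad_family_le htiny h𝒴.1 fun Y hY => by
    obtain ⟨hb, hd⟩ := h𝒴.2 Y hY
    refine ⟨hb, fun v hv => (hlow Y hb hd v hv).le, ?_⟩
    obtain ⟨v, hv⟩ := hb.nonempty
    have h1 := hlow Y hb hd v hv
    have h2 := hb.card_nbr_le hv
    have h3 := card_nbr_inter_add_sdiff (G := G) v W
    have h4 := hdeg v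
    omega
  set L : Finset V := {x | x ∉ W ∧ #(nbr G x \ W) ≤ 2 * s₁} with hL
  have hLdeg : ∀ x ∈ L, #(nbr G x ∩ L) ≤ 2 * s₁ := fun x hx => by
    refine (card_le_card fun y hy => ?_).trans (mem_filter.mp hx).2.2
    rw [mem_inter] at hy
    exact mem_sdiff.mpr ⟨hy.1, (mem_filter.mp hy.2).2.1⟩
  have hsub : ({v | v ∉ W ∧ #(nbr G v ∩ W) < h ∧ ∃ Y, IsBad G W s₁ Y ∧ v ∈ Y} : Finset V) ⊆
      (E ∪ 𝒴.biUnion id).biUnion fun z => {v | JoinedIn G L s₁ z v} := by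
    intro v hv
    obtain ⟨-, hvW, hvh, Y, hY, hvY⟩ := mem_filter.mp hv
    have hYL : Y ⊆ L := fun x hx => mem_filter.mpr ⟨mem_univ _, disjoint_left.mp hY.1 hx, by
      have h1 := hY.card_nbr_le hx
      have h2 := hY.2.2.1
      omega⟩
    have hmeet : ∃ z ∈ Y, z ∈ E ∪ 𝒴.biUnion id := by
      by_contra! hno
      have hYE : Disjoint Y E := disjoint_left.mpr fun z hz hzE =>
        hno z hz (mem_union_left _ hzE)
      have hYn : Y ∉ 𝒴 := fun hmem =>
        hno v hvY (mem_union_right _ (mem_biUnion.mpr ⟨Y, hmem, hvY⟩))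
      have hd : Set.PairwiseDisjoint ((insert Y 𝒴 : Finset (Finset V)) : Set (Finset V)) id := by
        rw [coe_insert]
        refine h𝒴.1.insert fun Z hZ _ => disjoint_left.mpr fun z hz hzZ => ?_
        exact hno z hz (mem_union_right _ (mem_biUnion.mpr ⟨Z, hZ, hzZ⟩))
      have := hmax (insert Y 𝒴) ⟨hd, fun Z hZ => ?_⟩
      · rw [card_insert_of_notMem hYn] at this
        omega
      · rcases mem_insert.mp hZ with rfl | hZ
        exacts [⟨hY, hYE⟩, h𝒴.2 Z hZ]
    obtain ⟨z, hzY, hz⟩ := hmeet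
    exact mem_biUnion.mpr ⟨z, hz, mem_filter.mpr
      ⟨mem_univ _, (hY.joinedIn hzY hvY).mono hYL le_rfl⟩⟩
  calc _ ≤ _ := card_le_card hsub
    _ ≤ #(E ∪ 𝒴.biUnion id) * (1 + 2 * s₁) ^ s₁ :=
        card_biUnion_le_card_mul _ _ _ fun z _ => card_joinedIn_le hLdeg z s₁
    _ ≤ _ := by
        refine Nat.mul_le_mul_right _ ((card_union_le _ _).trans (Nat.add_le_add
          (card_exceptional_le hTK W) ?_))
        refine (card_biUnion_le_card_mul _ _ s₁ fun Y hY => (h𝒴.2 Y hY).1.2.2.1).trans ?_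
        exact Nat.mul_le_mul_right _ hcard𝒴

/-- A bound for the number of vertices without five fine neighbours. -/
def coarseBound (s₁ ω : ℕ) : ℕ :=
  (ω + ω ^ 2) + (ω + ω ^ 2) ^ 2 +
    (1 + 2 * s₁) * ((ω ^ 2 + 2 * s₁ ^ 2 * ((s₁ + 1) * (ω + 1) ^ (2 * s₁ ^ 2)) * s₁) *
      (1 + 2 * s₁) ^ s₁)

/-- `y` is fine with respect to `W`: it has many neighbours outside `W`, and connected sets
outside `W` containing `y` expand with polynomial rate. -/
def IsFine (G : SimpleGraph V) (h : ℕ) (W : Finset V) (y : V) : Prop :=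
  y ∉ W ∧ h ≤ #(nbr G y \ W) + 1 ∧
    ∀ Y ρ, IsRad G ρ y Y → Disjoint Y W → 2 * #Y ≤ Fintype.card V →
      #Y ^ 2 ≤ #(extN G Y \ W) ^ 3

/-- Almost all vertices are fine and have at least five fine neighbours. -/
lemma card_not_fine_le {W : Finset V} {h s₁ : ℕ} (h6 : 6 ≤ h) (hTK : ¬ ContainsBalSub G h 2)
    (hdeg : ∀ v, 2 * h ≤ #(nbr G v) + 2)
    (htiny : ∀ s X, h ≤ 2 * s → s ≤ s₁ → Finset.Nonempty X → #X ≤ 2 * s ^ 3 →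
      8 * #X ^ 3 < s * #(extN G X) ^ 3)
    (hbig : ∀ Y, Disjoint Y W → s₁ < #Y → 2 * #Y ≤ Fintype.card V →
      #Y ^ 2 ≤ #(extN G Y \ W) ^ 3) :
    #{v | ¬ (IsFine G h W v ∧ 5 ≤ #{u ∈ nbr G v | IsFine G h W u})} ≤ coarseBound s₁ #W := by
  set Tr : Finset V := {v | v ∉ W ∧ #(nbr G v ∩ W) < h ∧ ∃ Y, IsBad G W s₁ Y ∧ v ∈ Y} with hTr
  set E : Finset V := {v | v ∉ W ∧ h ≤ #(nbr G v ∩ W)} with hE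
  set W₂ := W ∪ E with hW₂
  set E₂ : Finset V := {v | v ∉ W₂ ∧ h ≤ #(nbr G v ∩ W₂)} with hE₂
  have hcE : #E ≤ #W ^ 2 := card_exceptional_le hTK W
  have hcE₂ : #E₂ ≤ #W₂ ^ 2 := card_exceptional_le hTK W₂
  have hcW₂ : #W₂ ≤ #W + #W ^ 2 := (card_union_le _ _).trans (by omega)
  have hcTr := card_trapped_le (W := W) hTK hdeg htiny
  have hfine : ∀ v, v ∉ W₂ → v ∉ Tr → IsFine G h W v := by
    intro v hv hvTr
    rw [hW₂, mem_union, not_or] at hv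
    have hlt : #(nbr G v ∩ W) < h := by
      by_contra! hge
      exact hv.2 (mem_filter.mpr ⟨mem_univ _, hv.1, hge⟩)
    refine ⟨hv.1, ?_, fun Y ρ hY hYW hYc => ?_⟩
    · have h3 := card_nbr_inter_add_sdiff (G := G) v W
      have h4 := hdeg v
      omega
    · rcases le_or_gt #Y s₁ with hc | hc
      · by_contra! hlt'
        exact hvTr (mem_filter.mpr ⟨mem_univ _, hv.1, hlt, Y, ⟨hYW, ⟨ρ, v, hY⟩, hc, hlt'⟩, hY.1⟩)
      · exact hbig Y hYW hc hYc
  have hsub : ({v | ¬ (IsFine G h W v ∧ 5 ≤ #{u ∈ nbr G v | IsFine G h W u})} : Finset V) ⊆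
      (W₂ ∪ E₂) ∪ (Tr ∪ Tr.biUnion fun z => nbr G z \ W) := by
    intro v hv
    by_contra hno
    simp only [mem_union, mem_biUnion, not_or, not_exists, not_and] at hno
    obtain ⟨⟨h1, h2⟩, h3, h4⟩ := hno
    refine (mem_filter.mp hv).2 ⟨hfine v (by simpa using h1) h3, ?_⟩
    have hlt : #(nbr G v ∩ W₂) < h := by
      by_contra! hge
      exact h2 (mem_filter.mpr ⟨mem_univ _, by simpa using h1, hge⟩)
    have hsub : nbr G v \ W₂ ⊆ {u ∈ nbr G v | IsFine G h W u} := by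
      intro u hu
      rw [mem_sdiff] at hu
      refine mem_filter.mpr ⟨hu.1, hfine u hu.2 fun huTr => h4 u huTr ?_⟩
      rw [mem_sdiff, mem_nbr]
      refine ⟨(mem_nbr.mp hu.1).symm, fun hvW => h1 ?_⟩
      exact hW₂ ▸ mem_union_left E hvW
    have h5 := card_le_card hsub
    have h6 := card_nbr_inter_add_sdiff (G := G) v W₂
    have h7 := hdeg v
    omega
  have hnb : #(Tr.biUnion fun z => nbr G z \ W) ≤ #Tr * (2 * s₁) := by
    refine card_biUnion_le_card_mul _ _ _ fun z hz => ?_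
    obtain ⟨-, -, -, Y, hY, hzY⟩ := mem_filter.mp hz
    have h1 := hY.card_nbr_le hzY
    have h2 := hY.2.2.1
    omega
  have h1 := (card_le_card hsub).trans (card_union_le _ _)
  have h2 := card_union_le W₂ E₂
  have h3 := card_union_le Tr (Tr.biUnion fun z => nbr G z \ W)
  have h4 : #W₂ ^ 2 ≤ (#W + #W ^ 2) ^ 2 := Nat.pow_le_pow_left hcW₂ 2
  have h5 : (1 + 2 * s₁) * #Tr ≤ (1 + 2 * s₁) * _ := Nat.mul_le_mul_left _ hcTr
  unfold coarseBound
  nlinarith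

end

section
open scoped Classical
open Finset

/-- Numerical parameters. On arbitrary sets the graph expands with rate `1 / M`, on sets of size
at most `B` with rate `1 / L`; sets growing with rate `1 / (4 M)` exhaust the graph in `R`
steps; `m` is a bound for radii, `w` a bound for the sizes of the sets to be avoided, and `h` is
roughly half of the minimum degree. -/
structure Params where
  (M L B h R m r w : ℕ)

/-- The graph and the parameters are as in a sparse bipartite expander. -/
structure Setting {V : Type*} [Fintype V] (G : SimpleGraph V) (P : Params) : Prop where
  bip : IsBip G
  noSub : ¬ ContainsBalSub G P.h 2
  deg : ∀ v, 2 * P.h ≤ #(nbr G v) + 2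
  expand : ∀ X : Finset V, X.Nonempty → 2 * #X ≤ Fintype.card V → #X ≤ P.M * #(extN G X)
  expand_small : ∀ X : Finset V, X.Nonempty → #X ≤ P.B → #X ≤ P.L * #(extN G X)
  expand_tiny : ∀ (s : ℕ) (X : Finset V), P.h ≤ 2 * s → s ≤ 8 * P.L ^ 3 → X.Nonempty →
    #X ≤ 2 * s ^ 3 → 8 * #X ^ 3 < s * #(extN G X) ^ 3
  L_pos : 0 < P.L
  L_le : P.L ≤ P.M
  h_le : 20000 ≤ P.h
  growth : Fintype.card V * (4 * P.M) ^ P.R < (4 * P.M + 1) ^ P.R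
  w_le : 4 * P.M * ((1 + 2 * P.L) * P.w) ≤ P.B
  w_le' : 8 * P.M ^ 3 + 2 * P.L * P.w ≤ P.B
  coarse : 10 * coarseBound (8 * P.L ^ 3) ((1 + 2 * P.L) * P.w) ≤ Fintype.card V
  r_add_R : P.r + P.R ≤ P.m
  r_ge : 256 * P.M * (2 * (P.m + P.R) + 5) ≤ P.r ^ 3

variable {V : Type*} {G : SimpleGraph V} {P : Params}

lemma card_le_card_sdiff_add (X W : Finset V) : #X ≤ #(X \ W) + #W := by
  have := card_le_card (s := X) (t := (X \ W) ∪ W) (fun x hx => by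
    by_cases h : x ∈ W <;> simp [h, hx])
  exact this.trans (card_union_le _ _)

variable [Fintype V]

namespace Setting

lemma M_pos (hS : Setting G P) : 0 < P.M := hS.L_pos.trans_le hS.L_le

/-- Expansion while avoiding a set which is small compared to `X`. -/
lemma expand_sdiff (hS : Setting G P) {X W : Finset V} (hX : X.Nonempty)
    (hXn : 2 * #X ≤ Fintype.card V) (hW : 2 * P.L * #W ≤ #X) (hWB : 2 * P.M * #W ≤ P.B) :
    #X ≤ 2 * P.M * #(extN G X \ W) := by
  have h1 := card_le_card_sdiff_add (extN G X) W
  rcases le_or_gt #X P.B with hB | hB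
  · have h2 := hS.expand_small X hX hB
    have h3 : P.L * #(extN G X) ≤ P.L * (#(extN G X \ W) + #W) := Nat.mul_le_mul_left _ h1
    have h4 : P.L * #(extN G X \ W) ≤ P.M * #(extN G X \ W) := Nat.mul_le_mul_right _ hS.L_le
    nlinarith
  · have h2 := hS.expand X hX hXn
    have h3 : P.M * #(extN G X) ≤ P.M * (#(extN G X \ W) + #W) := Nat.mul_le_mul_left _ h1
    nlinarith

/-- Around a small set there is a slightly larger one, outside of which everything expands and
most vertices are fine. -/
lemma exists_fine_region (hS : Setting G P) {W : Finset V} (hW : #W ≤ P.w) :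
    ∃ W₁, W ⊆ W₁ ∧ #W₁ ≤ (1 + 2 * P.L) * P.w ∧
      (∀ Y : Finset V, Y.Nonempty → Disjoint Y W₁ → 2 * #Y ≤ Fintype.card V →
        #Y ≤ 2 * P.M * #(extN G Y \ W₁)) ∧
      10 * #{v | ¬ (IsFine G P.h W₁ v ∧ 5 ≤ #{u ∈ nbr G v | IsFine G P.h W₁ u})} ≤
        Fintype.card V := by
  obtain ⟨X, hXW, hXB, hX, hcore⟩ := exists_core (G := G) (2 * P.L) P.B W
  have hXc : #X ≤ 2 * P.L * #W := by
    rcases X.eq_empty_or_nonempty with rfl | hne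
    · simp
    · have h1 := hS.expand_small X hne hXB
      have h2 := card_le_card_sdiff_add (extN G X) W
      have h3 : P.L * #(extN G X) ≤ P.L * (#(extN G X \ W) + #W) := Nat.mul_le_mul_left _ h2
      nlinarith
  have hLw : 2 * P.L * #W ≤ 2 * P.L * P.w := Nat.mul_le_mul_left _ hW
  have hW₁ : #(W ∪ X) ≤ (1 + 2 * P.L) * P.w := (card_union_le _ _).trans (by nlinarith)
  have hMW : 4 * P.M * #(W ∪ X) ≤ P.B := (Nat.mul_le_mul_left _ hW₁).trans hS.w_le
  have hLM := hS.L_le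
  have hexp : ∀ Y : Finset V, Y.Nonempty → Disjoint Y (W ∪ X) → 2 * #Y ≤ Fintype.card V →
      #X + #Y ≤ P.B ∧ #Y ≤ 2 * P.L * #(extN G Y \ (W ∪ X)) ∨
      P.B < #X + #Y ∧ #Y ≤ 2 * P.M * #(extN G Y \ (W ∪ X)) := by
    intro Y hY hd hYn
    rcases le_or_gt (#X + #Y) P.B with hc | hc
    · exact Or.inl ⟨hc, (hcore Y hY hd hc).le⟩
    · refine Or.inr ⟨hc, ?_⟩
      have h1 := hS.expand Y hY hYn
      have h2 := card_le_card_sdiff_add (extN G Y) (W ∪ X)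
      have h3 : P.M * #(extN G Y) ≤ P.M * (#(extN G Y \ (W ∪ X)) + #(W ∪ X)) :=
        Nat.mul_le_mul_left _ h2
      have h4 : #X ≤ P.M * #(W ∪ X) := by
        calc #X ≤ #(W ∪ X) := card_le_card subset_union_right
          _ ≤ _ := Nat.le_mul_of_pos_left _ hS.M_pos
      have h5 : #(W ∪ X) ≤ P.M * #(W ∪ X) := Nat.le_mul_of_pos_left _ hS.M_pos
      have h6 : P.M * #X ≤ P.M * #(W ∪ X) := Nat.mul_le_mul_left _ (card_le_card subset_union_right)
      nlinarith
  refine ⟨W ∪ X, subset_union_left, hW₁, fun Y hY hd hYn => ?_, ?_⟩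
  · rcases hexp Y hY hd hYn with ⟨-, h1⟩ | ⟨-, h1⟩
    · exact h1.trans (Nat.mul_le_mul_right _ (Nat.mul_le_mul_left _ hLM))
    · exact h1
  · have hmono : coarseBound (8 * P.L ^ 3) #(W ∪ X) ≤
        coarseBound (8 * P.L ^ 3) ((1 + 2 * P.L) * P.w) := by
      unfold coarseBound
      gcongr
    refine (Nat.mul_le_mul_left _ ((card_not_fine_le (by have := hS.h_le; omega) hS.noSub hS.deg
      hS.expand_tiny ?_).trans hmono)).trans hS.coarse
    intro Y hd hYc hYn
    have hY : Y.Nonempty := card_pos.mp (by omega)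
    have key : ∀ c N y : ℕ, y ≤ 2 * c * N → 8 * c ^ 3 ≤ y → y ^ 2 ≤ N ^ 3 := by
      intro c N y h1 h2
      rcases Nat.eq_zero_or_pos y with h0 | h0
      · simp [h0]
      have h3 : y ^ 3 ≤ (2 * c * N) ^ 3 := Nat.pow_le_pow_left h1 3
      have h4 : y * y ^ 2 ≤ y * N ^ 3 := by
        calc y * y ^ 2 = y ^ 3 := by ring
          _ ≤ (2 * c * N) ^ 3 := h3
          _ = 8 * c ^ 3 * N ^ 3 := by ring
          _ ≤ _ := Nat.mul_le_mul_right _ h2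
      exact Nat.le_of_mul_le_mul_left h4 h0
    rcases hexp Y hY hd hYn with ⟨-, h1⟩ | ⟨hB, h1⟩
    · exact key _ _ _ h1 hYc.le
    · refine key _ _ _ h1 ?_
      have := hS.w_le'
      omega

end Setting

end

section
open scoped Classical
open Finset

variable {V : Type*} {G : SimpleGraph V} {P : Params}

lemma walk_parity {f : V → Bool} (hf : ∀ u v, G.Adj u v → f u ≠ f v) {a b : V}
    (w : G.Walk a b) : f a = f b ↔ Even w.length := by
  induction w with
  | nil => simp
  | @cons u v w hadj q ih =>
    rw [SimpleGraph.Walk.length_cons, Nat.even_add_one, ← ih]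
    have := hf _ _ hadj
    cases h1 : f u <;> cases h2 : f v <;> cases h3 : f w <;> simp_all

/-- The distance from `p` to `x` inside `K`. -/
noncomputable def lvl (G : SimpleGraph V) (K : Finset V) (p x : V) : ℕ :=
  sInf {i | JoinedIn G K i p x}

section lvl

variable {K : Finset V} {p x y u : V} {i : ℕ}

lemma JoinedIn.lvl_le (h : JoinedIn G K i p x) : lvl G K p x ≤ i := Nat.sInf_le h

lemma JoinedIn.lvl_spec (h : JoinedIn G K i p x) : JoinedIn G K (lvl G K p x) p x :=
  Nat.sInf_mem (s := {i | JoinedIn G K i p x}) ⟨i, h⟩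

lemma JoinedIn.lvl_le_add {j : ℕ} (h : JoinedIn G K i p x) (hx : JoinedIn G K j x u) :
    lvl G K p u ≤ lvl G K p x + j := (h.lvl_spec.trans hx).lvl_le

lemma JoinedIn.lvl_ne {f : V → Bool} (hf : ∀ u v, G.Adj u v → f u ≠ f v)
    (h : JoinedIn G K i p x) (hu : u ∈ K) (hxu : G.Adj x u) :
    lvl G K p x ≠ lvl G K p u := by
  intro heq
  have hu' := h.step hxu hu
  obtain ⟨w, h1, h2⟩ := h.lvl_spec
  obtain ⟨w', h1', h2'⟩ := hu'.lvl_spec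
  have e1 : lvl G K p x ≤ w.length := JoinedIn.lvl_le ⟨w, le_rfl, h2⟩
  have e2 : lvl G K p u ≤ w'.length := JoinedIn.lvl_le ⟨w', le_rfl, h2'⟩
  have hw : w.length = w'.length := by omega
  have p1 := walk_parity hf w
  have p2 := walk_parity hf w'
  rw [hw, ← p2] at p1
  have := hf _ _ hxu
  cases h1 : f x <;> cases h2 : f u <;> cases h3 : f p <;> simp_all

lemma JoinedIn.exists_lvl_path (h : JoinedIn G K i p x) :
    ∃ w : G.Walk p x, w.IsPath ∧ w.length = lvl G K p x ∧ (∀ z ∈ w.support, z ∈ K) ∧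
      (∀ z ∈ w.support, lvl G K p z ≤ lvl G K p x) ∧
      ∀ z ∈ w.support, ∀ z' ∈ w.support, lvl G K p z = lvl G K p z' → z = z' := by
  generalize ha : lvl G K p x = a
  induction a generalizing x i with
  | zero =>
    obtain ⟨w, h1, -⟩ := h.lvl_spec
    have hpx : p = x := SimpleGraph.Walk.eq_of_length_eq_zero (p := w) (by omega)
    subst hpx
    exact ⟨.nil, by simp, by simp, by simpa using h.left_mem, by simp [ha], by simp⟩
  | succ a ih =>
    obtain ⟨w, h1, h2⟩ := h.lvl_spec.symm
    cases w with
    | nil =>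
      have := (JoinedIn.refl (G := G) (i := 0) h.left_mem).lvl_le
      omega
    | @cons _ u _ hadj q =>
      rw [SimpleGraph.Walk.length_cons] at h1
      have hu : JoinedIn G K q.length p u :=
        JoinedIn.symm ⟨q, le_rfl, fun z hz => h2 z (by simp [hz])⟩
      have hle := hu.lvl_le
      have hge := hu.lvl_le_add (.of_adj hu.right_mem h.right_mem hadj.symm)
      obtain ⟨w', g1, g2, g3, g4, g5⟩ := ih hu (by omega)
      have hx : x ∉ w'.support := fun hx => by have := g4 x hx; omega
      refine ⟨w'.concat hadj.symm, ?_, by rw [SimpleGraph.Walk.length_concat, g2], ?_, ?_, ?_⟩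
      · rw [SimpleGraph.Walk.concat_isPath_iff]
        exact ⟨g1, hx⟩
      · intro z hz
        rw [SimpleGraph.Walk.support_concat, List.mem_append,
          List.mem_singleton] at hz
        rcases hz with hz | rfl
        exacts [g3 z hz, h.right_mem]
      · intro z hz
        rw [SimpleGraph.Walk.support_concat, List.mem_append,
          List.mem_singleton] at hz
        rcases hz with hz | rfl
        exacts [(g4 z hz).trans (by omega), ha.le]
      · intro z hz z' hz' heq
        rw [SimpleGraph.Walk.support_concat, List.mem_append,
          List.mem_singleton] at hz hz'
        rcases hz with hz | rfl <;> rcases hz' with hz' | rfl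
        · exact g5 z hz z' hz' heq
        · have := g4 z hz; omega
        · have := g4 z' hz'; omega
        · rfl

end lvl

variable [Fintype V]

/-- If most vertices have five neighbours in `F`, then some vertex of `F` has the same distance
from `p` as another vertex, and both have a common neighbour farther away. -/
lemma exists_twin {f : V → Bool} (hf : ∀ u v, G.Adj u v → f u ≠ f v) {K F T : Finset V}
    {p : V} {ρ : ℕ} (hFK : F ⊆ K) (hTF : T ⊆ F) (hT : ∀ v ∈ T, JoinedIn G K ρ p v)
    (hT5 : ∀ v ∈ T, 5 ≤ #(nbr G v ∩ F)) (hcard : Fintype.card V < 4 * #T) :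
    ∃ y ∈ F, ∃ y' u, y' ≠ y ∧ JoinedIn G K ρ p y ∧ JoinedIn G K ρ p y' ∧ u ∈ K ∧
      lvl G K p y' = lvl G K p y ∧ lvl G K p u = lvl G K p y + 1 ∧
      G.Adj y u ∧ G.Adj y' u := by
  by_contra! hno
  let C : V → Finset V := fun v => {u ∈ nbr G v ∩ F | lvl G K p u = lvl G K p v + 1}
  have hC : ∀ v ∈ T, 4 ≤ #(C v) := by
    intro v hv
    let D : Finset V := {u ∈ nbr G v ∩ F | lvl G K p v = lvl G K p u + 1}
    have hD : ∀ u ∈ D, JoinedIn G K ρ p u ∧ u ∈ F ∧ G.Adj u v ∧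
        lvl G K p v = lvl G K p u + 1 := by
      intro u hu
      rw [mem_filter, mem_inter, mem_nbr] at hu
      have h1 := ((hT v hv).step hu.1.1 (hFK hu.1.2)).lvl_spec
      have h2 := (hT v hv).lvl_le
      exact ⟨h1.mono subset_rfl (by omega), hu.1.2, hu.1.1.symm, hu.2⟩
    have hD1 : #D ≤ 1 := by
      rw [card_le_one]
      intro y hy y' hy'
      by_contra hne
      obtain ⟨g1, g2, g3, g4⟩ := hD y hy
      obtain ⟨g1', g2', g3', g4'⟩ := hD y' hy'
      exact hno y g2 y' v (Ne.symm hne) g1 g1' (hFK (hTF hv)) (by omega) g4 g3 g3'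
    have hsub : nbr G v ∩ F ⊆ C v ∪ D := by
      intro u hu
      have hu' := hu
      rw [mem_inter, mem_nbr] at hu'
      have h1 := (hT v hv).lvl_ne hf (hFK hu'.2) hu'.1
      have h2 := (hT v hv).lvl_le_add (.of_adj (hT v hv).right_mem (hFK hu'.2) hu'.1)
      have h3 := ((hT v hv).step hu'.1 (hFK hu'.2)).lvl_le_add
        (.of_adj (hFK hu'.2) (hT v hv).right_mem hu'.1.symm)
      rw [mem_union, mem_filter, mem_filter]
      rcases Nat.lt_or_ge (lvl G K p v) (lvl G K p u) with h | h
      · exact Or.inl ⟨hu, by omega⟩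
      · exact Or.inr ⟨hu, by omega⟩
    have h1 := (card_le_card hsub).trans (card_union_le _ _)
    have h2 := hT5 v hv
    omega
  have hdisj : Set.PairwiseDisjoint (T : Set V) C := by
    intro v hv v' hv' hne
    refine disjoint_left.mpr fun u hu hu' => ?_
    simp only [C, mem_filter, mem_inter, mem_nbr] at hu hu'
    exact hno v (hTF hv) v' u hne.symm (hT v hv) (hT v' hv') (hFK hu.1.2) (by omega) hu.2
      hu.1.1 hu'.1.1
  have h1 := card_biUnion hdisj
  have h2 := card_le_univ (T.biUnion C)
  have h3 := card_nsmul_le_sum T (fun v => #(C v)) 4 hC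
  rw [smul_eq_mul] at h3
  omega

end

section
open scoped Classical
open Finset

variable {V : Type*} {G : SimpleGraph V} {P : Params} [Fintype V]

/-- A connected set around a fine vertex grows cubically even when a sparse obstacle `A` is
removed. -/
lemma IsFine.exists_cubic_growth {h : ℕ} (hh : 20000 ≤ h) {W A : Finset V} {y : V}
    (hy : IsFine G h W y)
    (hA : ∀ i X, IsRad G i y X → Disjoint X W → #((extN G X \ W) ∩ A) ≤ 2 * i + 5) (i : ℕ) :
    ∃ X, IsRad G (i + 1) y X ∧ Disjoint X W ∧ (∀ x ∈ X, x ∈ A → x = y) ∧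
      (Fintype.card V < 2 * #X ∨ (i + 101) ^ 3 ≤ 64 * #X) := by
  have hgrow : ∀ j X, IsRad G j y X → Disjoint X W → (∀ x ∈ X, x ∈ A → x = y) →
      ∃ X', IsRad G (j + 1) y X' ∧ Disjoint X' W ∧ (∀ x ∈ X', x ∈ A → x = y) ∧
        X ⊆ X' ∧ #X + #(extN G X \ W) ≤ #X' + (2 * j + 5) := by
    intro j X hX hXW hXA
    have hmem : ∀ {x}, x ∈ (extN G X \ W) \ A ↔ ((x ∉ X ∧ ∃ u ∈ X, G.Adj u x) ∧ x ∉ W) ∧ x ∉ A :=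
      by intro x; rw [mem_sdiff, mem_sdiff, mem_extN]
    refine ⟨X ∪ (extN G X \ W) \ A, ⟨mem_union_left _ hX.1, fun x hx => ?_⟩, ?_, ?_,
      subset_union_left, ?_⟩
    · rcases mem_union.mp hx with hx' | hx'
      · exact (hX.2 x hx').mono subset_union_left (by omega)
      · obtain ⟨⟨⟨-, u, hu, hux⟩, -⟩, -⟩ := hmem.mp hx'
        exact ((hX.2 u hu).mono subset_union_left le_rfl).step hux hx
    · refine disjoint_left.mpr fun x hx => ?_
      rcases mem_union.mp hx with hx' | hx'
      exacts [disjoint_left.mp hXW hx', (hmem.mp hx').1.2]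
    · intro x hx hxA
      rcases mem_union.mp hx with hx' | hx'
      exacts [hXA x hx' hxA, ((hmem.mp hx').2 hxA).elim]
    · rw [card_union_of_disjoint (disjoint_left.mpr fun x hx hx' => (hmem.mp hx').1.1.1 hx)]
      have h1 := card_inter_add_card_sdiff (extN G X \ W) A
      have h2 := hA j X hX hXW
      omega
  induction i with
  | zero =>
    obtain ⟨X, h1, h2, h3, h4, h5⟩ := hgrow 0 {y} ⟨by simp, fun x hx => by
        rw [mem_singleton.mp hx]; exact .refl (by simp)⟩ (by simpa using hy.1) (by simp)
    refine ⟨X, h1, h2, h3, Or.inr ?_⟩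
    have h6 : nbr G y \ W ⊆ extN G {y} \ W := by
      intro x hx
      rw [mem_sdiff, mem_nbr] at hx
      simp only [mem_sdiff, mem_extN, mem_singleton, exists_eq_left]
      exact ⟨⟨hx.1.ne', hx.1⟩, hx.2⟩
    have h7 := card_le_card h6
    have h8 := hy.2.1
    rw [card_singleton] at h5
    omega
  | succ i ih =>
    obtain ⟨X, h1, h2, h3, h4⟩ := ih
    obtain ⟨X', g1, g2, g3, g4, g5⟩ := hgrow _ X h1 h2 h3
    refine ⟨X', g1, g2, g3, ?_⟩
    have hc := card_le_card g4
    rcases h4 with h4 | h4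
    · left; omega
    · by_cases hn : Fintype.card V < 2 * #X
      · left; omega
      right
      have h5 := hy.2.2 X _ h1 h2 (by omega)
      set N := #(extN G X \ W)
      have h6 : ((i + 101) ^ 2) ^ 3 ≤ (16 * N) ^ 3 := by
        calc ((i + 101) ^ 2) ^ 3 = ((i + 101) ^ 3) ^ 2 := by ring
          _ ≤ (64 * #X) ^ 2 := Nat.pow_le_pow_left h4 2
          _ = 4096 * #X ^ 2 := by ring
          _ ≤ 4096 * N ^ 3 := Nat.mul_le_mul_left _ h5
          _ = _ := by ring
      have h7 : (i + 101) ^ 2 ≤ 16 * N := le_of_pow_le_pow_left₀ (by norm_num) (Nat.zero_le _) h6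
      nlinarith

/-- From the centre of a large set of bounded radius one reaches another such centre by two
paths whose lengths differ by two. -/
lemma Setting.exists_detour (hS : Setting G P) {W F : Finset V} {p : V} (hW : #W ≤ P.w)
    (hF : IsRad G P.m p F) (hFW : Disjoint F W)
    (hFc : 2 * P.L * ((1 + 2 * P.L) * P.w) ≤ #F) :
    ∃ y A B a, p ∈ A ∧ Disjoint A W ∧ #A ≤ 2 * (P.m + P.R) + 5 ∧
      (∃ q : G.Walk p y, q.IsPath ∧ q.length = a ∧ ∀ x ∈ q.support, x ∈ A) ∧
      (∃ q : G.Walk p y, q.IsPath ∧ q.length = a + 2 ∧ ∀ x ∈ q.support, x ∈ A) ∧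
      IsRad G P.m y B ∧ Disjoint B W ∧ (∀ x ∈ B, x ∈ A → x = y) ∧ Fintype.card V < 2 * #B ∧
      a ≤ P.m + P.R := by
  obtain ⟨f, hf⟩ := hS.bip
  obtain ⟨W₁, hWW₁, hW₁c, hexp, hcoarse⟩ := hS.exists_fine_region hW
  set K := (univ \ W₁) ∪ F with hK
  have hKmem : ∀ {x}, x ∉ W₁ → x ∈ K := fun hx => by rw [hK, mem_union, mem_sdiff]; simp [hx]
  have hKW : Disjoint K W := by
    rw [hK, disjoint_union_left]
    exact ⟨disjoint_left.mpr fun x hx hxW => (mem_sdiff.mp hx).2 (hWW₁ hxW), hFW⟩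
  obtain ⟨B₀, -, hB₀K, hB₀c, hB₀⟩ := hF.exists_growth (S := K) (N := Fintype.card V / 2)
    hS.growth subset_union_right (by
      intro X hFX hXK hXc
      have h1 : #F ≤ #X := card_le_card hFX
      have h2 : 2 * P.L * #W₁ ≤ #X := (Nat.mul_le_mul_left _ hW₁c).trans (hFc.trans h1)
      have h3 : 4 * P.M * #W₁ ≤ P.B := (Nat.mul_le_mul_left _ hW₁c).trans hS.w_le
      have h4 := hS.expand_sdiff (X := X) (W := W₁) ⟨p, hFX hF.1⟩ (by omega) h2 (by nlinarith)
      have h5 : #(extN G X \ W₁) ≤ #(extN G X ∩ K) := card_le_card fun x hx => by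
        rw [mem_sdiff] at hx
        exact mem_inter.mpr ⟨hx.1, hKmem hx.2⟩
      calc #X ≤ 2 * P.M * #(extN G X \ W₁) := h4
        _ ≤ 2 * P.M * #(extN G X ∩ K) := Nat.mul_le_mul_left _ h5
        _ ≤ 4 * P.M * #(extN G X ∩ K) := Nat.mul_le_mul_right _ (by omega))
  set Fi : Finset V := {v | IsFine G P.h W₁ v} with hFi
  set T : Finset V := {v ∈ B₀ | IsFine G P.h W₁ v ∧ 5 ≤ #{u ∈ nbr G v | IsFine G P.h W₁ u}}
    with hT
  have hTc : Fintype.card V < 4 * #T := by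
    have hsub : B₀ ⊆ T ∪ ({v | ¬ (IsFine G P.h W₁ v ∧
        5 ≤ #{u ∈ nbr G v | IsFine G P.h W₁ u})} : Finset V) := by
      intro v hv
      rw [mem_union, mem_filter, mem_filter]
      by_cases hv' : IsFine G P.h W₁ v ∧ 5 ≤ #{u ∈ nbr G v | IsFine G P.h W₁ u}
      exacts [Or.inl ⟨hv, hv'⟩, Or.inr ⟨mem_univ _, hv'⟩]
    have h1 := (card_le_card hsub).trans (card_union_le _ _)
    omega
  obtain ⟨y, hyF, y', u, hne, hy, hy', hu, hl1, hl2, hyu, hy'u⟩ :=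
    exists_twin (f := f) hf (K := K) (F := Fi) (T := T) (p := p) (ρ := P.m + P.R)
      (fun x hx => hKmem (mem_filter.mp hx).2.1)
      (fun x hx => mem_filter.mpr ⟨mem_univ _, (mem_filter.mp hx).2.1⟩)
      (fun x hx => (hB₀.2 x (mem_filter.mp hx).1).mono hB₀K le_rfl)
      (fun x hx => by
        refine (mem_filter.mp hx).2.2.trans (card_le_card fun z hz => ?_)
        rw [mem_filter] at hz
        exact mem_inter.mpr ⟨hz.1, mem_filter.mpr ⟨mem_univ _, hz.2⟩⟩) hTc
  have hyfine : IsFine G P.h W₁ y := (mem_filter.mp hyF).2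
  obtain ⟨q, q1, q2, q3, q4, q5⟩ := hy.exists_lvl_path
  obtain ⟨q', q1', q2', q3', q4', q5'⟩ := hy'.exists_lvl_path
  set a := lvl G K p y with ha
  have ham : a ≤ P.m + P.R := hy.lvl_le
  set A : Finset V := insert u (q.support.toFinset ∪ q'.support.toFinset) with hA
  have hAmem : ∀ {x}, x ∈ A ↔ x = u ∨ x ∈ q.support ∨ x ∈ q'.support := by
    intro x; rw [hA, mem_insert, mem_union, List.mem_toFinset, List.mem_toFinset]
  have hAK : A ⊆ K := fun x hx => by
    rcases hAmem.mp hx with rfl | hx | hx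
    exacts [hu, q3 x hx, q3' x hx]
  have hAc : #A ≤ 2 * (P.m + P.R) + 5 := by
    have h1 : #A ≤ _ := card_insert_le u (q.support.toFinset ∪ q'.support.toFinset)
    have h2 := card_union_le q.support.toFinset q'.support.toFinset
    have h3 := q.support.toFinset_card_le
    have h4 := q'.support.toFinset_card_le
    rw [SimpleGraph.Walk.length_support] at h3 h4
    omega
  have huq : u ∉ q.support := fun h => by have := q4 u h; omega
  have huq' : u ∉ q'.support := fun h => by have := q4' u h; omega
  have hyq' : y ∉ q'.support := fun h => hne (q5' y' q'.end_mem_support y h hl1)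
  have hobst : ∀ i X, IsRad G i y X → Disjoint X W₁ → #((extN G X \ W₁) ∩ A) ≤ 2 * i + 5 := by
    intro i X hX hXW
    have hXK : X ⊆ K := fun x hx => hKmem (disjoint_left.mp hXW hx)
    set Z := (extN G X \ W₁) ∩ A with hZ
    have hlow : ∀ z ∈ Z, a ≤ lvl G K p z + (i + 1) := by
      intro z hz
      rw [hZ, mem_inter, mem_sdiff, mem_extN] at hz
      obtain ⟨⟨⟨-, x, hx, hxz⟩, -⟩, hzA⟩ := hz
      have h1 : JoinedIn G K (i + 1) y z :=
        ((hX.2 x hx).mono hXK le_rfl).step hxz (hAK hzA)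
      exact (hy.trans h1).lvl_le_add h1.symm
    have hpath : ∀ {b} (q₀ : G.Walk p b), (∀ z ∈ q₀.support, lvl G K p z ≤ a) →
        (∀ z ∈ q₀.support, ∀ z' ∈ q₀.support, lvl G K p z = lvl G K p z' → z = z') →
        #{z ∈ Z | z ∈ q₀.support} ≤ i + 2 := by
      intro b q₀ h1 h2
      have h3 : #{z ∈ Z | z ∈ q₀.support} ≤ #(Finset.Icc (a - (i + 1)) a) := by
        refine card_le_card_of_injOn (lvl G K p) (fun z hz => ?_) (fun z hz z' hz' h => ?_)
        · rw [mem_coe, mem_filter] at hz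
          have := hlow z hz.1
          have := h1 z hz.2
          rw [mem_coe, mem_Icc]
          omega
        · rw [mem_coe, mem_filter] at hz hz'
          exact h2 z hz.2 z' hz'.2 h
      rw [Nat.card_Icc] at h3
      omega
    have hsub : Z ⊆ {u} ∪ ({z ∈ Z | z ∈ q.support} ∪ {z ∈ Z | z ∈ q'.support}) := by
      intro z hz
      rcases hAmem.mp (mem_inter.mp hz).2 with h | h | h <;> simp [h, hz]
    have h1 := hpath q q4 q5
    have h2 := hpath q' (fun z hz => (q4' z hz).trans hl1.le) q5'
    have h3 := (card_le_card hsub).trans (card_union_le _ _)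
    have h4 := card_union_le {z ∈ Z | z ∈ q.support} {z ∈ Z | z ∈ q'.support}
    rw [card_singleton] at h3
    omega
  have hr : 1 ≤ P.r := by
    by_contra! h0
    have h1 := hS.r_ge
    have h2 := hS.M_pos
    rw [show P.r = 0 by omega] at h1
    simp at h1
    omega
  obtain ⟨X, hX1, hX2, hX3, hX4⟩ := hyfine.exists_cubic_growth hS.h_le hobst (P.r - 1)
  rw [show P.r - 1 + 1 = P.r by omega] at hX1
  obtain ⟨B, hXB, hBS, hBc, hBr⟩ := hX1.exists_growth (S := (univ \ W₁) \ A.erase y)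
    (N := Fintype.card V / 2) hS.growth (by
      intro x hx
      rw [mem_sdiff, mem_sdiff, mem_erase]
      exact ⟨⟨mem_univ _, disjoint_left.mp hX2 hx⟩, fun h => h.1 (hX3 x hx h.2)⟩) (by
      intro Y hXY hYS hYc
      have hY : Y.Nonempty := ⟨y, hXY hX1.1⟩
      have h1 := hexp Y hY (disjoint_left.mpr fun x hx =>
        (mem_sdiff.mp (mem_sdiff.mp (hYS hx)).1).2) (by omega)
      have h2 := card_le_card_sdiff_add (extN G Y \ W₁) (A.erase y)
      have h3 : (extN G Y \ W₁) \ A.erase y ⊆ extN G Y ∩ ((univ \ W₁) \ A.erase y) := by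
        intro x hx
        rw [mem_sdiff, mem_sdiff] at hx
        rw [mem_inter, mem_sdiff, mem_sdiff]
        exact ⟨hx.1.1, ⟨mem_univ _, hx.1.2⟩, hx.2⟩
      have h4 := card_le_card h3
      have h5 : #(A.erase y) ≤ 2 * (P.m + P.R) + 5 :=
        (card_le_card (erase_subset _ _)).trans hAc
      have h6 := card_le_card hXY
      have h7 : P.r ^ 3 ≤ 64 * #X := by
        rcases hX4 with h | h
        · omega
        · exact (Nat.pow_le_pow_left (by omega) 3).trans h
      have h8 := hS.r_ge
      have h9 : 4 * P.M * #(A.erase y) ≤ #Y := by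
        have : 256 * P.M * #(A.erase y) ≤ 256 * P.M * (2 * (P.m + P.R) + 5) :=
          Nat.mul_le_mul_left _ h5
        nlinarith
      have h10 : 2 * P.M * #(extN G Y \ W₁) ≤
          2 * P.M * (#(extN G Y ∩ ((univ \ W₁) \ A.erase y)) + #(A.erase y)) :=
        Nat.mul_le_mul_left _ (by omega)
      nlinarith)
  have hBmem : ∀ x ∈ B, x ∉ W₁ ∧ (x ∈ A → x = y) := by
    intro x hx
    have := hBS hx
    rw [mem_sdiff, mem_sdiff, mem_erase] at this
    exact ⟨this.1.2, fun hxA => by_contra fun hne => this.2 ⟨hne, hxA⟩⟩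
  refine ⟨y, A, B, a, hAmem.mpr (Or.inr (Or.inl q.start_mem_support)),
    disjoint_of_subset_left hAK hKW, hAc,
    ⟨q, q1, q2, fun x hx => hAmem.mpr (Or.inr (Or.inl hx))⟩,
    ⟨(q'.concat hy'u).concat hyu.symm, ?_, ?_, fun x hx => ?_⟩,
    ⟨hBr.1, fun x hx => (hBr.2 x hx).mono subset_rfl hS.r_add_R⟩,
    disjoint_left.mpr fun x hx hxW => (hBmem x hx).1 (hWW₁ hxW),
    fun x hx => (hBmem x hx).2, by omega, ham⟩
  · rw [SimpleGraph.Walk.concat_isPath_iff, SimpleGraph.Walk.concat_isPath_iff]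
    refine ⟨⟨q1', huq'⟩, fun h => ?_⟩
    rw [SimpleGraph.Walk.support_concat, List.mem_append, List.mem_singleton] at h
    rcases h with h | h
    exacts [hyq' h, hyu.ne h]
  · rw [SimpleGraph.Walk.length_concat, SimpleGraph.Walk.length_concat, q2', hl1]
  · rw [SimpleGraph.Walk.support_concat, SimpleGraph.Walk.support_concat, List.mem_append,
      List.mem_append, List.mem_singleton, List.mem_singleton] at hx
    rcases hx with (hx | rfl) | rfl
    exacts [hAmem.mpr (Or.inr (Or.inr hx)), hAmem.mpr (Or.inl rfl),
      hAmem.mpr (Or.inr (Or.inl q.end_mem_support))]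

end

section
open scoped Classical
open Finset

variable {V : Type*} {G : SimpleGraph V} {P : Params}

lemma isPath_append {a b c : V} {p : G.Walk a b} {q : G.Walk b c} (hp : p.IsPath)
    (hq : q.IsPath) (h : ∀ x ∈ p.support, x ∈ q.support → x = b) : (p.append q).IsPath := by
  rw [SimpleGraph.Walk.isPath_def, SimpleGraph.Walk.support_append, List.nodup_append']
  refine ⟨hp.support_nodup, hq.support_nodup.tail, fun x hx hx' => ?_⟩
  have hxb := h x hx (List.mem_of_mem_tail hx')
  subst hxb
  have h1 := hq.support_nodup
  rw [← SimpleGraph.Walk.cons_tail_support, List.nodup_cons] at h1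
  exact h1.1 hx'

variable [Fintype V]

/-- A chain of detours: a set `A` contains paths from `v` to `p` whose lengths run through an
arithmetic progression with difference two. -/
lemma Setting.exists_adjuster (hS : Setting G P) {U F : Finset V} {v : V} {t : ℕ}
    (hF : IsRad G P.m v F) (hFU : Disjoint F U)
    (hFc : 2 * P.L * ((1 + 2 * P.L) * P.w) ≤ #F)
    (hn : 4 * P.L * ((1 + 2 * P.L) * P.w) ≤ Fintype.card V)
    (hU : #U + t * (2 * (P.m + P.R) + 5) ≤ P.w) :
    ∃ p A B a, p ∈ A ∧ Disjoint A U ∧ #A ≤ t * (2 * (P.m + P.R) + 5) + 1 ∧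
      IsRad G P.m p B ∧ Disjoint B U ∧ (∀ x ∈ B, x ∈ A → x = p) ∧
      2 * P.L * ((1 + 2 * P.L) * P.w) ≤ #B ∧ a ≤ t * (P.m + P.R) ∧
      ∀ j ≤ t, ∃ q : G.Walk v p, q.IsPath ∧ q.length = a + 2 * j ∧ ∀ x ∈ q.support, x ∈ A := by
  induction t with
  | zero =>
    refine ⟨v, {v}, F, 0, by simp, ?_, by simp, hF, hFU, by simp, hFc, by simp, fun j hj => ?_⟩
    · simpa using disjoint_left.mp hFU hF.1
    · exact ⟨.nil, by simp, by simp; omega, by simp⟩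
  | succ t ih =>
    obtain ⟨p, A, B, a, hpA, hAU, hAc, hB, hBU, hBA, hBc, ha, hpath⟩ := ih (by nlinarith)
    have hW : #(U ∪ A.erase p) ≤ P.w := by
      have h1 := card_union_le U (A.erase p)
      rw [card_erase_of_mem hpA] at h1
      have h2 : (t + 1) * (2 * (P.m + P.R) + 5) =
        t * (2 * (P.m + P.R) + 5) + (2 * (P.m + P.R) + 5) := by ring
      omega
    obtain ⟨y, A', B', a', hpA', hA'W, hA'c, ⟨q, q1, q2, q3⟩, ⟨q', q1', q2', q3'⟩, hB', hB'W,
      hB'A', hB'c, ha'⟩ := hS.exists_detour hW hB (disjoint_union_right.mpr ⟨hBU,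
        disjoint_left.mpr fun x hx hx' => (mem_erase.mp hx').1 (hBA x hx (mem_erase.mp hx').2)⟩) hBc
    rw [disjoint_union_right] at hA'W hB'W
    have hAA' : ∀ x ∈ A, x ∈ A' → x = p := fun x hx hx' => by
      by_contra hne
      exact disjoint_left.mp hA'W.2 hx' (mem_erase.mpr ⟨hne, hx⟩)
    have hglue : ∀ {b} (q₀ : G.Walk v p) (q₁ : G.Walk p b), q₀.IsPath → q₁.IsPath →
        (∀ x ∈ q₀.support, x ∈ A) → (∀ x ∈ q₁.support, x ∈ A') →
        (q₀.append q₁).IsPath ∧ ∀ x ∈ (q₀.append q₁).support, x ∈ A ∪ A' := by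
      intro b q₀ q₁ h1 h2 h3 h4
      refine ⟨isPath_append h1 h2 fun x hx hx' => hAA' x (h3 x hx) (h4 x hx'), fun x hx => ?_⟩
      rcases (SimpleGraph.Walk.mem_support_append_iff _ _).mp hx with hx | hx
      exacts [mem_union_left _ (h3 x hx), mem_union_right _ (h4 x hx)]
    refine ⟨y, A ∪ A', B', a + a', mem_union_right _ (q3 _ q.end_mem_support),
      disjoint_union_left.mpr ⟨hAU, hA'W.1⟩, ?_, hB', hB'W.1, ?_, ?_, ?_, fun j hj => ?_⟩
    · have h1 := card_union_le A A'
      have h2 : (t + 1) * (2 * (P.m + P.R) + 5) =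
        t * (2 * (P.m + P.R) + 5) + (2 * (P.m + P.R) + 5) := by ring
      omega
    · intro x hx hx'
      by_cases hxA' : x ∈ A'
      · exact hB'A' x hx hxA'
      · have hxA := (mem_union.mp hx').resolve_right hxA'
        have hne : x ≠ p := fun h => hxA' (h ▸ hpA')
        exact (disjoint_left.mp hB'W.2 hx (mem_erase.mpr ⟨hne, hxA⟩)).elim
    · nlinarith
    · nlinarith
    · rcases Nat.lt_or_ge j (t + 1) with hj' | hj'
      · obtain ⟨q₀, h1, h2, h3⟩ := hpath j (by omega)
        obtain ⟨h4, h5⟩ := hglue q₀ q h1 q1 h3 q3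
        exact ⟨_, h4, by rw [SimpleGraph.Walk.length_append]; omega, h5⟩
      · obtain ⟨q₀, h1, h2, h3⟩ := hpath t le_rfl
        obtain ⟨h4, h5⟩ := hglue q₀ q' h1 q1' h3 q3'
        exact ⟨_, h4, by rw [SimpleGraph.Walk.length_append]; omega, h5⟩

end

section
open scoped Classical
open Finset

variable {V : Type*} {G : SimpleGraph V} {P : Params}

/-- The set `W` is negligible for the growth of `Y`. -/
def Negligible (P : Params) (W Y : Finset V) : Prop :=
  2 * P.M * #W ≤ #Y ∨ 2 * P.L * #W ≤ #Y ∧ 2 * P.M * #W ≤ P.B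

/-- A small set meets at most half of the members of a family of small degree. -/
lemma card_le_two_mul_card_disjoint {E Q : Finset V} {A : V → Finset V} {κ : ℕ}
    (hdeg : ∀ x ∈ Q, #{e ∈ E | x ∈ A e} ≤ κ) (hQ : 2 * κ * #Q ≤ #E) :
    #E ≤ 2 * #{e ∈ E | Disjoint (A e) Q} := by
  have h1 : #{e ∈ E | ¬ Disjoint (A e) Q} ≤ #Q * κ := by
    refine (card_le_card (t := Q.biUnion fun x => {e ∈ E | x ∈ A e}) fun e he => ?_).trans
      (card_biUnion_le_card_mul _ _ _ hdeg)
    obtain ⟨he, hd⟩ := mem_filter.mp he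
    obtain ⟨x, hx, hx'⟩ := not_disjoint_iff.mp hd
    exact mem_biUnion.mpr ⟨x, hx', mem_filter.mpr ⟨he, hx⟩⟩
  have h2 := card_filter_add_card_filter_not (s := E) (fun e => Disjoint (A e) Q)
  nlinarith

variable [Fintype V]

namespace Setting

lemma expand_of_negligible (hS : Setting G P) {W Y X : Finset V} (h : Negligible P W Y)
    (hY : Y.Nonempty) (hYX : Y ⊆ X) (hX : #X ≤ Fintype.card V / 2) :
    #X ≤ 4 * P.M * #(extN G X ∩ (univ \ W)) := by
  have h0 : extN G X ∩ (univ \ W) = extN G X \ W := by ext; simp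
  rw [h0]
  have hc := card_le_card hYX
  have hXn : 2 * #X ≤ Fintype.card V := by omega
  rcases h with h | ⟨h1, h2⟩
  · have h1 := card_le_card_sdiff_add (extN G X) W
    have h2 := hS.expand X (hY.mono hYX) hXn
    have h3 : P.M * #(extN G X) ≤ P.M * (#(extN G X \ W) + #W) := Nat.mul_le_mul_left _ h1
    nlinarith
  · have := hS.expand_sdiff (hY.mono hYX) hXn (h1.trans hc) h2
    nlinarith

lemma exists_growth_sdiff (hS : Setting G P) {W Y : Finset V} (h : Negligible P W Y)
    (hY : Y.Nonempty) (hYW : Disjoint Y W) :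
    ∃ B, Y ⊆ B ∧ Disjoint B W ∧ Fintype.card V / 2 < #B ∧
      ∀ x ∈ B, ∃ y ∈ Y, JoinedIn G B P.R y x := by
  have hsub : Y ⊆ univ \ W := fun x hx => by simpa using disjoint_left.mp hYW hx
  obtain ⟨B, h1, h2, h3, h4⟩ := exists_growth hS.growth hY hsub
    fun X hX _ hXc => hS.expand_of_negligible h hY hX hXc
  exact ⟨B, h1, disjoint_left.mpr fun x hx => by simpa using h2 hx, h3, h4⟩

lemma exists_joinedIn_sdiff (hS : Setting G P) {W Y Z : Finset V} (hWY : Negligible P W Y)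
    (hWZ : Negligible P W Z) (hY : Y.Nonempty) (hZ : Z.Nonempty) (hYW : Disjoint Y W)
    (hZW : Disjoint Z W) : ∃ y ∈ Y, ∃ z ∈ Z, JoinedIn G (univ \ W) (P.R + P.R) y z :=
  exists_joinedIn_of_growth hS.growth hY hZ
    (fun x hx => by simpa using disjoint_left.mp hYW hx)
    (fun x hx => by simpa using disjoint_left.mp hZW hx)
    (fun _ hX _ hXc => hS.expand_of_negligible hWY hY hX hXc)
    (fun _ hX _ hXc => hS.expand_of_negligible hWZ hZ hX hXc)

/-- Outside of any set which is not too large there are sets of small radius. -/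
lemma exists_isRad_disjoint (hS : Setting G P) {Z : Finset V} {s : ℕ}
    (hZ : 8 * P.M * #Z ≤ Fintype.card V) (hs : 1 ≤ s) (hsV : 4 * s ≤ Fintype.card V) :
    ∃ y S, Disjoint S Z ∧ #S = s ∧ IsRad G P.R y S := by
  obtain ⟨X, hXZ, hXc, hX, hcore⟩ := exists_core (G := G) (4 * P.M) (Fintype.card V / 2) Z
  have hM := hS.M_pos
  have hXM : #X ≤ 2 * P.M * #Z := by
    rcases X.eq_empty_or_nonempty with rfl | hne
    · simp
    · have h1 := hS.expand X hne (by omega)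
      have h2 := card_le_card_sdiff_add (extN G X) Z
      have h3 : P.M * #(extN G X) ≤ P.M * (#(extN G X \ Z) + #Z) := Nat.mul_le_mul_left _ h2
      nlinarith
  have hX4 : 4 * #X ≤ Fintype.card V := by nlinarith
  have hZ8 : 8 * #Z ≤ Fintype.card V := by nlinarith
  have hlt : #(Z ∪ X) < #(univ : Finset V) := by
    have := card_union_le Z X
    rw [card_univ]
    omega
  obtain ⟨y, -, hy⟩ := exists_mem_notMem_of_card_lt_card hlt
  obtain ⟨S, hyS, hSsub, hSc, hSj⟩ := exists_growth (N := Fintype.card V / 4) hS.growth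
    (singleton_nonempty y) (S := univ \ (Z ∪ X)) (by simpa using hy) fun Y hY hYS hYc => by
      have h0 : extN G Y ∩ (univ \ (Z ∪ X)) = extN G Y \ (Z ∪ X) := by ext; simp
      rw [h0]
      exact (hcore Y ⟨y, hY (mem_singleton_self y)⟩
        (disjoint_left.mpr fun x hx => (mem_sdiff.mp (hYS hx)).2) (by omega)).le
  have hrad : IsRad G P.R y S := ⟨hyS (mem_singleton_self y), fun x hx => by
    obtain ⟨y', hy', h⟩ := hSj x hx
    rwa [mem_singleton.mp hy'] at h⟩
  obtain ⟨T, hTS, hTc, hT⟩ := hrad.exists_subset_card hs (by omega)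
  refine ⟨y, T, disjoint_left.mpr fun x hx hxZ => ?_, hTc, hT⟩
  have := hSsub (hTS hx)
  simp [hxZ] at this

/-- There are many short walks which start in `F` and do not overlap much outside of `F`. -/
lemma exists_walk_system (hS : Setting G P) {W F : Finset V} (hF : F.Nonempty)
    (hFW : Disjoint F W) {N κ c : ℕ} (hN : 2 * N ≤ Fintype.card V) (hκ : 1 ≤ κ)
    (hc : N * (P.R + 1) ≤ κ * c) (hL : 2 * P.L * (#W + c) ≤ #F) (hM : 2 * P.M * (#W + c) ≤ P.B) :
    ∃ (E : Finset V) (A : V → Finset V), #E = N ∧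
      (∀ e ∈ E, (∃ y ∈ F, JoinedIn G (A e) P.R y e) ∧ Disjoint (A e) W ∧ #(A e) ≤ P.R + 1) ∧
      ∀ x ∉ F, #{e ∈ E | x ∈ A e} ≤ κ := by
  suffices h : ∀ i ≤ N, ∃ (E : Finset V) (A : V → Finset V), #E = i ∧
      (∀ e ∈ E, (∃ y ∈ F, JoinedIn G (A e) P.R y e) ∧ Disjoint (A e) W ∧ #(A e) ≤ P.R + 1) ∧
      ∀ x ∉ F, #{e ∈ E | x ∈ A e} ≤ κ from h N le_rfl
  intro i hi
  induction i with
  | zero => exact ⟨∅, fun _ => ∅, by simp⟩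
  | succ i ih =>
    obtain ⟨E, A, hE, hA, hdeg⟩ := ih (by omega)
    set sat : Finset V := {x | x ∉ F ∧ κ ≤ #{e ∈ E | x ∈ A e}} with hsat
    have h1 : #sat * κ ≤ κ * c := by
      have h2 : #sat * κ ≤ ∑ x ∈ sat, #{e ∈ E | x ∈ A e} := by
        rw [← smul_eq_mul]
        exact card_nsmul_le_sum _ _ _ fun x hx => (mem_filter.mp hx).2.2
      have h3 : ∑ x ∈ sat, #{e ∈ E | x ∈ A e} = ∑ e ∈ E, #{x ∈ sat | x ∈ A e} :=
        sum_card_bipartiteAbove_eq_sum_card_bipartiteBelow (fun x e => x ∈ A e)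
      have h4 : ∑ e ∈ E, #{x ∈ sat | x ∈ A e} ≤ #E • (P.R + 1) :=
        sum_le_card_nsmul _ _ _ fun e he => (card_le_card fun x hx => (mem_filter.mp hx).2).trans
          (hA e he).2.2
      have h5 : #E • (P.R + 1) ≤ N * (P.R + 1) := by
        rw [smul_eq_mul]; exact Nat.mul_le_mul_right _ (by omega)
      omega
    have hsc : #sat ≤ c := by
      rw [Nat.mul_comm] at h1
      exact Nat.le_of_mul_le_mul_left h1 hκ
    have hWs : #(W ∪ sat) ≤ #W + c := (card_union_le _ _).trans (by omega)
    have hFs : Disjoint F (W ∪ sat) := disjoint_union_right.mpr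
      ⟨hFW, disjoint_left.mpr fun x hx hx' => (mem_filter.mp hx').2.1 hx⟩
    obtain ⟨Z, -, hZW, hZc, hZ⟩ := hS.exists_growth_sdiff (W := W ∪ sat) (Y := F)
      (Or.inr ⟨(Nat.mul_le_mul_left _ hWs).trans hL, (Nat.mul_le_mul_left _ hWs).trans hM⟩) hF hFs
    obtain ⟨e, heZ, heE⟩ := exists_mem_notMem_of_card_lt_card (s := E) (t := Z) (by omega)
    obtain ⟨y, hy, w, hw, hwZ⟩ := hZ e heZ
    refine ⟨insert e E, Function.update A e w.support.toFinset, ?_, ?_, ?_⟩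
    · rw [card_insert_of_notMem heE, hE]
    · intro e' he'
      rcases eq_or_ne e' e with rfl | hne
      · rw [Function.update_self]
        refine ⟨⟨y, hy, w, hw, by simp⟩, disjoint_left.mpr fun x hx => ?_, ?_⟩
        · exact disjoint_left.mp (disjoint_union_right.mp hZW).1 (hwZ x (by simpa using hx))
        · refine (List.toFinset_card_le _).trans ?_
          rw [SimpleGraph.Walk.length_support]
          omega
      · rw [Function.update_of_ne hne]
        exact hA e' ((mem_insert.mp he').resolve_left hne)
    · intro x hx
      have hsub : {e' ∈ E | x ∈ Function.update A e w.support.toFinset e'} =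
          {e' ∈ E | x ∈ A e'} := filter_congr fun e' he' => by
        rw [Function.update_of_ne (ne_of_mem_of_not_mem he' heE)]
      rw [filter_insert, hsub, Function.update_self]
      split_ifs with hxw
      · have hxs : x ∉ sat := disjoint_left.mp (disjoint_union_right.mp hZW).2
          (hwZ x (by simpa using hxw))
        have : #{e' ∈ E | x ∈ A e'} < κ := by
          by_contra hcon
          exact hxs (mem_filter.mpr ⟨mem_univ _, hx, not_lt.mp hcon⟩)
        exact (card_insert_le _ _).trans (by omega)
      · exact hdeg x hx

end Setting

end

section
open scoped Classical
open Finset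

variable {V : Type*} {G : SimpleGraph V} {P : Params}

/-- There is a path of length `l` from `p` to a vertex of a set of size `σ` and of small radius.
Path and set avoid `W`, and apart from vertices in `Q` they also avoid `Z`. -/
def HasChain (G : SimpleGraph V) (P : Params) (W Z Q : Finset V) (σ : ℕ) (p : V) (l : ℕ) :
    Prop :=
  ∃ (y s : V) (S : Finset V) (w : G.Walk p s), w.IsPath ∧ w.length = l ∧ s ∈ S ∧ #S = σ ∧
    IsRad G P.R y S ∧ Disjoint S (W ∪ Z) ∧ (∀ x ∈ w.support, x ∈ S → x = s) ∧
    (∀ x ∈ w.support, x ∉ W) ∧ ∀ x ∈ w.support, x ∈ Z → x ∈ Q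

lemma card_support_le {a b : V} (w : G.Walk a b) : #w.support.toFinset ≤ w.length + 1 := by
  refine (List.toFinset_card_le _).trans ?_
  rw [SimpleGraph.Walk.length_support]

variable [Fintype V]

namespace Setting

lemma exists_hasChain (hS : Setting G P) {W Z F : Finset V} {σ : ℕ} {p : V}
    (hF : IsRad G P.m p F) (hFW : Disjoint F W) (hNF : Negligible P W F)
    (hσ : 1 ≤ σ) (hσV : 4 * σ ≤ Fintype.card V) (hσW : 2 * P.M * #W ≤ σ)
    (hZ : 8 * P.M * (#W + #Z) ≤ Fintype.card V) :
    ∃ (Q : Finset V) (l : ℕ), #Q ≤ P.m + 2 * P.R + 1 ∧ Disjoint Q W ∧ l ≤ P.m + 2 * P.R ∧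
      HasChain G P W Z Q σ p l := by
  obtain ⟨y, S, hSd, hSc, hSr⟩ := hS.exists_isRad_disjoint (Z := W ∪ Z) (s := σ)
    ((Nat.mul_le_mul_left _ (card_union_le _ _)).trans hZ) hσ hσV
  obtain ⟨f, hf, z, hz, hj⟩ := hS.exists_joinedIn_sdiff hNF (Z := S) (Or.inl (hσW.trans hSc.ge))
    ⟨p, hF.1⟩ ⟨y, hSr.1⟩ hFW (disjoint_union_right.mp hSd).1
  have hpz : JoinedIn G (univ \ W) (P.m + (P.R + P.R)) p z :=
    ((hF.2 f hf).mono (fun x hx => by simpa using disjoint_left.mp hFW hx) le_rfl).trans hj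
  obtain ⟨s, hs, w, hw, hwl, hwW, hws⟩ := hpz.exists_path_first_hit hz
  refine ⟨w.support.toFinset, w.length, (card_support_le w).trans (by omega),
    disjoint_left.mpr fun x hx => ?_, by omega, y, s, S, w, hw, rfl, hs, hSc, hSr, hSd, hws,
    fun x hx => ?_, fun x hx _ => by simpa using hx⟩
  · simpa using hwW x (by simpa using hx)
  · simpa using hwW x hx

lemma exists_hasChain_succ (hS : Setting G P) {W Z Q : Finset V} {σ l : ℕ} {p : V}
    (h : HasChain G P W Z Q σ p l) (hσ : 1 ≤ σ) (hσV : 4 * σ ≤ Fintype.card V)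
    (hσW : 2 * P.M * (#W + #Z + (l + 1)) ≤ σ)
    (hZ : 8 * P.M * (#W + #Z + (l + 1) + σ) ≤ Fintype.card V) :
    ∃ l', l < l' ∧ l' ≤ l + 4 * P.R ∧ HasChain G P W Z Q σ p l' := by
  obtain ⟨y, s, S, w, hw, hwl, hs, hSc, hSr, hSd, hws, hwW, hwQ⟩ := h
  have hwc := card_support_le w
  have hc1 := card_union_le W Z
  have hc2 := card_union_le (W ∪ Z) w.support.toFinset
  have hc3 := card_union_le ((W ∪ Z) ∪ w.support.toFinset) S
  obtain ⟨y', S', hSd', hSc', hSr'⟩ := hS.exists_isRad_disjoint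
    (Z := ((W ∪ Z) ∪ w.support.toFinset) ∪ S) (s := σ)
    ((Nat.mul_le_mul_left _ (by omega)).trans hZ) hσ hσV
  have hd1 := disjoint_union_right.mp hSd'
  have hd2 := disjoint_union_right.mp hd1.1
  set D := (W ∪ Z) ∪ w.support.toFinset.erase s with hD
  have hc4 : #D ≤ #W + #Z + (l + 1) := by
    have h1 : #D ≤ _ := card_union_le (W ∪ Z) (w.support.toFinset.erase s)
    have h2 := card_erase_le (s := w.support.toFinset) (a := s)
    omega
  have hneg : 2 * P.M * #D ≤ σ := (Nat.mul_le_mul_left _ hc4).trans hσW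
  have hSD : Disjoint S D := disjoint_union_right.mpr ⟨hSd, disjoint_left.mpr fun x hx hx' =>
    (mem_erase.mp hx').1 (hws x (by simpa using (mem_erase.mp hx').2) hx)⟩
  have hSD' : Disjoint S' D := disjoint_union_right.mpr ⟨hd2.1, disjoint_left.mpr fun x hx hx' =>
    disjoint_left.mp hd2.2 hx (mem_erase.mp hx').2⟩
  obtain ⟨a, ha, b, hb, hab⟩ := hS.exists_joinedIn_sdiff (W := D) (Y := S) (Z := S')
    (Or.inl (hneg.trans hSc.ge)) (Or.inl (hneg.trans hSc'.ge)) ⟨s, hs⟩ ⟨y', hSr'.1⟩ hSD hSD'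
  have hsub : S ⊆ univ \ D := fun x hx => by simpa using disjoint_left.mp hSD hx
  have hsb : JoinedIn G (univ \ D) (P.R + P.R + (P.R + P.R)) s b :=
    (((hSr.2 s hs).symm.trans (hSr.2 a ha)).mono hsub le_rfl).trans hab
  obtain ⟨s', hs', q, hq, hql, hqD, hqs⟩ := hsb.exists_path_first_hit hb
  have hne : s ≠ s' := fun h => disjoint_left.mp hd1.2 hs' (h ▸ hs)
  have hqpos : 0 < q.length := by
    by_contra h0
    exact hne (SimpleGraph.Walk.eq_of_length_eq_zero (by omega : q.length = 0))
  have hqD' : ∀ x ∈ q.support, (x ∉ W ∧ x ∉ Z) ∧ (x ∈ w.support → x = s) := fun x hx => by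
    have h1 := hqD x hx
    simp only [hD, mem_sdiff, mem_univ, true_and, mem_union, mem_erase, List.mem_toFinset,
      not_or, not_and] at h1
    exact ⟨h1.1, fun h2 => by_contra fun h3 => h1.2 h3 h2⟩
  refine ⟨l + q.length, by omega, by omega, y', s', S', w.append q,
    isPath_append hw hq fun x hx hx' => (hqD' x hx').2 hx, ?_, hs', hSc', hSr', hd2.1, ?_, ?_, ?_⟩
  · rw [SimpleGraph.Walk.length_append, hwl]
  · intro x hx hxS
    rcases (SimpleGraph.Walk.mem_support_append_iff _ _).mp hx with hx | hx
    · exact (disjoint_left.mp hd2.2 hxS (by simpa using hx)).elim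
    · exact hqs x hx hxS
  · intro x hx
    rcases (SimpleGraph.Walk.mem_support_append_iff _ _).mp hx with hx | hx
    exacts [hwW x hx, (hqD' x hx).1.1]
  · intro x hx hxZ
    rcases (SimpleGraph.Walk.mem_support_append_iff _ _).mp hx with hx | hx
    exacts [hwQ x hx hxZ, ((hqD' x hx).1.2 hxZ).elim]

/-- There are chains of approximately any prescribed length. -/
lemma exists_hasChain_near (hS : Setting G P) {W Z Q : Finset V} {σ l₀ T : ℕ} {p : V}
    (h : HasChain G P W Z Q σ p l₀) (hl₀ : l₀ ≤ P.m + 2 * P.R) (hσ : 1 ≤ σ)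
    (hσV : 4 * σ ≤ Fintype.card V) (hσW : 2 * P.M * (#W + #Z + (T + 1)) ≤ σ)
    (hZ : 8 * P.M * (#W + #Z + (T + 1) + σ) ≤ Fintype.card V) (hT : P.m + 2 * P.R ≤ T) :
    ∃ l, l ≤ T ∧ T ≤ l + (P.m + 4 * P.R) ∧ HasChain G P W Z Q σ p l := by
  induction T, hT using Nat.le_induction with
  | base => exact ⟨l₀, hl₀, by omega, h⟩
  | succ T hT ih =>
    obtain ⟨l, h1, h2, h3⟩ := ih
      ((Nat.mul_le_mul_left _ (by omega)).trans hσW) ((Nat.mul_le_mul_left _ (by omega)).trans hZ)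
    rcases Nat.lt_or_ge T (l + (P.m + 4 * P.R)) with hlt | hge
    · exact ⟨l, by omega, by omega, h3⟩
    · obtain ⟨l', h4, h5, h6⟩ := hS.exists_hasChain_succ h3 hσ hσV
        ((Nat.mul_le_mul_left _ (by omega)).trans hσW)
        ((Nat.mul_le_mul_left _ (by omega)).trans hZ)
      exact ⟨l', by omega, by omega, h6⟩

end Setting

end

section
open scoped Classical
open Finset

variable {V : Type*} {G : SimpleGraph V} {P : Params} [Fintype V]

namespace Setting

/-- Two small expansions are joined by a path of approximately any prescribed length. -/
lemma exists_path_near (hS : Setting G P) {W F K : Finset V} {p v : V} {N κ c σ T : ℕ}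
    (hF : IsRad G P.m p F) (hK : IsRad G P.m v K) (hFW : Disjoint F W) (hKW : Disjoint K W)
    (hFK : Disjoint F K) (hNF : Negligible P (W ∪ K) F)
    (hL : 2 * P.L * (#W + c) ≤ #K) (hM : 2 * P.M * (#W + c) ≤ P.B)
    (hN : 2 * N ≤ Fintype.card V) (hκ : 1 ≤ κ) (hc : N * (P.R + 1) ≤ κ * c)
    (hκN : 2 * κ * (P.m + 2 * P.R + 1) ≤ N) (hσV : 4 * σ ≤ Fintype.card V)
    (hσ : 2 * P.M * (#W + #K + N * (P.R + 1) + (T + 1)) ≤ σ)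
    (hσ' : 8 * P.M * (#W + #K + N * (P.R + 1) + (T + 1) + σ) ≤ Fintype.card V)
    (hNT : 4 * P.M * (#W + (T + 1)) ≤ N) (hT : P.m + 2 * P.R ≤ T) :
    ∃ w : G.Walk p v, w.IsPath ∧ T ≤ w.length + (P.m + 4 * P.R) ∧
      w.length ≤ T + (P.m + 5 * P.R) ∧ ∀ x ∈ w.support, x ∉ W := by
  have hMpos := hS.M_pos
  obtain ⟨E, A, hE, hA, hdeg⟩ := hS.exists_walk_system ⟨v, hK.1⟩ hKW hN hκ hc hL hM
  have hZc : #(E.biUnion A) ≤ N * (P.R + 1) :=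
    (card_biUnion_le_card_mul _ _ _ fun e he => (hA e he).2.2).trans_eq (by rw [hE])
  have hWK := card_union_le W K
  have hσ1 : 1 ≤ σ := by
    refine le_trans ?_ hσ
    exact Nat.mul_pos (by omega) (by omega)
  obtain ⟨Q, l₀, hQc, hQW, hl₀, hch⟩ := hS.exists_hasChain (Z := E.biUnion A) hF
    (disjoint_union_right.mpr ⟨hFW, hFK⟩) hNF hσ1 hσV
    ((Nat.mul_le_mul_left _ (by omega)).trans hσ) ((Nat.mul_le_mul_left _ (by omega)).trans hσ')
  obtain ⟨l, hlT, hTl, y, s, S, w, hw, hwl, hs, hSc, hSr, hSd, hws, hwW, hwQ⟩ :=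
    hS.exists_hasChain_near hch hl₀ hσ1 hσV ((Nat.mul_le_mul_left _ (by omega)).trans hσ)
    ((Nat.mul_le_mul_left _ (by omega)).trans hσ') hT
  rw [disjoint_union_right] at hQW
  rw [disjoint_union_right, disjoint_union_right] at hSd
  have hEc := card_le_two_mul_card_disjoint (E := E) (Q := Q) (A := A) (κ := κ)
    (fun x hx => hdeg x (disjoint_left.mp hQW.2 hx))
    ((Nat.mul_le_mul_left _ hQc).trans (hκN.trans hE.ge))
  set E' : Finset V := {e ∈ E | Disjoint (A e) Q} with hE'
  set D := W ∪ w.support.toFinset.erase s with hD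
  have hDc : #D ≤ #W + (T + 1) := by
    have h1 : #D ≤ _ := card_union_le W (w.support.toFinset.erase s)
    have h2 := card_erase_le (s := w.support.toFinset) (a := s)
    have h3 := card_support_le w
    omega
  have hσD : 2 * P.M * #D ≤ #S := (Nat.mul_le_mul_left _ (by omega)).trans (hσ.trans hSc.ge)
  have hED : 2 * P.M * #D ≤ #E' := by
    have h1 : 4 * P.M * #D ≤ N := (Nat.mul_le_mul_left _ hDc).trans hNT
    nlinarith
  have hmemD : ∀ {x}, x ∉ W → (x ∈ w.support → x = s) → x ∈ univ \ D := fun {x} h1 h2 => by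
    simp only [hD, mem_sdiff, mem_univ, true_and, mem_union, mem_erase, List.mem_toFinset]
    tauto
  have hAD : ∀ e ∈ E', A e ⊆ univ \ D := fun e he x hx => by
    obtain ⟨heE, hed⟩ := mem_filter.mp he
    exact hmemD (disjoint_left.mp (hA e heE).2.1 hx) fun hxw => (disjoint_left.mp hed hx
      (hwQ x hxw (mem_biUnion.mpr ⟨e, heE, hx⟩))).elim
  have hSD : S ⊆ univ \ D := fun x hx => hmemD (disjoint_left.mp hSd.1.1 hx) fun h => hws x h hx
  have hKD : K ⊆ univ \ D := fun x hx => hmemD (disjoint_left.mp hKW hx) fun h =>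
    (hwW x h (mem_union_right _ hx)).elim
  have hend : ∀ e ∈ E', e ∈ A e := fun e he => by
    obtain ⟨_, _, h⟩ := (hA e (mem_filter.mp he).1).1
    exact h.right_mem
  have hE'ne : E'.Nonempty := by
    have h1 : 0 < 4 * P.M * (#W + (T + 1)) := Nat.mul_pos (by omega) (by omega)
    exact card_pos.mp (by omega)
  obtain ⟨a, ha, e, he, hae⟩ := hS.exists_joinedIn_sdiff (W := D) (Y := S) (Z := E')
    (Or.inl hσD) (Or.inl hED) ⟨s, hs⟩ hE'ne
    (disjoint_left.mpr fun x hx => (mem_sdiff.mp (hSD hx)).2)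
    (disjoint_left.mpr fun x hx => (mem_sdiff.mp (hAD x hx (hend x hx))).2)
  obtain ⟨z, hz, hze⟩ := (hA e (mem_filter.mp he).1).1
  have hsv : JoinedIn G (univ \ D) (P.R + P.R + (P.R + P.R) + P.R + P.m) s v :=
    (((((hSr.2 s hs).symm.trans (hSr.2 a ha)).mono hSD le_rfl).trans hae).trans
      (hze.symm.mono (hAD e he) le_rfl)).trans ((hK.2 z hz).symm.mono hKD le_rfl)
  obtain ⟨q, hq, hql, hqD⟩ := hsv.exists_path
  have hqD' : ∀ x ∈ q.support, x ∉ W ∧ (x ∈ w.support → x = s) := fun x hx => by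
    have h1 := hqD x hx
    simp only [hD, mem_sdiff, mem_univ, true_and, mem_union, mem_erase, List.mem_toFinset] at h1
    tauto
  refine ⟨w.append q, isPath_append hw hq fun x hx hx' => (hqD' x hx').2 hx, ?_, ?_, ?_⟩
  · rw [SimpleGraph.Walk.length_append]; omega
  · rw [SimpleGraph.Walk.length_append]; omega
  · intro x hx
    rcases (SimpleGraph.Walk.mem_support_append_iff _ _).mp hx with hx | hx
    exacts [fun h => hwW x hx (mem_union_left _ h), (hqD' x hx).1]

/-- Two expansions are joined by a path of any prescribed length which is neither too small nor
too large and of the correct parity. -/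
lemma exists_path_length_eq (hS : Setting G P) {U F₁ F₂ : Finset V} {v₁ v₂ : V}
    {f N κ c σ ℓ : ℕ} (hF₁ : IsRad G P.m v₁ F₁) (hF₂ : IsRad G P.m v₂ F₂)
    (hU₁ : Disjoint F₁ U) (hU₂ : Disjoint F₂ U) (hFF : Disjoint F₁ F₂)
    (hf : 1 ≤ f) (hf₂ : f ≤ #F₂) (hf₁ : 2 * P.L * ((1 + 2 * P.L) * P.w) ≤ #F₁)
    (hw : #U + f + (P.m + 5 * P.R) * (2 * (P.m + P.R) + 5) ≤ P.w)
    (hV : 4 * P.L * ((1 + 2 * P.L) * P.w) ≤ Fintype.card V)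
    (hL : 2 * P.L * (#U + (P.m + 5 * P.R) * (2 * (P.m + P.R) + 5) + c) ≤ f)
    (hM : 2 * P.M * (P.w + c) ≤ P.B)
    (hN : 2 * N ≤ Fintype.card V) (hκ : 1 ≤ κ) (hc : N * (P.R + 1) ≤ κ * c)
    (hκN : 2 * κ * (P.m + 2 * P.R + 1) ≤ N) (hσV : 4 * σ ≤ Fintype.card V)
    (hσ : 2 * P.M * (P.w + N * (P.R + 1) + (ℓ + 1)) ≤ σ)
    (hσ' : 8 * P.M * (P.w + N * (P.R + 1) + (ℓ + 1) + σ) ≤ Fintype.card V)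
    (hNT : 4 * P.M * (P.w + (ℓ + 1)) ≤ N)
    (hℓ : (P.m + 5 * P.R) * (P.m + P.R) + 2 * (P.m + 5 * P.R) ≤ ℓ)
    (hpar : ∀ w : G.Walk v₁ v₂, w.length % 2 = ℓ % 2) :
    ∃ w : G.Walk v₁ v₂, w.IsPath ∧ w.length = ℓ ∧ ∀ x ∈ w.support, x ∉ U := by
  obtain ⟨K, hKF, hKc, hK⟩ := hF₂.exists_subset_card hf hf₂
  have hUK := card_union_le U K
  obtain ⟨p, A, B, a, hpA, hAU, hAc, hB, hBU, hBA, hBc, ha, hpath⟩ :=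
    hS.exists_adjuster (U := U ∪ K) (t := P.m + 5 * P.R) hF₁
      (disjoint_union_right.mpr ⟨hU₁, disjoint_of_subset_right hKF hFF⟩) hf₁ hV (by omega)
  rw [disjoint_union_right] at hAU hBU
  set W := U ∪ A.erase p with hWdef
  have hWc : #W ≤ #U + (P.m + 5 * P.R) * (2 * (P.m + P.R) + 5) := by
    have h1 : #W ≤ _ := card_union_le U (A.erase p)
    rw [card_erase_of_mem hpA] at h1
    omega
  have hWw : #W ≤ P.w := by omega
  have hWKw : #(W ∪ K) ≤ P.w := (card_union_le _ _).trans (by omega)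
  have hwle : P.w ≤ (1 + 2 * P.L) * P.w := Nat.le_mul_of_pos_left _ (by omega)
  obtain ⟨q, hq, hq1, hq2, hqW⟩ := hS.exists_path_near (W := W) (F := B) (K := K) (p := p)
    (T := ℓ - a - (P.m + 5 * P.R)) hB hK
    (disjoint_union_right.mpr ⟨hBU.1, disjoint_left.mpr fun x hx hx' =>
      (mem_erase.mp hx').1 (hBA x hx (mem_erase.mp hx').2)⟩)
    (disjoint_union_right.mpr ⟨disjoint_of_subset_left hKF hU₂, disjoint_left.mpr fun x hx hx' =>
      disjoint_left.mp hAU.2 (mem_erase.mp hx').2 hx⟩)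
    hBU.2 (Or.inr ⟨(Nat.mul_le_mul_left _ (hWKw.trans hwle)).trans hBc,
      (Nat.mul_le_mul (by omega) (hWKw.trans hwle)).trans hS.w_le⟩)
    ((Nat.mul_le_mul_left _ (by omega)).trans (hL.trans hKc.ge))
    ((Nat.mul_le_mul_left _ (by omega)).trans hM) hN hκ hc hκN hσV
    ((Nat.mul_le_mul_left _ (by omega)).trans hσ) ((Nat.mul_le_mul_left _ (by omega)).trans hσ')
    ((Nat.mul_le_mul_left _ (by omega)).trans hNT) (by omega)
  have hglue : ∀ q₀ : G.Walk v₁ p, q₀.IsPath → (∀ x ∈ q₀.support, x ∈ A) →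
      (q₀.append q).IsPath ∧ ∀ x ∈ (q₀.append q).support, x ∉ U := by
    intro q₀ h1 h2
    refine ⟨isPath_append h1 hq fun x hx hx' => ?_, fun x hx => ?_⟩
    · by_contra hne
      exact hqW x hx' (mem_union_right _ (mem_erase.mpr ⟨hne, h2 x hx⟩))
    · rcases (SimpleGraph.Walk.mem_support_append_iff _ _).mp hx with hx | hx
      exacts [disjoint_left.mp hAU.1 (h2 x hx), fun h => hqW x hx (mem_union_left _ h)]
  obtain ⟨q₀, -, hq₀, -⟩ := hpath 0 (by omega)
  have hpar₀ := hpar (q₀.append q)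
  rw [SimpleGraph.Walk.length_append, hq₀] at hpar₀
  obtain ⟨q₁, h1, h2, h3⟩ := hpath ((ℓ - a - q.length) / 2) (by omega)
  refine ⟨q₁.append q, (hglue q₁ h1 h3).1, ?_, (hglue q₁ h1 h3).2⟩
  rw [SimpleGraph.Walk.length_append, h2]
  omega

end Setting

end

section
open scoped Classical
open Finset

variable {V : Type*} {G : SimpleGraph V}

lemma IsBip.length_mod_two (hG : IsBip G) {a b : V} (hab : a ≠ b) (w : G.Walk a b) :
    w.length % 2 = piVal G a b % 2 := by
  obtain ⟨f, hf⟩ := hG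
  rw [piVal, if_neg hab]
  split_ifs with h
  · obtain ⟨w', hw'⟩ := h
    have h1 := walk_parity hf w
    rw [walk_parity hf w', Nat.even_iff, Nat.even_iff] at h1
    rw [Nat.odd_iff] at hw'
    omega
  · have h1 : ¬ Odd w.length := fun h1 => h ⟨w, h1⟩
    rw [Nat.not_odd_iff_even, Nat.even_iff] at h1
    omega

variable [Fintype V]

lemma extNbr_coe (X : Finset V) : extNbr G (X : Set V) = (extN G X : Set V) := by
  ext v
  simp [extNbr]

lemma MinDegGE.le_card_nbr {d : ℝ} (h : MinDegGE G d) (v : V) : d ≤ #(nbr G v) := by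
  have h1 : G.neighborSet v = (nbr G v : Set V) := by
    ext u
    simp
  have h2 := h v
  rwa [h1, Set.ncard_coe_finset] at h2

lemma one_le_log_fifteen_mul {y : ℝ} (hy : 1 ≤ y) : 1 ≤ Real.log (15 * y) := by
  rw [Real.le_log_iff_exp_le (by linarith)]
  linarith [Real.exp_one_lt_d9]

/-- In an expander with large minimum degree all sets expand. -/
lemma IsExpander.card_le {d δ : ℝ} (hG : IsExpander G 1 δ) (hdeg : MinDegGE G d) (hδ : 1 ≤ δ)
    (hδd : δ ≤ d) {X : Finset V} (hX : X.Nonempty) (hXV : 2 * #X ≤ Fintype.card V) :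
    (#X : ℝ) ≤ Real.log (15 * #X) ^ 2 * #(extN G X) := by
  have hX1 : (1 : ℝ) ≤ #X := by exact_mod_cast hX.card_pos
  have hlog := one_le_log_fifteen_mul hX1
  have hXV' : 2 * (#X : ℝ) ≤ Fintype.card V := by exact_mod_cast hXV
  rcases le_or_gt (δ / 2) #X with hc | hc
  · have h1 := hG (X : Set V) (by rwa [Set.ncard_coe_finset])
      (by rw [Set.ncard_coe_finset, Nat.card_eq_fintype_card]; linarith)
    rw [extNbr_coe, Set.ncard_coe_finset, Set.ncard_coe_finset, epsFn, if_neg (by linarith)] at h1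
    have h2 : 15 * (#X : ℝ) / δ ≤ 15 * #X := div_le_self (by linarith) hδ
    have h3 : 1 < 15 * (#X : ℝ) / δ := by
      rw [lt_div_iff₀ (by linarith)]
      linarith
    have h4 : 0 < Real.log (15 * #X / δ) := Real.log_pos h3
    rw [div_mul_eq_mul_div, one_mul, div_le_iff₀ (by positivity)] at h1
    have h5 : Real.log (15 * #X / δ) ^ 2 ≤ Real.log (15 * #X) ^ 2 := by
      gcongr
    nlinarith [(Nat.cast_nonneg #(extN G X) : (0 : ℝ) ≤ _)]
  · obtain ⟨v, hv⟩ := hX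
    have h1 := hdeg.le_card_nbr v
    have h2 : #(nbr G v) ≤ #(extN G X) + #X := by
      refine (card_le_card fun u hu => ?_).trans (card_union_le _ _)
      by_cases huX : u ∈ X
      · exact mem_union_right _ huX
      · exact mem_union_left _ (mem_extN.mpr ⟨huX, v, hv, by simpa using hu⟩)
    have h3 : (#(nbr G v) : ℝ) ≤ #(extN G X) + #X := by exact_mod_cast h2
    have h4 : (1 : ℝ) ≤ Real.log (15 * #X) ^ 2 := one_le_pow₀ hlog
    nlinarith [(Nat.cast_nonneg #(extN G X) : (0 : ℝ) ≤ _)]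

lemma joinedIn_of_walk_coe {F : G.Subgraph} {a b : F.verts} (w : F.coe.Walk a b) :
    JoinedIn G F.verts.toFinset w.length (F.hom a) (F.hom b) := by
  refine ⟨w.map F.hom, (SimpleGraph.Walk.length_map _ _).le, fun x hx => ?_⟩
  rw [SimpleGraph.Walk.support_map, List.mem_map] at hx
  obtain ⟨z, -, rfl⟩ := hx
  simp

lemma IsExpansion.isRad {F : G.Subgraph} {v : V} {D μ : ℝ} {m : ℕ} (h : IsExpansion G F v D μ)
    (hm : μ < m + 1) : IsRad G m v F.verts.toFinset ∧ (#F.verts.toFinset : ℝ) = D := by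
  obtain ⟨hv, hD, hw⟩ := h
  refine ⟨⟨by simpa using hv, fun u hu => ?_⟩, by rw [← hD, Set.ncard_eq_toFinset_card']⟩
  obtain ⟨w, hwl⟩ := hw u (by simpa using hu)
  exact (joinedIn_of_walk_coe w).mono subset_rfl
    (Nat.lt_succ_iff.mp (by exact_mod_cast hwl.trans_lt hm))

end

section
open scoped Classical
open Finset

lemma growth_of_lt {n M R : ℕ} {x : ℝ} (hn : (n : ℝ) = Real.exp x)
    (hR : (4 * M + 1 : ℝ) * x < R) : n * (4 * M) ^ R < (4 * M + 1) ^ R := by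
  have hpos : (0 : ℝ) < 4 * M + 1 := by positivity
  have h1 : (4 * M : ℝ) = (4 * M + 1) * (1 - 1 / (4 * M + 1)) := by field_simp; ring
  have h2 : (1 - 1 / (4 * M + 1) : ℝ) ≤ Real.exp (-(1 / (4 * M + 1))) := by
    have := Real.add_one_le_exp (-(1 / (4 * M + 1) : ℝ))
    linarith
  have h3 : (0 : ℝ) ≤ 1 - 1 / (4 * M + 1) := by
    rw [sub_nonneg, div_le_one hpos]
    linarith [(Nat.cast_nonneg M : (0 : ℝ) ≤ _)]
  have h4 : Real.exp x * (1 - 1 / (4 * M + 1) : ℝ) ^ R < 1 := by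
    calc Real.exp x * (1 - 1 / (4 * M + 1) : ℝ) ^ R
        ≤ Real.exp x * Real.exp (-(1 / (4 * M + 1))) ^ R := by gcongr
      _ = Real.exp (x - R / (4 * M + 1)) := by
          rw [← Real.exp_nat_mul, ← Real.exp_add]
          congr 1
          ring
      _ < 1 := by
          rw [Real.exp_lt_one_iff, sub_neg, lt_div_iff₀ hpos]
          linarith
  have h5 : (n : ℝ) * (4 * M) ^ R < (4 * M + 1) ^ R := by
    rw [hn, h1, mul_pow]
    have h6 : (0 : ℝ) < (4 * M + 1) ^ R := by positivity
    rw [← h1]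
    nlinarith
  exact_mod_cast h5

lemma coarseBound_le {L ω : ℕ} (hL : 1 ≤ L) (hω : (ω + 1 : ℝ) ≤ Real.exp L) :
    (10 * coarseBound (8 * L ^ 3) ω : ℝ) ≤ Real.exp (400 * L ^ 7) := by
  set H := Real.exp ((L : ℝ) ^ 7) with hH
  have hL1 : (1 : ℝ) ≤ L := by exact_mod_cast hL
  have hle : ∀ {i : ℕ}, i ≤ 7 → (L : ℝ) ^ i ≤ (L : ℝ) ^ 7 := fun h => pow_le_pow_right₀ hL1 h
  have hpow : ∀ (i : ℕ) (y : ℝ), y ≤ i * (L : ℝ) ^ 7 → Real.exp y ≤ H ^ i := fun i y h => by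
    rw [hH, ← Real.exp_nat_mul]
    exact Real.exp_le_exp.mpr h
  have hH2 : 2 ≤ H := by
    have := Real.add_one_le_exp ((L : ℝ) ^ 7)
    have := one_le_pow₀ hL1 (n := 7)
    linarith
  have hH1 : 1 ≤ H := by linarith
  have hmono : ∀ {i j : ℕ}, i ≤ j → H ^ i ≤ H ^ j := fun h => pow_le_pow_right₀ hH1 h
  have hω0 : (0 : ℝ) ≤ ω := Nat.cast_nonneg _
  have h1 : (ω + 1 : ℝ) ≤ H := hω.trans (by
    simpa using hpow 1 L (by have := hle (i := 1) (by norm_num); simpa using this))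
  set s : ℝ := 8 * (L : ℝ) ^ 3 with hs
  have hs0 : 0 ≤ s := by positivity
  have h2 : 1 + 2 * s ≤ H ^ 16 := by
    have h3 := Real.add_one_le_exp (2 * s)
    have h4 := hpow 16 (2 * s) (by have := hle (i := 3) (by norm_num); push_cast; linarith)
    linarith
  have h5 : (ω + 1 : ℝ) ^ (2 * (8 * L ^ 3) ^ 2) ≤ H ^ 128 := by
    calc (ω + 1 : ℝ) ^ (2 * (8 * L ^ 3) ^ 2) ≤ Real.exp L ^ (2 * (8 * L ^ 3) ^ 2) := by gcongr
      _ = Real.exp (128 * (L : ℝ) ^ 7) := by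
          rw [← Real.exp_nat_mul]
          congr 1
          push_cast
          ring
      _ ≤ _ := hpow 128 _ (by norm_num)
  have h6 : (1 + 2 * s) ^ (8 * L ^ 3) ≤ H ^ 128 := by
    calc (1 + 2 * s) ^ (8 * L ^ 3) ≤ Real.exp (2 * s) ^ (8 * L ^ 3) := by
          gcongr
          linarith [Real.add_one_le_exp (2 * s)]
      _ = Real.exp (128 * (L : ℝ) ^ 6) := by
          rw [← Real.exp_nat_mul]
          congr 1
          push_cast
          ring
      _ ≤ _ := hpow 128 _ (by have := hle (i := 6) (by norm_num); push_cast; linarith)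
  have h7 : 2 * s ^ 2 * ((s + 1) * (ω + 1 : ℝ) ^ (2 * (8 * L ^ 3) ^ 2)) * s ≤ H ^ 192 := by
    calc 2 * s ^ 2 * ((s + 1) * (ω + 1 : ℝ) ^ (2 * (8 * L ^ 3) ^ 2)) * s
        = (2 * s ^ 2 * (s + 1) * s) * (ω + 1 : ℝ) ^ (2 * (8 * L ^ 3) ^ 2) := by ring
      _ ≤ (1 + 2 * s) ^ 4 * H ^ 128 := by
          gcongr
          have : 0 ≤ s ^ 3 := by positivity
          have : 0 ≤ s ^ 4 := by positivity
          nlinarith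
      _ ≤ (H ^ 16) ^ 4 * H ^ 128 := by gcongr
      _ = H ^ 192 := by ring
  have h8 : (ω + ω ^ 2 : ℝ) ≤ H ^ 2 := by
    calc (ω + ω ^ 2 : ℝ) ≤ (ω + 1) ^ 2 := by nlinarith
      _ ≤ H ^ 2 := by gcongr
  have h9 : (ω : ℝ) ^ 2 ≤ H ^ 192 := by
    calc (ω : ℝ) ^ 2 ≤ H ^ 2 := by gcongr; linarith
      _ ≤ _ := hmono (by norm_num)
  have hcast : (coarseBound (8 * L ^ 3) ω : ℝ) = (ω + ω ^ 2) + (ω + ω ^ 2) ^ 2 + (1 + 2 * s) *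
      ((ω ^ 2 + 2 * s ^ 2 * ((s + 1) * (ω + 1) ^ (2 * (8 * L ^ 3) ^ 2)) * s) *
        (1 + 2 * s) ^ (8 * L ^ 3)) := by
    unfold coarseBound
    push_cast
    rfl
  calc (10 * coarseBound (8 * L ^ 3) ω : ℝ)
      ≤ 10 * (H ^ 2 + (H ^ 2) ^ 2 + H ^ 16 * ((H ^ 192 + H ^ 192) * H ^ 128)) := by
        rw [hcast]
        gcongr
    _ ≤ 10 * (H ^ 336 + H ^ 336 + H ^ 16 * ((H ^ 192 + H ^ 192) * H ^ 128)) := by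
        rw [← pow_mul]
        gcongr <;> norm_num
    _ = 40 * H ^ 336 := by ring
    _ ≤ H ^ 6 * H ^ 336 := by
        gcongr
        calc (40 : ℝ) ≤ 2 ^ 6 := by norm_num
          _ ≤ H ^ 6 := by gcongr
    _ = H ^ 342 := by ring
    _ ≤ H ^ 400 := hmono (by norm_num)
    _ = _ := by rw [hH, ← Real.exp_nat_mul]; norm_num

end

section
open scoped Classical
open Finset

/-- The real number `x`, which is the logarithm of the number of vertices, is large compared to
`K`, and `L` is suitable as an expansion rate of small sets. -/
structure IsScale (x : ℝ) (K L : ℕ) : Prop where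
  le_x : 10 ^ 9 ≤ x
  le_log : 3 ≤ Real.log x
  le_K : 10 ≤ K
  le_L : (K + 7 : ℝ) ^ 2 * Real.log x ^ 2 ≤ L
  L_le : 400 * (L : ℝ) ^ 7 ≤ x
  pow_le : x ^ (K + 20) ≤ Real.exp x

namespace IsScale

variable {x : ℝ} {K L : ℕ}

lemma pos (h : IsScale x K L) : 0 < x := by linarith [h.le_x]

lemma pow_lt (h : IsScale x K L) {i j : ℕ} (hij : i < j) : 10 ^ 9 * x ^ i ≤ x ^ j := by
  have h1 : 1 ≤ x := by linarith [h.le_x]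
  have h0 := h.pos
  calc 10 ^ 9 * x ^ i ≤ x * x ^ i := by gcongr; exact h.le_x
    _ = x ^ (i + 1) := by ring
    _ ≤ x ^ j := pow_le_pow_right₀ h1 hij

lemma one_le_L (h : IsScale x K L) : (1 : ℝ) ≤ L := by
  refine le_trans ?_ h.le_L
  have h1 := h.le_log
  have h2 : (0 : ℝ) ≤ K := Nat.cast_nonneg _
  exact one_le_mul_of_one_le_of_one_le (one_le_pow₀ (by linarith)) (one_le_pow₀ (by linarith))

lemma L_pow_le (h : IsScale x K L) {i : ℕ} (hi : i ≤ 7) : 400 * (L : ℝ) ^ i ≤ x :=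
  (mul_le_mul_of_nonneg_left (pow_le_pow_right₀ h.one_le_L hi) (by norm_num)).trans h.L_le

lemma pow_le_exp_L (h : IsScale x K L) {i : ℕ} (hi : i ≤ K + 7) : x ^ i ≤ Real.exp L := by
  have h1 := h.le_log
  have h2 : (0 : ℝ) ≤ K := Nat.cast_nonneg _
  have h3 : (i : ℝ) ≤ K + 7 := by exact_mod_cast hi
  have h4 : i * Real.log x ≤ L := by
    refine le_trans ?_ h.le_L
    calc i * Real.log x ≤ (K + 7) * Real.log x := by gcongr
      _ ≤ ((K + 7) * Real.log x) ^ 2 := le_self_pow₀ (by nlinarith) (by norm_num)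
      _ = _ := by ring
  calc x ^ i = Real.exp (i * Real.log x) := by
        rw [Real.exp_nat_mul, Real.exp_log h.pos]
    _ ≤ _ := Real.exp_le_exp.mpr h4

end IsScale

/-- The sizes of the parameters in terms of the logarithm `x` of the number of vertices and the
size `D` of the expansions which are to be connected. -/
structure Params.Fits (P : Params) (x : ℝ) (K D : ℕ) : Prop where
  le_M : 4 * x ^ 2 ≤ P.M
  M_le : (P.M : ℝ) ≤ 5 * x ^ 2
  lt_R : (4 * P.M + 1) * x < P.R
  R_le : (P.R : ℝ) ≤ 17 * x ^ 3
  m_le : (P.m : ℝ) ≤ 800 * x ^ 3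
  lt_m : 800 * x ^ 3 < P.m + 1
  le_r : x ^ 2 ≤ P.r
  r_le : (P.r : ℝ) ≤ 2 * x ^ 2
  B_le : (P.B : ℝ) ≤ x ^ (K + 6)
  lt_B : x ^ (K + 6) < P.B + 1
  le_w : 2 * (D / x) ≤ P.w
  w_le : (P.w : ℝ) ≤ 3 * (D / x)

lemma IsScale.exists_fits {x : ℝ} {K L D : ℕ} (hx : IsScale x K L) (hD : x ^ 10 ≤ D) (h : ℕ) :
    ∃ P : Params, P.L = L ∧ P.h = h ∧ P.Fits x K D := by
  have h0 := hx.pos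
  have hM := Nat.le_ceil (4 * x ^ 2)
  have hM' := (Nat.ceil_lt_add_one (a := 4 * x ^ 2) (by positivity)).le
  have p0 := hx.pow_lt (i := 0) (j := 1) (by norm_num)
  have p1 := hx.pow_lt (i := 1) (j := 2) (by norm_num)
  have p2 := hx.pow_lt (i := 2) (j := 3) (by norm_num)
  rw [pow_one] at p0 p1
  have hDx : x ^ 9 ≤ D / x := by
    rw [le_div_iff₀ h0]
    calc x ^ 9 * x = x ^ 10 := by ring
      _ ≤ (D : ℝ) := hD
  have p9 := hx.pow_lt (i := 0) (j := 9) (by norm_num)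
  refine ⟨⟨⌈4 * x ^ 2⌉₊, L, ⌊x ^ (K + 6)⌋₊, h, ⌊(4 * ⌈4 * x ^ 2⌉₊ + 1) * x⌋₊ + 1, ⌊800 * x ^ 3⌋₊,
    ⌈x ^ 2⌉₊, ⌈2 * (D / x)⌉₊⟩, rfl, rfl, hM, ?_, ?_, ?_, ?_, ?_, ?_, ?_, ?_, ?_, ?_, ?_⟩
  · dsimp only
    linarith
  · push_cast
    exact Nat.lt_floor_add_one _
  · have h1 := Nat.floor_le (a := (4 * (⌈4 * x ^ 2⌉₊ : ℝ) + 1) * x) (by positivity)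
    push_cast
    have h2 : (4 * (⌈4 * x ^ 2⌉₊ : ℝ) + 1) * x ≤ (4 * (4 * x ^ 2 + 1) + 1) * x := by gcongr
    nlinarith
  · exact Nat.floor_le (by positivity)
  · exact Nat.lt_floor_add_one _
  · exact Nat.le_ceil _
  · have h1 := Nat.ceil_lt_add_one (a := x ^ 2) (by positivity)
    dsimp only
    linarith
  · exact Nat.floor_le (by positivity)
  · exact Nat.lt_floor_add_one _
  · exact Nat.le_ceil _
  · have h1 := Nat.ceil_lt_add_one (a := 2 * ((D : ℝ) / x)) (by positivity)
    dsimp only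
    linarith

/-- Expanders of the appropriate size satisfy the requirements on graph and parameters. -/
lemma IsScale.setting {V : Type*} [Fintype V] {G : SimpleGraph V} {P : Params} {x : ℝ} {K D : ℕ}
    (hx : IsScale x K P.L) (hP : P.Fits x K D) (hD : (D : ℝ) ≤ x ^ K)
    (hV : (Fintype.card V : ℝ) = Real.exp x) (bip : IsBip G) (noSub : ¬ ContainsBalSub G P.h 2)
    (deg : ∀ v, 2 * P.h ≤ #(nbr G v) + 2) (h_le : 20000 ≤ P.h)
    (htiny : ∀ s : ℕ, P.h ≤ 2 * s → 8 * Real.log (30 * s ^ 3) ^ 6 < s)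
    (hexp : ∀ X : Finset V, X.Nonempty → 2 * #X ≤ Fintype.card V →
      (#X : ℝ) ≤ Real.log (15 * #X) ^ 2 * #(extN G X)) : Setting G P := by
  have h0 := hx.pos
  have hL1 := hx.one_le_L
  have hL2 := hx.L_pow_le (i := 1) (by norm_num)
  have hL3 := hx.L_pow_le (i := 3) (by norm_num)
  rw [pow_one] at hL2
  have p0 := hx.pow_lt (i := 0) (j := 1) (by norm_num)
  have p1 := hx.pow_lt (i := 1) (j := 2) (by norm_num)
  have p2 := hx.pow_lt (i := 2) (j := 3) (by norm_num)
  have p5 := hx.pow_lt (i := 5) (j := 6) (by norm_num)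
  have pK0 := hx.pow_lt (i := K) (j := K + 6) (by omega)
  have pK1 := hx.pow_lt (i := K + 2) (j := K + 6) (by omega)
  have pK2 := hx.pow_lt (i := 0) (j := K) (by have := hx.le_K; omega)
  have pK3 := hx.pow_lt (i := K + 6) (j := K + 7) (by omega)
  have pK4 := hx.pow_lt (i := K + 7) (j := K + 20) (by omega)
  have pK5 := hx.pow_lt (i := 0) (j := K + 6) (by omega)
  have pK6 := hx.pow_lt (i := 6) (j := K + 6) (by have := hx.le_K; omega)
  have pK7 := hx.pow_lt (i := K) (j := K + 1) (by omega)
  have pK8 := hx.pow_lt (i := 1) (j := K + 6) (by omega)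
  have hn := hx.pow_le
  rw [pow_zero] at *
  rw [pow_one] at *
  have hDx : (D / x : ℝ) * x = D := div_mul_cancel₀ _ h0.ne'
  have hu0 : (0 : ℝ) ≤ D / x := by positivity
  have hM0 : (0 : ℝ) ≤ P.M := Nat.cast_nonneg _
  have hw0 : (0 : ℝ) ≤ P.w := Nat.cast_nonneg _
  have hBn : ∀ X : Finset V, #X ≤ P.B → 2 * #X ≤ Fintype.card V := fun X hX => by
    have h1 : (#X : ℝ) ≤ P.B := by exact_mod_cast hX
    have h2 : (2 * #X : ℝ) ≤ Fintype.card V := by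
      rw [hV]
      linarith [hP.B_le]
    exact_mod_cast h2
  have hlog : ∀ (X : Finset V) (y : ℝ), X.Nonempty → 2 * #X ≤ Fintype.card V →
      15 * (#X : ℝ) ≤ Real.exp y → (#X : ℝ) ≤ y ^ 2 * #(extN G X) := by
    intro X y hX hXV hy
    refine (hexp X hX hXV).trans ?_
    have h1 : (1 : ℝ) ≤ #X := by exact_mod_cast hX.card_pos
    have h2 := one_le_log_fifteen_mul h1
    have h3 : Real.log (15 * #X) ≤ y := (Real.log_le_iff_le_exp (by positivity)).mpr hy
    gcongr
  have hω : ((1 + 2 * P.L) * P.w : ℝ) ≤ 9 * P.L * (D / x) := by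
    calc ((1 + 2 * P.L) * P.w : ℝ) ≤ (P.L + 2 * P.L) * (3 * (D / x)) := by
          gcongr
          exact hP.w_le
      _ = _ := by ring
  have hLD : (400 * P.L * (D / x) : ℝ) ≤ x ^ K := by
    calc (400 * P.L * (D / x) : ℝ) ≤ x * (D / x) := by gcongr
      _ = D := by rw [mul_comm, hDx]
      _ ≤ x ^ K := hD
  refine ⟨bip, noSub, deg, ?_, ?_, ?_, ?_, ?_, h_le, growth_of_lt hV hP.lt_R, ?_, ?_, ?_, ?_, ?_⟩
  · intro X hX hXV
    have h1 : (2 * #X : ℝ) ≤ Fintype.card V := by exact_mod_cast hXV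
    have h2 := hlog X (2 * x) hX hXV (by
      have h3 : Real.exp (2 * x) = Real.exp x * Real.exp x := by rw [← Real.exp_add]; ring_nf
      rw [h3]
      rw [hV] at h1
      have : 8 ≤ Real.exp x := by linarith
      nlinarith)
    have h3 : (#X : ℝ) ≤ P.M * #(extN G X) := h2.trans (by
      have := hP.le_M
      gcongr
      linarith)
    exact_mod_cast h3
  · intro X hX hXB
    have h1 : (#X : ℝ) ≤ P.B := by exact_mod_cast hXB
    have h2 := hlog X ((K + 7) * Real.log x) hX (hBn X hXB) (by
      have h3 : Real.exp ((K + 7) * Real.log x) = x ^ (K + 7) := by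
        have h4 := Real.exp_nat_mul (Real.log x) (K + 7)
        rw [Real.exp_log h0] at h4
        rw [← h4]
        push_cast
        rfl
      rw [h3]
      linarith [hP.B_le])
    have h3 : (#X : ℝ) ≤ P.L * #(extN G X) := h2.trans (by
      have := hx.le_L
      rw [mul_pow]
      gcongr)
    exact_mod_cast h3
  · intro s X hs hsL hX hXs
    have hsL' : (s : ℝ) ≤ 8 * (P.L : ℝ) ^ 3 := by exact_mod_cast hsL
    have hsx : (s : ℝ) ≤ x := by linarith
    have hs0 : (0 : ℝ) < s := by
      have : 0 < s := by omega
      exact_mod_cast this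
    have hXs' : (#X : ℝ) ≤ 2 * (s : ℝ) ^ 3 := by exact_mod_cast hXs
    have hXB : #X ≤ P.B := by
      have h1 : (#X : ℝ) < P.B + 1 := by
        have h2 : (s : ℝ) ^ 3 ≤ x ^ 3 := by gcongr
        have h3 : 10 ^ 9 * x ^ 3 ≤ x ^ (K + 6) := hx.pow_lt (by omega)
        have h4 : (0 : ℝ) < x ^ 3 := by positivity
        linarith [hP.lt_B]
      exact Nat.lt_succ_iff.mp (by exact_mod_cast h1)
    have hX1 : (1 : ℝ) ≤ #X := by exact_mod_cast hX.card_pos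
    have h2 := one_le_log_fifteen_mul hX1
    have h3 := hexp X hX (hBn X hXB)
    have h4 : Real.log (15 * #X) ≤ Real.log (30 * s ^ 3) :=
      Real.log_le_log (by positivity) (by linarith)
    have h5 : (#X : ℝ) ^ 3 ≤ Real.log (30 * s ^ 3) ^ 6 * #(extN G X) ^ 3 := by
      calc (#X : ℝ) ^ 3 ≤ (Real.log (30 * s ^ 3) ^ 2 * #(extN G X)) ^ 3 := by
            gcongr
            exact h3.trans (by gcongr)
        _ = _ := by ring
    have h6 : (0 : ℝ) < #(extN G X) := by
      rcases (Nat.cast_nonneg #(extN G X) : (0 : ℝ) ≤ _).eq_or_lt with h | h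
      · rw [← h] at h3
        linarith
      · exact h
    have h7 : (8 * #X ^ 3 : ℝ) < s * #(extN G X) ^ 3 := by
      have h8 : (0 : ℝ) < #(extN G X) ^ 3 := by positivity
      nlinarith [htiny s hs]
    exact_mod_cast h7
  · exact_mod_cast (by linarith : (0 : ℝ) < P.L)
  · have : (P.L : ℝ) ≤ P.M := by linarith [hP.le_M]
    exact_mod_cast this
  · have h1 : (4 * P.M * ((1 + 2 * P.L) * P.w) : ℝ) < P.B + 1 := by
      calc (4 * P.M * ((1 + 2 * P.L) * P.w) : ℝ)
          ≤ 4 * (5 * x ^ 2) * (9 * P.L * (D / x)) := by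
            gcongr
            exact hP.M_le
        _ = 20 * 9 / 400 * x ^ 2 * (400 * P.L * (D / x)) := by ring
        _ ≤ 20 * 9 / 400 * x ^ 2 * x ^ K := by gcongr
        _ = 20 * 9 / 400 * x ^ (K + 2) := by ring
        _ < _ := by
            have : 0 < x ^ (K + 2) := by positivity
            linarith [hP.lt_B]
    exact Nat.lt_succ_iff.mp (by exact_mod_cast h1)
  · have h1 : (8 * P.M ^ 3 + 2 * P.L * P.w : ℝ) < P.B + 1 := by
      calc (8 * P.M ^ 3 + 2 * P.L * P.w : ℝ)
          ≤ 8 * (5 * x ^ 2) ^ 3 + 2 * P.L * (3 * (D / x)) := by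
            gcongr
            exacts [hP.M_le, hP.w_le]
        _ = 1000 * x ^ 6 + 6 * P.L * (D / x) := by ring
        _ < _ := by
            have h2 : 0 < x ^ 6 := by positivity
            have h3 : (0 : ℝ) ≤ P.L * (D / x) := by positivity
            linarith [hP.lt_B]
    exact Nat.lt_succ_iff.mp (by exact_mod_cast h1)
  · have h1 := coarseBound_le (L := P.L) (ω := (1 + 2 * P.L) * P.w) (by exact_mod_cast hL1) (by
      refine le_trans ?_ (hx.pow_le_exp_L (i := K + 1) (by omega))
      push_cast
      have h3 : (0 : ℝ) ≤ P.L * (D / x) := by positivity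
      linarith)
    have h2 : (10 * coarseBound (8 * P.L ^ 3) ((1 + 2 * P.L) * P.w) : ℝ) ≤ Fintype.card V := by
      rw [hV]
      exact h1.trans (Real.exp_le_exp.mpr hx.L_le)
    exact_mod_cast h2
  · have h1 : (P.r + P.R : ℝ) < P.m + 1 := by
      have h2 : 0 < x ^ 2 := by positivity
      linarith [hP.r_le, hP.R_le, hP.lt_m]
    exact Nat.lt_succ_iff.mp (by exact_mod_cast h1)
  · have h1 : (256 * P.M * (2 * (P.m + P.R) + 5) : ℝ) ≤ P.r ^ 3 := by
      calc (256 * P.M * (2 * (P.m + P.R) + 5) : ℝ)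
          ≤ 256 * (5 * x ^ 2) * (2 * (800 * x ^ 3 + 17 * x ^ 3) + x ^ 3) := by
            gcongr
            exacts [hP.M_le, hP.m_le, hP.R_le, by linarith]
        _ = 256 * 5 * 1635 * x ^ 5 := by ring
        _ ≤ x ^ 6 := by
            have : 0 < x ^ 5 := by positivity
            linarith
        _ = (x ^ 2) ^ 3 := by ring
        _ ≤ P.r ^ 3 := by
            gcongr
            exact hP.le_r
    exact_mod_cast h1

end

section
open scoped Classical
open Finset

set_option maxHeartbeats 3000000 in
/-- In a setting of the appropriate size, expansions are joined by paths of prescribed length. -/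
lemma Setting.exists_path_of_fits {V : Type*} [Fintype V] {G : SimpleGraph V} {P : Params}
    {x : ℝ} {K D ℓ : ℕ} (hS : Setting G P) (hx : IsScale x K P.L) (hP : P.Fits x K D)
    (hD₁ : x ^ 10 ≤ D) (hD₂ : (D : ℝ) ≤ x ^ K) (hV : (Fintype.card V : ℝ) = Real.exp x)
    {U F₁ F₂ : Finset V} {v₁ v₂ : V} (hU : (#U : ℝ) ≤ D / (2 * x ^ 3))
    (hF₁ : IsRad G P.m v₁ F₁) (hF₂ : IsRad G P.m v₂ F₂) (hc₁ : #F₁ = D) (hc₂ : #F₂ = D)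
    (hU₁ : Disjoint F₁ U) (hU₂ : Disjoint F₂ U) (hFF : Disjoint F₁ F₂)
    (hℓ₁ : x ^ 7 ≤ ℓ) (hℓ₂ : (ℓ : ℝ) ≤ Fintype.card V / x ^ 10)
    (hpar : ∀ w : G.Walk v₁ v₂, w.length % 2 = ℓ % 2) :
    ∃ w : G.Walk v₁ v₂, w.IsPath ∧ w.length = ℓ ∧ ∀ x ∈ w.support, x ∉ U := by
  have h0 := hx.pos
  have hL1 := hx.one_le_L
  have hL2 := hx.L_pow_le (i := 1) (by norm_num)
  have hL3 := hx.L_pow_le (i := 2) (by norm_num)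
  have p0 := hx.pow_lt (i := 0) (j := 3) (by norm_num)
  have p3 := hx.pow_lt (i := 3) (j := 6) (by norm_num)
  have p6 := hx.pow_lt (i := 6) (j := 7) (by norm_num)
  have p9 := hx.pow_lt (i := 0) (j := 9) (by norm_num)
  have pK1 := hx.pow_lt (i := K + 1) (j := K + 6) (by omega)
  have pK2 := hx.pow_lt (i := K) (j := K + 20) (by omega)
  have pK3 := hx.pow_lt (i := K) (j := K + 10) (by omega)
  have pK4 := hx.pow_lt (i := 0) (j := K + 10) (by omega)
  have hn := hx.pow_le
  rw [pow_zero] at p0 p9 pK4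
  rw [pow_one] at hL2
  obtain ⟨u, hu⟩ : ∃ u : ℝ, u = D / x := ⟨_, rfl⟩
  have hDu : u * x = D := by rw [hu, div_mul_cancel₀ _ h0.ne']
  have hw1 := hP.le_w
  have hw2 := hP.w_le
  rw [← hu] at hw1 hw2
  have hu9 : x ^ 9 ≤ u := by
    rw [hu, le_div_iff₀ h0]
    calc x ^ 9 * x = x ^ 10 := by ring
      _ ≤ (D : ℝ) := hD₁
  have hu0 : 0 < u := lt_of_lt_of_le (by positivity) hu9
  have hLu : 400 * (P.L : ℝ) * u ≤ D := by
    rw [← hDu, mul_comm u]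
    gcongr
  have hLLu : 400 * (P.L : ℝ) ^ 2 * u ≤ D := by
    rw [← hDu, mul_comm u]
    gcongr
  have hU' : (#U : ℝ) * (2 * x ^ 2) ≤ u := by
    rw [le_div_iff₀ (by positivity)] at hU
    have : (#U : ℝ) * (2 * x ^ 2) * x ≤ u * x := by
      rw [hDu]
      linarith
    exact le_of_mul_le_mul_right this h0
  have hU'' : (#U : ℝ) * (800 * P.L) ≤ u := by
    have h1 : x ≤ x ^ 2 := le_self_pow₀ (by linarith [hx.le_x]) two_ne_zero
    have h2 : 800 * (P.L : ℝ) ≤ 2 * x ^ 2 := by linarith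
    exact (mul_le_mul_of_nonneg_left h2 (Nat.cast_nonneg _)).trans hU'
  have hUu : (#U : ℝ) ≤ u / 10 := by
    have h1 : (#U : ℝ) * 10 ≤ #U * (800 * P.L) := by
      gcongr
      linarith
    linarith
  have hLx6 : 2 * 10 ^ 6 * P.L * x ^ 6 ≤ u / 10 := by
    have h1 : 400 * P.L * x ^ 6 ≤ x * x ^ 6 := by gcongr
    have h2 := hx.pow_lt (i := 7) (j := 9) (by norm_num)
    have h3 : x * x ^ 6 = x ^ 7 := by ring
    have h4 : 0 < x ^ 7 := by positivity
    linarith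
  have hx6 : 2 * 10 ^ 6 * x ^ 6 ≤ u / 10 := by
    refine le_trans ?_ hLx6
    have : 0 < x ^ 6 := by positivity
    nlinarith
  obtain ⟨g, hg⟩ : ∃ g : ℝ, g = Real.exp x / x ^ 11 := ⟨_, rfl⟩
  have hgn : g * x ^ 11 = Real.exp x := by rw [hg, div_mul_cancel₀ _ (by positivity)]
  have hgx : x ^ (K + 10) ≤ g * x := by
    have : x ^ (K + 10) * x ^ 10 ≤ g * x * x ^ 10 := by
      calc x ^ (K + 10) * x ^ 10 = x ^ (K + 20) := by ring
        _ ≤ Real.exp x := hn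
        _ = g * x * x ^ 10 := by rw [← hgn]; ring
    exact le_of_mul_le_mul_right this (by positivity)
  have hg1 : 1 ≤ g := by
    have h1 : x ^ 1 ≤ x ^ (K + 10) := pow_le_pow_right₀ (by linarith [hx.le_x]) (by omega)
    rw [pow_one] at h1
    exact le_of_mul_le_mul_right (by linarith only [h1, hgx]) h0
  have hg0 : 0 < g := by linarith
  have gp : ∀ i j : ℕ, i < j → 10 ^ 9 * (g * x ^ i) ≤ g * x ^ j := fun i j hij => by
    have := mul_le_mul_of_nonneg_left (hx.pow_lt hij) hg0.le
    linarith only [this]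
  have hℓ3 : (ℓ : ℝ) ≤ g * x := by
    rw [hV, ← hgn] at hℓ₂
    refine hℓ₂.trans_eq ?_
    field_simp
  have hwD : (P.w : ℝ) + 1 ≤ g * x := by
    have h1 : u ≤ D := by
      rw [← hDu]
      nlinarith [hx.le_x]
    have h2 : 0 < x ^ K := by positivity
    linarith
  obtain ⟨R, hR⟩ : ∃ R : ℝ, R = P.R := ⟨_, rfl⟩
  have hx3 : 0 < x ^ 3 := by positivity
  have hq1 : (P.m + 2 * P.R + 1 : ℝ) ≤ 835 * x ^ 3 := by linarith [hP.m_le, hP.R_le]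
  have hq2 : 800 * x ^ 3 ≤ (P.m + 2 * P.R + 1 : ℝ) := by
    linarith [hP.lt_m, (Nat.cast_nonneg P.R : (0 : ℝ) ≤ _)]
  have hR1 : (P.R + 1 : ℝ) ≤ 18 * x ^ 3 := by linarith [hP.R_le]
  have ht : (P.m + 5 * P.R : ℝ) ≤ 885 * x ^ 3 := by linarith [hP.m_le, hP.R_le]
  have hmR : (P.m + P.R : ℝ) ≤ 817 * x ^ 3 := by linarith [hP.m_le, hP.R_le]
  have htt : ((P.m + 5 * P.R) * (2 * (P.m + P.R) + 5) : ℝ) ≤ 15 * 10 ^ 5 * x ^ 6 := by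
    calc ((P.m + 5 * P.R) * (2 * (P.m + P.R) + 5) : ℝ)
        ≤ (885 * x ^ 3) * (2 * (817 * x ^ 3) + x ^ 3) := by
          gcongr
          linarith
      _ = 885 * 1635 * x ^ 6 := by ring
      _ ≤ _ := by
        have : 0 < x ^ 6 := by positivity
        linarith
  set q := P.m + 2 * P.R + 1 with hq
  have hqc : (q : ℝ) = P.m + 2 * P.R + 1 := by rw [hq]; push_cast; ring
  rw [← hqc] at hq1 hq2
  set κ := ⌈g⌉₊ with hκ
  have hκ1 : g ≤ κ := Nat.le_ceil g
  have hκ2 : (κ : ℝ) ≤ 2 * g := by linarith [Nat.ceil_lt_add_one hg0.le]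
  have hN1 : (2 * κ * q : ℝ) ≤ 3340 * (g * x ^ 3) := by
    calc (2 * κ * q : ℝ) ≤ 2 * (2 * g) * (835 * x ^ 3) := by gcongr
      _ = _ := by ring
  have hN2 : 1600 * (g * x ^ 3) ≤ (2 * κ * q : ℝ) := by
    calc 1600 * (g * x ^ 3) = 2 * g * (800 * x ^ 3) := by ring
      _ ≤ _ := by gcongr
  have hNR : (2 * κ * q * (P.R + 1) : ℝ) ≤ 60120 * (g * x ^ 6) := by
    calc (2 * κ * q * (P.R + 1) : ℝ) ≤ 3340 * (g * x ^ 3) * (18 * x ^ 3) := by gcongr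
      _ = _ := by ring
  have hc : (2 * q * (P.R + 1) : ℝ) ≤ 10 ^ 5 * x ^ 6 := by
    calc (2 * q * (P.R + 1) : ℝ) ≤ 2 * (835 * x ^ 3) * (18 * x ^ 3) := by gcongr
      _ = 30060 * x ^ 6 := by ring
      _ ≤ _ := by gcongr; norm_num
  set σ := ⌈10 ^ 6 * (g * x ^ 8)⌉₊ with hσ
  have hσ1 : 10 ^ 6 * (g * x ^ 8) ≤ σ := Nat.le_ceil _
  have hgx8 : 1 ≤ g * x ^ 8 :=
    one_le_mul_of_one_le_of_one_le hg1 (one_le_pow₀ (by linarith [hx.le_x]))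
  have hσ2 : (σ : ℝ) ≤ 2 * 10 ^ 6 * (g * x ^ 8) := by
    linarith [Nat.ceil_lt_add_one (a := 10 ^ 6 * (g * x ^ 8)) (by positivity)]
  set f := ⌈u⌉₊ with hf
  have hf1 : u ≤ f := Nat.le_ceil u
  have hf2 : (f : ℝ) ≤ u + 1 := (Nat.ceil_lt_add_one hu0.le).le
  have hfu : 10 ^ 9 ≤ u := by linarith
  have hLLw : (2 * P.L * ((1 + 2 * P.L) * P.w) : ℝ) ≤ D := by
    calc (2 * P.L * ((1 + 2 * P.L) * P.w) : ℝ) ≤ 2 * P.L * ((P.L + 2 * P.L) * (3 * u)) := by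
          gcongr
      _ = 18 * P.L ^ 2 * u := by ring
      _ ≤ 400 * P.L ^ 2 * u := by gcongr; norm_num
      _ ≤ D := hLLu
  have g1 := gp 1 3 (by norm_num)
  have g2 := gp 3 11 (by norm_num)
  have g3 := gp 1 6 (by norm_num)
  have g4 := gp 8 11 (by norm_num)
  have g5 := gp 6 8 (by norm_num)
  have g6 := gp 10 11 (by norm_num)
  rw [pow_one] at g1 g3
  have gg3 : 0 < g * x ^ 3 := by positivity
  have gg6 : 0 < g * x ^ 6 := by positivity
  have gg10 : 0 < g * x ^ 10 := by positivity
  have hM2 := hP.M_le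
  refine hS.exists_path_length_eq (f := f) (N := 2 * κ * q) (κ := κ) (c := 2 * q * (P.R + 1))
    (σ := σ) hF₁ hF₂ hU₁ hU₂ hFF ?_ ?_ ?_ ?_ ?_ ?_ ?_ ?_ ?_ ?_ le_rfl ?_ ?_ ?_ ?_ ?_ hpar
  · exact Nat.one_le_iff_ne_zero.mpr (Nat.ceil_pos.mpr hu0).ne'
  · rw [hc₂]
    refine Nat.ceil_le.mpr ?_
    rw [← hDu]
    nlinarith [hx.le_x]
  · rw [hc₁]
    exact_mod_cast hLLw
  · have : (#U + f + (P.m + 5 * P.R) * (2 * (P.m + P.R) + 5) : ℝ) ≤ P.w := by linarith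
    exact_mod_cast this
  · have : (4 * P.L * ((1 + 2 * P.L) * P.w) : ℝ) ≤ Fintype.card V := by
      rw [hV]
      have : 0 < x ^ K := by positivity
      linarith
    exact_mod_cast this
  · have : (2 * P.L * (#U + (P.m + 5 * P.R) * (2 * (P.m + P.R) + 5) + 2 * q * (P.R + 1)) : ℝ) ≤
        f := by
      calc (2 * P.L * (#U + (P.m + 5 * P.R) * (2 * (P.m + P.R) + 5) + 2 * q * (P.R + 1)) : ℝ)
          ≤ 2 * P.L * (#U + 15 * 10 ^ 5 * x ^ 6 + 10 ^ 5 * x ^ 6) := by gcongr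
        _ = #U * (800 * P.L) / 400 + 16 / 10 * (2 * 10 ^ 6 * P.L * x ^ 6) := by ring
        _ ≤ f := by linarith
    exact_mod_cast this
  · have : (2 * P.M * (P.w + 2 * q * (P.R + 1)) : ℝ) < P.B + 1 := by
      calc (2 * P.M * (P.w + 2 * q * (P.R + 1)) : ℝ) ≤ 2 * (5 * x ^ 2) * (3 * u + u) := by
            gcongr
            linarith
        _ = 40 * x * (u * x) := by ring
        _ ≤ 40 * x * x ^ K := by rw [hDu]; gcongr
        _ = 40 * x ^ (K + 1) := by ring
        _ < P.B + 1 := by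
          have : 0 < x ^ (K + 1) := by positivity
          linarith [hP.lt_B]
    exact Nat.lt_succ_iff.mp (by exact_mod_cast this)
  · have : (2 * (2 * κ * q) : ℝ) ≤ Fintype.card V := by
      rw [hV]
      linarith
    exact_mod_cast this
  · exact Nat.one_le_iff_ne_zero.mpr (Nat.ceil_pos.mpr hg0).ne'
  · exact le_of_eq (by ring)
  · have : (4 * σ : ℝ) ≤ Fintype.card V := by
      rw [hV]
      linarith
    exact_mod_cast this
  · have : (2 * P.M * (P.w + 2 * κ * q * (P.R + 1) + (ℓ + 1)) : ℝ) ≤ σ := by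
      calc (2 * P.M * (P.w + 2 * κ * q * (P.R + 1) + (ℓ + 1)) : ℝ)
          ≤ 2 * (5 * x ^ 2) * (60121 * (g * x ^ 6)) := by
            gcongr
            linarith
        _ = 601210 * (g * x ^ 8) := by ring
        _ ≤ σ := by linarith
    exact_mod_cast this
  · have : (8 * P.M * (P.w + 2 * κ * q * (P.R + 1) + (ℓ + 1) + σ) : ℝ) ≤ Fintype.card V := by
      calc (8 * P.M * (P.w + 2 * κ * q * (P.R + 1) + (ℓ + 1) + σ) : ℝ)
          ≤ 8 * (5 * x ^ 2) * (3 * 10 ^ 6 * (g * x ^ 8)) := by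
            gcongr
            linarith
        _ = 12 * 10 ^ 7 * (g * x ^ 10) := by ring
        _ ≤ Fintype.card V := by
            rw [hV]
            linarith
    exact_mod_cast this
  · have : (4 * P.M * (P.w + (ℓ + 1)) : ℝ) ≤ 2 * κ * q := by
      calc (4 * P.M * (P.w + (ℓ + 1)) : ℝ) ≤ 4 * (5 * x ^ 2) * (2 * (g * x)) := by
            gcongr
            linarith
        _ = 40 * (g * x ^ 3) := by ring
        _ ≤ _ := by linarith
    exact_mod_cast this
  · have : ((P.m + 5 * P.R) * (P.m + P.R) + 2 * (P.m + 5 * P.R) : ℝ) ≤ ℓ := by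
      calc ((P.m + 5 * P.R) * (P.m + P.R) + 2 * (P.m + 5 * P.R) : ℝ)
          ≤ (885 * x ^ 3) * (817 * x ^ 3) + 2 * (885 * x ^ 3) := by gcongr
        _ = 885 * 817 * x ^ 6 + 1770 * x ^ 3 := by ring
        _ ≤ ℓ := by
          have : 0 < x ^ 6 := by positivity
          linarith
    exact_mod_cast this

open Filter in
lemma eventually_log_pow_lt (c : ℝ) (i : ℕ) : ∀ᶠ x : ℝ in atTop, c * Real.log x ^ i < x := by
  have h1 := (Real.isLittleO_pow_log_id_atTop (n := i)).bound
    (c := 1 / (2 * (|c| + 1))) (by positivity)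
  filter_upwards [h1, eventually_ge_atTop 1] with x hx hx1
  have h2 : 0 ≤ Real.log x ^ i := pow_nonneg (Real.log_nonneg hx1) _
  rw [Real.norm_of_nonneg h2, id, Real.norm_of_nonneg (by linarith), div_mul_eq_mul_div,
    le_div_iff₀ (by positivity)] at hx
  have h3 := le_abs_self c
  nlinarith

open Filter in
lemma eventually_isScale {K : ℕ} (hK : 10 ≤ K) : ∀ᶠ x : ℝ in atTop, ∃ L, IsScale x K L := by
  have h1 := (isLittleO_pow_exp_atTop (n := K + 20)).bound (c := 1) one_pos
  filter_upwards [h1, eventually_ge_atTop (10 ^ 9), Real.tendsto_log_atTop.eventually_ge_atTop 3,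
    eventually_log_pow_lt (400 * (2 * (K + 7 : ℝ) ^ 2) ^ 7) 14] with x hx1 hx2 hx3 hx4
  have hc : (1 : ℝ) ≤ (K + 7) ^ 2 * Real.log x ^ 2 := by
    refine one_le_mul_of_one_le_of_one_le (one_le_pow₀ ?_) (one_le_pow₀ (by linarith))
    linarith [(Nat.cast_nonneg K : (0 : ℝ) ≤ _)]
  refine ⟨⌈(K + 7 : ℝ) ^ 2 * Real.log x ^ 2⌉₊, hx2, hx3, hK, Nat.le_ceil _, ?_, ?_⟩
  · have h2 := (Nat.ceil_lt_add_one (a := (K + 7 : ℝ) ^ 2 * Real.log x ^ 2) (by positivity)).le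
    calc 400 * (⌈(K + 7 : ℝ) ^ 2 * Real.log x ^ 2⌉₊ : ℝ) ^ 7
        ≤ 400 * (2 * ((K + 7 : ℝ) ^ 2 * Real.log x ^ 2)) ^ 7 := by
          gcongr
          linarith
      _ = 400 * (2 * (K + 7 : ℝ) ^ 2) ^ 7 * Real.log x ^ 14 := by ring
      _ ≤ x := hx4.le
  · rwa [one_mul, Real.norm_of_nonneg (by positivity), Real.norm_of_nonneg (by positivity)] at hx1

open Filter in
lemma eventually_tiny : ∀ᶠ s : ℕ in atTop, 8 * Real.log (30 * (s : ℝ) ^ 3) ^ 6 < s := by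
  filter_upwards [tendsto_natCast_atTop_atTop.eventually (eventually_log_pow_lt (8 * 4 ^ 6) 6),
    eventually_ge_atTop 30] with s hs hs30
  have h30 : (30 : ℝ) ≤ s := by exact_mod_cast hs30
  have h1 : Real.log (30 * (s : ℝ) ^ 3) ≤ 4 * Real.log s := by
    calc Real.log (30 * (s : ℝ) ^ 3) ≤ Real.log ((s : ℝ) ^ 4) := by
          refine Real.log_le_log (by positivity) ?_
          calc 30 * (s : ℝ) ^ 3 ≤ s * (s : ℝ) ^ 3 := by gcongr
            _ = _ := by ring
      _ = _ := by rw [Real.log_pow]; norm_num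
  have h2 : 0 ≤ Real.log (30 * (s : ℝ) ^ 3) := by
    refine Real.log_nonneg ?_
    have : (1 : ℝ) ≤ (s : ℝ) ^ 3 := one_le_pow₀ (by linarith)
    linarith
  calc 8 * Real.log (30 * (s : ℝ) ^ 3) ^ 6 ≤ 8 * (4 * Real.log s) ^ 6 := by gcongr
    _ = 8 * 4 ^ 6 * Real.log s ^ 6 := by ring
    _ < s := hs

end

/-- connecting two expansions by a path of any plausible length in a
sparse expander (Lemma 2.12). -/
theorem statement16 :
    ∃ ε₁ : ℝ, 0 < ε₁ ∧
      ∀ ε₂ : ℝ, 0 < ε₂ → ε₂ < 1 / 5 → ∀ k : ℝ, 10 ≤ k →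
        ∃ d₀ : ℝ, ∀ (n : ℕ) (d : ℝ), d₀ ≤ d → d ≤ n →
          ∀ (V : Type) [Fintype V] (G : SimpleGraph V), Nat.card V = n →
            ¬ ContainsBalSub G ⌈d / 2⌉₊ 2 →
            IsBip G → IsExpander G ε₁ (ε₂ * d) → MinDegGE G d →
              ∀ D : ℕ, Real.log n ^ 10 ≤ (D : ℝ) → (D : ℝ) ≤ Real.log n ^ k →
                ∀ U : Set V, (U.ncard : ℝ) ≤ (D : ℝ) / (2 * Real.log n ^ 3) →
                  ∀ (v₁ v₂ : V) (F₁ F₂ : G.Subgraph),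
                    Disjoint F₁.verts U → Disjoint F₂.verts U →
                    Disjoint F₁.verts F₂.verts →
                    IsExpansion G F₁ v₁ (D : ℝ) (800 / ε₁ * Real.log n ^ 3) →
                    IsExpansion G F₂ v₂ (D : ℝ) (800 / ε₁ * Real.log n ^ 3) →
                    ∀ ℓ : ℕ, Real.log n ^ 7 ≤ (ℓ : ℝ) → (ℓ : ℝ) ≤ n / Real.log n ^ 10 →
                      ℓ % 2 = piVal G v₁ v₂ % 2 →
                      ∃ w : G.Walk v₁ v₂, w.IsPath ∧ w.length = ℓ ∧
                        ∀ x ∈ w.support, x ∉ U := by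
  classical
  refine ⟨1, one_pos, fun ε₂ hε₀ hε₁ k hk => ?_⟩
  have hK : 10 ≤ ⌈k⌉₊ := by exact_mod_cast hk.trans (Nat.le_ceil k)
  obtain ⟨X₀, hX₀⟩ := Filter.eventually_atTop.mp (eventually_isScale hK)
  obtain ⟨s₀, hs₀⟩ := Filter.eventually_atTop.mp eventually_tiny
  refine ⟨max (max (Real.exp X₀) (1 / ε₂)) (max 40000 (4 * s₀)), ?_⟩
  intro n d hd hdn V _ G hn hsub hbip hG hdeg D hD₁ hD₂ U hU v₁ v₂ F₁ F₂ hU₁ hU₂ hFF hF₁ hF₂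
    ℓ hℓ₁ hℓ₂ hpar
  rw [max_le_iff, max_le_iff, max_le_iff] at hd
  obtain ⟨⟨hd₁, hd₂⟩, hd₃, hd₄⟩ := hd
  have hn0 : (0 : ℝ) < n := by linarith
  obtain ⟨x, hxn⟩ : ∃ x, x = Real.log n := ⟨_, rfl⟩
  rw [← hxn] at hD₁ hD₂ hU hF₁ hF₂ hℓ₁ hℓ₂
  have hnx : (n : ℝ) = Real.exp x := by rw [hxn, Real.exp_log hn0]
  rw [Nat.card_eq_fintype_card] at hn
  subst hn
  obtain ⟨L, hx⟩ := hX₀ x (by rw [hxn]; exact (Real.le_log_iff_exp_le hn0).mpr (hd₁.trans hdn))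
  obtain ⟨P, rfl, hPh, hP⟩ := hx.exists_fits hD₁ ⌈d / 2⌉₊
  have hhd : d / 2 ≤ P.h := hPh ▸ Nat.le_ceil _
  have hhd' : (P.h : ℝ) < d / 2 + 1 := hPh ▸ Nat.ceil_lt_add_one (by linarith)
  have hDK : (D : ℝ) ≤ x ^ ⌈k⌉₊ := by
    refine hD₂.trans ?_
    rw [← Real.rpow_natCast]
    exact Real.rpow_le_rpow_of_exponent_le (by linarith [hx.le_x]) (Nat.le_ceil k)
  have hεd : 1 ≤ ε₂ * d := by
    rw [div_le_iff₀ hε₀] at hd₂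
    linarith
  have hS : Setting G P := by
    refine hx.setting hP hDK hnx hbip (hPh ▸ hsub) (fun v => ?_) ?_ (fun s hs => hs₀ s ?_)
      fun X hX hXV => hG.card_le hdeg hεd (by nlinarith) hX hXV
    · have h1 := hdeg.le_card_nbr v
      have h2 : (2 * P.h : ℝ) < (nbr G v).card + 2 + 1 := by linarith
      exact Nat.lt_succ_iff.mp (by exact_mod_cast h2)
    · have h1 : (20000 : ℝ) ≤ P.h := by linarith
      exact_mod_cast h1
    · have h1 : (P.h : ℝ) ≤ 2 * s := by exact_mod_cast hs
      have h2 : (s₀ : ℝ) ≤ s := by linarith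
      exact_mod_cast h2
  rw [div_one] at hF₁ hF₂
  obtain ⟨hr₁, hc₁⟩ := hF₁.isRad hP.lt_m
  obtain ⟨hr₂, hc₂⟩ := hF₂.isRad hP.lt_m
  have hv : v₁ ≠ v₂ := by
    rintro rfl
    exact Set.disjoint_left.mp hFF (Set.mem_toFinset.mp hr₁.1) (Set.mem_toFinset.mp hr₂.1)
  obtain ⟨w, hw, hwl, hwU⟩ := hS.exists_path_of_fits (U := U.toFinset) hx hP hD₁ hDK hnx
    (by rwa [← Set.ncard_eq_toFinset_card']) hr₁ hr₂ (by exact_mod_cast hc₁)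
    (by exact_mod_cast hc₂) (Set.disjoint_toFinset.mpr hU₁) (Set.disjoint_toFinset.mpr hU₂)
    (Set.disjoint_toFinset.mpr hFF) hℓ₁ hℓ₂ fun w => (hbip.length_mod_two hv w).trans hpar.symm
  exact ⟨w, hw, hwl, fun y hy hyU => hwU y hy (Set.mem_toFinset.mpr hyU)⟩

end Balanced
end

section
/- Let 0 < ε₁ < 1, 0 < ε₂ < 1/20 and s ≥ 1. Then there exist c > 0 and d₀ ∈ ℕ such that the following holds for any n and d with d₀ ≤ d ≤ log^{20s} n. Suppose H is an n-vertex (ε₁, ε₂·d)-expander with minimum degree δ(H) ≥ d/16. Let r = (log log n)^5, let v ∈ V(H), let q ≤ c·d, let P₁, …, P_q be consecutive shortest paths from v in B_H^r(v), and let P = ⋃_i V(P_i). Then |B^r_{H−P+v}(v)| ≥ 2·d²·log^{10} n, where H − P + v denotes the induced subgraph of H on (V(H) \ P) ∪ {v}. -/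
open Real

namespace Balanced

variable {V : Type*}

theorem ballIn_mono_radius (G : SimpleGraph V) (S : Set V) (v : V) {i j : ℕ} (h : i ≤ j) :
    ballIn G S v i ⊆ ballIn G S v j :=
  fun _ ⟨w, hw, hS⟩ => ⟨w, hw.trans h, hS⟩

/-- A neighbour of a ball in `G[S]` which lies in `S` is in the next ball. -/
theorem extNbr_ballIn_inter_subset (G : SimpleGraph V) (S : Set V) (v : V) (i : ℕ) :
    extNbr G (ballIn G S v i) ∩ S ⊆ ballIn G S v (i + 1) := by
  rintro y ⟨⟨-, u, ⟨w, hw, hwS⟩, huy⟩, hyS⟩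
  refine ⟨w.concat huy, by simpa using hw, ?_⟩
  intro x hx
  rw [SimpleGraph.Walk.support_concat] at hx
  simp only [List.mem_append, List.mem_singleton] at hx
  rcases hx with hx | rfl
  · exact hwS x hx
  · exact hyS

/-- Consecutive shortest paths meet the neighbourhood of a ball of radius `i` avoiding them only
among their vertices at positions `1, …, i + 1`. -/
theorem extNbr_ballIn_diff_subset (G : SimpleGraph V) (v : V) {r i q : ℕ} (hi : i ≤ r)
    (P : Fin q → Σ u : V, G.Walk v u) (hP : ConsecSP G v (ballIn G Set.univ v r) P) :
    extNbr G (ballIn G ((⋃ j, suppSet (P j).2)ᶜ ∪ {v}) v i) \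
        ((⋃ j, suppSet (P j).2)ᶜ ∪ {v}) ⊆
      (fun p : Fin q × Fin (i + 1) => (P p.1).2.getVert (p.2 + 1)) '' Set.univ := by
  classical
  rintro y ⟨⟨-, u, ⟨w, hw, hwS⟩, huy⟩, hyS⟩
  simp only [Set.mem_union, Set.mem_compl_iff, Set.mem_iUnion, Set.mem_singleton_iff, not_or,
    not_not] at hyS
  obtain ⟨⟨j, hj⟩, hyv⟩ := hyS
  have hy : y ∈ (P j).2.support := hj
  obtain ⟨hsub, -, hmin⟩ := hP j
  have hlen := hmin ((w.concat huy).append ((P j).2.dropUntil y hy)) (by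
    intro x hx
    have hx' : x ∈ ((w.concat huy).append ((P j).2.dropUntil y hy)).support := hx
    rw [SimpleGraph.Walk.mem_support_append_iff, SimpleGraph.Walk.support_concat] at hx'
    simp only [List.mem_append, List.mem_singleton] at hx'
    rcases hx' with (hx' | rfl) | hx'
    · rcases hwS x hx' with hxP | hxv
      · refine Or.inl ⟨⟨w.takeUntil x hx', ?_, fun _ _ => Set.mem_univ _⟩, ?_⟩
        · exact (w.length_takeUntil_le_length hx').trans (hw.trans hi)
        · intro hxj
          simp only [Set.mem_iUnion] at hxj
          obtain ⟨l, -, hl⟩ := hxj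
          exact hxP (Set.mem_iUnion.2 ⟨l, hl⟩)
      · exact Or.inr hxv
    · exact hsub x hj
    · exact hsub x ((P j).2.support_dropUntil_subset_support hy hx'))
  have hsplit : (P j).2.length
      = ((P j).2.takeUntil y hy).length + ((P j).2.dropUntil y hy).length := by
    rw [← SimpleGraph.Walk.length_append, SimpleGraph.Walk.take_spec]
  rw [SimpleGraph.Walk.length_append, SimpleGraph.Walk.length_concat] at hlen
  have hget : (P j).2.getVert ((P j).2.takeUntil y hy).length = y :=
    SimpleGraph.Walk.getVert_length_takeUntil hy
  have hpos : ((P j).2.takeUntil y hy).length ≠ 0 := by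
    intro h0
    rw [h0, SimpleGraph.Walk.getVert_zero] at hget
    exact hyv hget.symm
  refine ⟨(j, ⟨((P j).2.takeUntil y hy).length - 1, by omega⟩), Set.mem_univ _, ?_⟩
  simp only
  rw [Nat.sub_add_cancel (by omega), hget]

/-- Growth of balls avoiding consecutive shortest paths. -/
theorem ncard_ballIn_succ_ge [Finite V] (G : SimpleGraph V) (v : V) {r i q : ℕ} (hi : i ≤ r)
    (P : Fin q → Σ u : V, G.Walk v u) (hP : ConsecSP G v (ballIn G Set.univ v r) P) :
    (ballIn G ((⋃ j, suppSet (P j).2)ᶜ ∪ {v}) v i).ncard +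
        (extNbr G (ballIn G ((⋃ j, suppSet (P j).2)ᶜ ∪ {v}) v i)).ncard ≤
      (ballIn G ((⋃ j, suppSet (P j).2)ᶜ ∪ {v}) v (i + 1)).ncard + q * (i + 1) := by
  have hdiff := extNbr_ballIn_diff_subset G v hi P hP
  set S : Set V := (⋃ j, suppSet (P j).2)ᶜ ∪ {v}
  set X := ballIn G S v i with hX
  have hloss : (extNbr G X \ S).ncard ≤ q * (i + 1) := by
    refine (Set.ncard_le_ncard hdiff (Set.toFinite _)).trans ?_
    refine (Set.ncard_image_le (Set.toFinite _)).trans ?_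
    simp [Set.ncard_univ]
  have hdisj : Disjoint X (extNbr G X ∩ S) :=
    Set.disjoint_left.2 fun _ hx hy => hy.1.1 hx
  have hsub : X ∪ (extNbr G X ∩ S) ⊆ ballIn G S v (i + 1) :=
    Set.union_subset (ballIn_mono_radius G S v i.le_succ) (extNbr_ballIn_inter_subset G S v i)
  have hcard := Set.ncard_le_ncard hsub (Set.toFinite _)
  rw [Set.ncard_union_eq hdisj (Set.toFinite _) (Set.toFinite _)] at hcard
  have := Set.ncard_inter_add_ncard_sdiff_eq_ncard (extNbr G X) S (Set.toFinite _)
  omega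

theorem extNbr_ballIn_zero (G : SimpleGraph V) {S : Set V} {v : V} (hv : v ∈ S) :
    ballIn G S v 0 = {v} ∧ extNbr G (ballIn G S v 0) = G.neighborSet v := by
  have h0 : ballIn G S v 0 = {v} := by
    ext u
    constructor
    · rintro ⟨w, hw, -⟩
      exact (SimpleGraph.Walk.eq_of_length_eq_zero (Nat.le_zero.1 hw)).symm
    · rintro rfl
      exact ⟨.nil, le_rfl, by simpa using hv⟩
  refine ⟨h0, ?_⟩
  rw [h0]
  ext u
  simp only [extNbr, Set.mem_singleton_iff, exists_eq_left, Set.mem_ofPred_eq,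
    SimpleGraph.mem_neighborSet]
  exact ⟨fun h => h.2, fun h => ⟨h.ne', h⟩⟩

/-- For `t ≥ d / 32`, the expansion `ε(t) t` dominates a multiple of `√(t d)`. -/
theorem epsFn_mul_ge_of_sq_le {ε₁ ε₂ d t b : ℝ} (hε₁ : 0 < ε₁) (hε₂ : 0 < ε₂)
    (hε₂' : ε₂ < 1 / 20) (hd : 0 < d) (ht : d / 32 ≤ t) (hb : b ^ 2 * d ≤ t) :
    ε₁ * ε₂ / 240 * b * d ≤ epsFn ε₁ (ε₂ * d) t * t := by
  have hk : 0 < ε₂ * d := mul_pos hε₂ hd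
  have hnot : ¬ t < ε₂ * d / 5 := by nlinarith
  rw [epsFn, if_neg hnot]
  have htpos : 0 < t := by linarith
  set y := 15 * t / (ε₂ * d) with hy
  have hty : t = ε₂ * d * y / 15 := by rw [hy]; field_simp
  have hy1 : 1 < y := by
    rw [hy, lt_div_iff₀ hk]; nlinarith
  have hlog : 0 < Real.log y := Real.log_pos hy1
  have hy0 : 0 < y := by linarith
  have hlog_le : Real.log y ≤ 4 * √(√y) := by
    have h := Real.log_le_self (Real.sqrt_nonneg (√y))
    rw [Real.log_sqrt (Real.sqrt_nonneg _), Real.log_sqrt hy0.le] at h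
    linarith
  have hsq : Real.log y ^ 2 ≤ 16 * √y := by
    calc Real.log y ^ 2 ≤ (4 * √(√y)) ^ 2 := by gcongr
      _ = 16 * √y := by rw [mul_pow, Real.sq_sqrt (Real.sqrt_nonneg _)]; norm_num
  have hbs : b ≤ √y := by
    apply Real.le_sqrt_of_sq_le
    rw [hy, le_div_iff₀ hk]
    nlinarith [sq_nonneg b, mul_nonneg (sq_nonneg b) hd.le]
  have hss : √y * √y = y := Real.mul_self_sqrt hy0.le
  rw [div_mul_eq_mul_div ε₁, le_div_iff₀ (pow_pos hlog 2)]
  have hc : 0 < ε₁ * ε₂ / 240 * d := by positivity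
  calc ε₁ * ε₂ / 240 * b * d * Real.log y ^ 2
      = (ε₁ * ε₂ / 240 * d) * (b * Real.log y ^ 2) := by ring
    _ ≤ (ε₁ * ε₂ / 240 * d) * (√y * (16 * √y)) := by gcongr
    _ = ε₁ * (ε₂ * d * (√y * √y) / 15) := by ring
    _ = ε₁ * t := by rw [hss, ← hty]

/-- An upper bound on the size gives a lower bound on the expansion rate. -/
theorem epsFn_ge_of_log_le {ε₁ ε₂ d t Λ : ℝ} (hε₁ : 0 < ε₁) (hε₂ : 0 < ε₂)
    (hε₂' : ε₂ < 1 / 20) (hd : 0 < d) (ht : d / 32 ≤ t)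
    (hΛ : Real.log (15 * t / (ε₂ * d)) ≤ Λ) :
    ε₁ / Λ ^ 2 ≤ epsFn ε₁ (ε₂ * d) t := by
  have hk : 0 < ε₂ * d := mul_pos hε₂ hd
  have hnot : ¬ t < ε₂ * d / 5 := by nlinarith
  rw [epsFn, if_neg hnot]
  have hlog : 0 < Real.log (15 * t / (ε₂ * d)) := by
    apply Real.log_pos
    rw [lt_div_iff₀ hk]; nlinarith
  gcongr

/-- A sequence with multiplicative growth after the first step grows exponentially. -/
theorem exp_le_of_growth {t : ℕ → ℝ} {δ : ℝ} (hδ : 0 ≤ δ) (hδ' : δ ≤ 1) {r : ℕ} (h1 : 1 ≤ t 1)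
    (hstep : ∀ i, 1 ≤ i → i < r → t i * (1 + δ) ≤ t (i + 1)) (hr : 1 ≤ r) :
    Real.exp (δ / 2 * (r - 1)) ≤ t r := by
  have hexp : Real.exp (δ / 2) ≤ 1 + δ := by
    rw [← Real.le_log_iff_exp_le (by linarith)]
    refine le_trans ?_ (Real.one_sub_inv_le_log_of_pos (by linarith))
    have : (1 + δ) * (1 + δ)⁻¹ = 1 := mul_inv_cancel₀ (by linarith)
    have h2 : 0 < (1 + δ)⁻¹ := by positivity
    have h3 : 1 / 2 ≤ (1 + δ)⁻¹ := by nlinarith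
    nlinarith
  have key : ∀ i, 1 ≤ i → i ≤ r → Real.exp (δ / 2 * (i - 1)) ≤ t i := by
    intro i hi
    induction i, hi using Nat.le_induction with
    | base => intro _; simpa using h1
    | succ i hi ih =>
      intro hir
      have h := ih (by omega)
      calc Real.exp (δ / 2 * ((i + 1 : ℕ) - 1))
          = Real.exp (δ / 2 * (i - 1)) * Real.exp (δ / 2) := by
            rw [← Real.exp_add]; congr 1; push_cast; ring
        _ ≤ t i * (1 + δ) := by gcongr; exact (Real.exp_pos _).le.trans h
        _ ≤ t (i + 1) := hstep i hi hir
  exact key r hr le_rfl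

/-- The growth estimate: if the loss at radius `i` is at most `q (i + 1)` with `q ≤ c d`, then the
loss never exceeds half of the expansion. -/
theorem size_step {ε₁ ε₂ d q g : ℝ} {t N : ℕ → ℝ} {r : ℕ} (hε₁ : 0 < ε₁) (hε₂ : 0 < ε₂)
    (hε₂' : ε₂ < 1 / 20) (hd : 0 < d) (hg : 0 < g) (hg1 : g ≤ 1 / 12)
    (hg2 : 6 * g ≤ ε₁ * ε₂ / 240) (hq : q ≤ ε₁ * ε₂ / 240 * g / 2 * d)
    (ht1 : d / 32 ≤ t 1) (hmono : Monotone t)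
    (hN : ∀ i, 1 ≤ i → i < r → epsFn ε₁ (ε₂ * d) (t i) * t i ≤ N i)
    (hstep : ∀ i, i < r → t i + N i ≤ t (i + 1) + q * (i + 1)) :
    ∀ i, 1 ≤ i → i < r → t i + epsFn ε₁ (ε₂ * d) (t i) * t i / 2 ≤ t (i + 1) := by
  have hlow : ∀ i, 1 ≤ i → d / 32 ≤ t i := fun i hi => ht1.trans (hmono hi)
  have main : ∀ i, 1 ≤ i → i < r → (g * (i + 1)) ^ 2 * d ≤ t i →
      ε₁ * ε₂ / 240 * (g * (i + 1)) * d ≤ epsFn ε₁ (ε₂ * d) (t i) * t i ∧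
        t i + epsFn ε₁ (ε₂ * d) (t i) * t i / 2 ≤ t (i + 1) := by
    intro i hi hir hsz
    have hE := epsFn_mul_ge_of_sq_le hε₁ hε₂ hε₂' hd (hlow i hi) hsz
    refine ⟨hE, ?_⟩
    have h1 := hN i hi hir
    have h2 := hstep i hir
    have h3 : q * (i + 1) ≤ ε₁ * ε₂ / 240 * g / 2 * d * (i + 1) := by gcongr
    linarith
  have size : ∀ i, 1 ≤ i → i ≤ r → (g * (i + 1)) ^ 2 * d ≤ t i := by
    intro i hi
    induction i, hi using Nat.le_induction with
    | base =>
      intro _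
      refine le_trans ?_ ht1
      have : g ^ 2 ≤ 1 / 144 := by nlinarith
      push_cast
      nlinarith
    | succ i hi ih =>
      intro hir
      have hsz := ih (by omega)
      obtain ⟨hE, hS⟩ := main i hi hir hsz
      have h1 : 6 * g * (g * (i + 1)) * d ≤ ε₁ * ε₂ / 240 * (g * (i + 1)) * d := by gcongr
      have h2 : 0 ≤ g ^ 2 * d := by positivity
      have h3 : (0 : ℝ) ≤ i := Nat.cast_nonneg i
      push_cast
      nlinarith [mul_nonneg h2 h3]
  exact fun i hi hir => (main i hi hir (size i hi hir.le)).2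

/-- Sets of size at most `2 d² L¹⁰` have logarithmic size ratio `O(log L)`. -/
theorem log_ratio_le {ε₂ d L s t : ℝ} (hε₂ : 0 < ε₂) (hd : 0 < d) (hL0 : 0 < L)
    (hLε : 30 / ε₂ ≤ L) (hdL : d ≤ L ^ (20 * s)) (ht : 0 < t) (htL : t ≤ 2 * d ^ 2 * L ^ 10) :
    Real.log (15 * t / (ε₂ * d)) ≤ (20 * s + 11) * Real.log L := by
  rw [← Real.log_rpow hL0]
  refine Real.log_le_log (by positivity) ?_
  rw [div_le_iff₀ (by positivity)]
  have hrw : L ^ (20 * s + 11) = L ^ (20 * s) * L ^ 11 := by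
    rw [Real.rpow_add hL0, ← Real.rpow_natCast L 11]; norm_num
  have h30 : 30 ≤ L * ε₂ := by rwa [div_le_iff₀ hε₂] at hLε
  calc 15 * t ≤ 15 * (2 * d ^ 2 * L ^ 10) := by gcongr
    _ = 30 * (d * L ^ 10 * d) := by ring
    _ ≤ (L * ε₂) * (L ^ (20 * s) * L ^ 10 * d) := by gcongr
    _ = L ^ (20 * s + 11) * (ε₂ * d) := by rw [hrw]; ring

/-- After `(log L)⁵` steps with growth rate of order `(log L)⁻²`, any prescribed power of `L` is
exceeded. -/
theorem rpow_le_exp_growth {ε₁ L s r : ℝ} (hε₁ : 0 < ε₁) (hs : 0 ≤ s) (hL0 : 0 < L)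
    (hℓ2 : 2 ≤ Real.log L) (hbig : 16 * (20 * s + 11) ^ 3 / ε₁ ≤ Real.log L)
    (hr : Real.log L ^ 5 ≤ r) :
    L ^ (40 * s + 11) ≤
      Real.exp (ε₁ / ((20 * s + 11) * Real.log L) ^ 2 / 2 / 2 * (r - 1)) := by
  rw [Real.rpow_def_of_pos hL0]
  apply Real.exp_le_exp.2
  generalize Real.log L = ℓ at *
  have hℓ5 : 2 ≤ ℓ ^ 5 := by
    calc (2 : ℝ) ≤ 2 ^ 5 := by norm_num
      _ ≤ ℓ ^ 5 := by gcongr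
  have hℓ0 : 0 < ℓ := by linarith
  have h1 : ℓ ^ 5 / 2 ≤ r - 1 := by linarith
  have h4 : 40 * s + 11 ≤ 2 * (20 * s + 11) := by linarith
  have hC : 0 < 20 * s + 11 := by linarith
  generalize 20 * s + 11 = C at *
  rw [div_le_iff₀ hε₁] at hbig
  have h2 : ℓ * (40 * s + 11) ≤ ε₁ / (C * ℓ) ^ 2 / 2 / 2 * (ℓ ^ 5 / 2) := by
    have h3 : ε₁ / (C * ℓ) ^ 2 / 2 / 2 * (ℓ ^ 5 / 2) = ε₁ * ℓ ^ 3 / (8 * C ^ 2) := by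
      field_simp; norm_num
    rw [h3, le_div_iff₀ (by positivity)]
    calc ℓ * (40 * s + 11) * (8 * C ^ 2) ≤ ℓ * (2 * C) * (8 * C ^ 2) := by gcongr
      _ = (16 * C ^ 3) * ℓ := by ring
      _ ≤ (ℓ * ε₁) * ℓ := by gcongr
      _ ≤ (ℓ * ε₁) * ℓ ^ 2 := by gcongr; nlinarith
      _ = ε₁ * ℓ ^ 3 := by ring
  exact h2.trans (by gcongr)

/-- The largeness conditions used in the growth argument hold eventually. -/
theorem eventually_large (ε₁ ε₂ s : ℝ) :
    ∀ᶠ L : ℝ in Filter.atTop, 2 ≤ L ∧ 30 / ε₂ ≤ L ∧ 2 ≤ Real.log L ∧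
      16 * (20 * s + 11) ^ 3 / ε₁ ≤ Real.log L ∧
      L ^ (40 * s + 12) ≤ Real.exp L := by
  have hexp : ∀ᶠ L : ℝ in Filter.atTop, L ^ (40 * s + 12) ≤ Real.exp L := by
    have := (isLittleO_rpow_exp_atTop (40 * s + 12)).bound one_pos
    filter_upwards [this, Filter.eventually_ge_atTop 0] with L hL hL0
    rw [one_mul, Real.norm_of_nonneg (Real.exp_pos _).le,
      Real.norm_of_nonneg (Real.rpow_nonneg hL0 _)] at hL
    exact hL
  filter_upwards [Filter.eventually_ge_atTop 2, Filter.eventually_ge_atTop (30 / ε₂),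
    Real.tendsto_log_atTop.eventually_ge_atTop 2,
    Real.tendsto_log_atTop.eventually_ge_atTop (16 * (20 * s + 11) ^ 3 / ε₁), hexp]
    with L h1 h2 h3 h4 h5
  exact ⟨h1, h2, h3, h4, h5⟩

/-- expanding a vertex avoiding few consecutive shortest paths
(Lemma 2.15). -/
theorem statement18 :
    ∀ ε₁ ε₂ s : ℝ, 0 < ε₁ → ε₁ < 1 → 0 < ε₂ → ε₂ < 1 / 20 → 1 ≤ s →
      ∃ (c : ℝ) (d₀ : ℕ), 0 < c ∧
        ∀ (n : ℕ) (d : ℝ), (d₀ : ℝ) ≤ d → d ≤ Real.log n ^ (20 * s) →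
          ∀ (V : Type) [Fintype V] (H : SimpleGraph V), Nat.card V = n →
            IsExpander H ε₁ (ε₂ * d) → MinDegGE H (d / 16) →
              ∀ (v : V) (q : ℕ), (q : ℝ) ≤ c * d →
                ∀ P : Fin q → Σ u : V, H.Walk v u,
                  ConsecSP H v (ballIn H Set.univ v ⌈Real.log (Real.log n) ^ 5⌉₊) P →
                  2 * d ^ 2 * Real.log n ^ 10 ≤
                    ((ballIn H ((⋃ i, suppSet (P i).2)ᶜ ∪ {v}) v
                      ⌈Real.log (Real.log n) ^ 5⌉₊).ncard : ℝ) := by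
  intro ε₁ ε₂ s hε₁ hε₁' hε₂ hε₂' hs
  obtain ⟨L₀, hL₀⟩ := Filter.eventually_atTop.1 (eventually_large ε₁ ε₂ s)
  set β : ℝ := ε₁ * ε₂ / 240 with hβ
  have hβ0 : 0 < β := by positivity
  set g : ℝ := min (1 / 12) (β / 6) with hgdef
  have hg : 0 < g := by rw [hgdef]; positivity
  have hg1 : g ≤ 1 / 12 := min_le_left _ _
  have hg2 : 6 * g ≤ β := by
    have : g ≤ β / 6 := min_le_right _ _
    linarith
  refine ⟨min (β * g / 2) (1 / 32), ⌈(max L₀ 0) ^ (20 * s)⌉₊ + 1, by positivity, ?_⟩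
  intro n d hd₀ hdL V _ H hcard hexp hdeg v q hq P hP
  have hceil := Nat.le_ceil ((max L₀ 0) ^ (20 * s))
  push_cast at hd₀
  have hrp : 0 ≤ (max L₀ 0) ^ (20 * s) := Real.rpow_nonneg (le_max_right _ _) _
  have hd1 : 1 ≤ d := by linarith
  have hd : 0 < d := by linarith
  set L := Real.log n with hL
  have hLnn : 0 ≤ L := Real.log_natCast_nonneg n
  have hLL : L₀ ≤ L := by
    by_contra hlt
    push Not at hlt
    have := Real.rpow_le_rpow hLnn (hlt.le.trans (le_max_left L₀ 0)) (by linarith : 0 ≤ 20 * s)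
    linarith
  obtain ⟨hL2, hLε, hℓ2, hℓbig, hLexp⟩ := hL₀ L hLL
  have hL0 : 0 < L := by linarith
  set ℓ := Real.log L with hℓ
  set r := ⌈ℓ ^ 5⌉₊ with hr
  have hr_ge : ℓ ^ 5 ≤ r := Nat.le_ceil _
  have hℓ5 : 2 ≤ ℓ ^ 5 := by
    calc (2 : ℝ) ≤ 2 ^ 5 := by norm_num
      _ ≤ ℓ ^ 5 := by gcongr
  have hr1 : 1 ≤ r := by
    have : (1 : ℝ) ≤ r := by linarith
    exact_mod_cast this
  have hmonoX := fun {i j : ℕ} (hij : i ≤ j) =>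
    ballIn_mono_radius H ((⋃ i, suppSet (P i).2)ᶜ ∪ {v}) v hij
  have hgrow := fun i (hi : i ≤ r) => ncard_ballIn_succ_ge H v hi P hP
  have hzero := extNbr_ballIn_zero H (S := (⋃ i, suppSet (P i).2)ᶜ ∪ {v}) (v := v)
    (Or.inr rfl)
  set X : ℕ → Set V := ballIn H ((⋃ i, suppSet (P i).2)ᶜ ∪ {v}) v with hX
  by_contra hsmall
  push Not at hsmall
  set t : ℕ → ℝ := fun i => ((X i).ncard : ℝ) with ht
  have htmono : Monotone t := fun i j hij => by
    simp only [ht]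
    exact_mod_cast Set.ncard_le_ncard (hmonoX hij) (Set.toFinite _)
  have hstep : ∀ i, i < r → t i + ((extNbr H (X i)).ncard : ℝ) ≤ t (i + 1) + q * (i + 1) := by
    intro i hi
    simp only [ht]
    exact_mod_cast hgrow i hi.le
  have hq1 : (q : ℝ) ≤ β * g / 2 * d := hq.trans (by gcongr; exact min_le_left _ _)
  have hq2 : (q : ℝ) ≤ 1 / 32 * d := hq.trans (by gcongr; exact min_le_right _ _)
  have hdegv := hdeg v
  have hstep0 := hstep 0 (by omega)
  have ht0 : t 0 = 1 := by simp only [ht]; rw [hzero.1]; simp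
  rw [hzero.2, ht0] at hstep0
  simp only [Nat.cast_zero, zero_add, mul_one] at hstep0
  have ht1 : d / 32 ≤ t 1 := by linarith
  have ht1' : 1 ≤ t 1 := by linarith
  have hdsq : d ^ 2 ≤ L ^ (40 * s) := by
    calc d ^ 2 ≤ (L ^ (20 * s)) ^ 2 := by gcongr
      _ = L ^ (40 * s) := by
        rw [← Real.rpow_natCast, ← Real.rpow_mul hL0.le]; congr 1; push_cast; ring
  have hM : 2 * d ^ 2 * L ^ 10 ≤ L ^ (40 * s + 11) := by
    calc 2 * d ^ 2 * L ^ 10 ≤ L * L ^ (40 * s) * L ^ 10 := by gcongr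
      _ = L ^ (40 * s) * L ^ (11 : ℕ) := by ring
      _ = L ^ (40 * s + 11) := by
        rw [Real.rpow_add hL0, ← Real.rpow_natCast L 11]; norm_num
  have hnpos : 0 < (n : ℝ) := by
    rcases Nat.eq_zero_or_pos n with h | h
    · rw [h] at hL; simp at hL; linarith
    · exact_mod_cast h
  have hMn : 2 * d ^ 2 * L ^ 10 ≤ n / 2 := by
    have h1 : L ^ (40 * s + 12) ≤ n := by
      rw [hL, Real.exp_log hnpos] at hLexp
      exact hLexp
    have h2 : L ^ (40 * s + 12) = L ^ (40 * s + 11) * L := by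
      rw [← Real.rpow_add_one hL0.ne']; congr 1; ring
    have h3 : 0 ≤ L ^ (40 * s + 11) := Real.rpow_nonneg hL0.le _
    nlinarith
  have htlt : ∀ i, i ≤ r → t i < 2 * d ^ 2 * L ^ 10 :=
    fun i hi => (htmono hi).trans_lt hsmall
  have htlow : ∀ i, 1 ≤ i → d / 32 ≤ t i := fun i hi => ht1.trans (htmono hi)
  have hhalf := size_step (N := fun i => ((extNbr H (X i)).ncard : ℝ)) hε₁ hε₂ hε₂' hd hg hg1 hg2
    hq1 ht1 htmono
    (by
      intro i hi hir
      refine hexp (X i) ?_ ?_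
      · have := htlow i hi
        change _ ≤ t i
        nlinarith
      · rw [hcard]
        exact (htlt i hir.le).le.trans hMn) hstep
  set C := 20 * s + 11 with hC
  have hC1 : 1 ≤ C := by linarith
  have hΛ : ∀ i, 1 ≤ i → i < r → Real.log (15 * t i / (ε₂ * d)) ≤ C * ℓ := by
    intro i hi hir
    exact log_ratio_le hε₂ hd hL0 hLε hdL (by linarith [htlow i hi]) (htlt i hir.le).le
  have hℓ0 : 0 < ℓ := by linarith
  set δ := ε₁ / (C * ℓ) ^ 2 / 2 with hδ
  have hδ0 : 0 ≤ δ := by positivity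
  have hδ1 : δ ≤ 1 := by
    have h1 : 1 ≤ (C * ℓ) ^ 2 :=
      one_le_pow₀ (one_le_mul_of_one_le_of_one_le hC1 (by linarith))
    have : ε₁ / (C * ℓ) ^ 2 ≤ 1 := by rw [div_le_one (by positivity)]; linarith
    linarith
  have hrate : ∀ i, 1 ≤ i → i < r → t i * (1 + δ) ≤ t (i + 1) := by
    intro i hi hir
    have h1 := hhalf i hi hir
    have h2 := epsFn_ge_of_log_le hε₁ hε₂ hε₂' hd (htlow i hi) (hΛ i hi hir)
    have htp : 0 < t i := by linarith [htlow i hi]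
    have h3 := mul_le_mul_of_nonneg_right h2 htp.le
    rw [hδ]
    linarith
  have hfin := exp_le_of_growth hδ0 hδ1 ht1' hrate hr1
  have hbig := rpow_le_exp_growth hε₁ (by linarith : 0 ≤ s) hL0 hℓ2 hℓbig hr_ge
  rw [← hℓ, ← hC, ← hδ] at hbig
  have : t r < t r := lt_of_lt_of_le hsmall (hM.trans (hbig.trans hfin))
  exact lt_irrefl _ this

end Balanced
end
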